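/- Let U be a definable group and let V be a definable normal subgroup of U. Then the quotient U/V is definable: there is a definable map π : U → N^k (for some k) whose fibers are exactly the cosets of V, so U/V inherits the structure of a definable group. -/

import Mathlib

open Filter Set Topology

universe u

section OMinPreamble

variable {N : Type u}

section Basic
variable [LinearOrder N]

/-- A finite union of singletons and open intervals (with possibly infinite endpoints). -/
def IsFinUnionPtsIntervals (A : Set N) : Prop :=
  ∃ (k : ℕ) (f : Fin k → Set N),
    (∀ i, (∃ a, f i = {a}) ∨ (∃ a b, f i = Set.Ioo a b) ∨ (∃ a, f i = Set.Ioi a) ∨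
        (∃ b, f i = Set.Iio b) ∨ f i = Set.univ) ∧
    A = ⋃ i, f i

/-- An o-minimal structure on the ordered set `N`: an assignment, to each arity `m`,
of a collection of "definable" subsets of `N^m`, closed under the boolean and
first-order operations, containing the order and all points (parameters), and such
that every definable subset of `N` is a finite union of points and open intervals. -/
structure Struc (N : Type u) [LinearOrder N] where
  Def : ∀ m : ℕ, Set (Fin m → N) → Prop
  def_inter : ∀ {m : ℕ} {A B : Set (Fin m → N)}, Def m A → Def m B → Def m (A ∩ B)
  def_compl : ∀ {m : ℕ} {A : Set (Fin m → N)}, Def m A → Def m Aᶜ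
  def_univ : ∀ m : ℕ, Def m Set.univ
  def_reindex : ∀ {m k : ℕ} (g : Fin m → Fin k) {A : Set (Fin m → N)},
      Def m A → Def k {x | x ∘ g ∈ A}
  def_proj : ∀ {m : ℕ} {A : Set (Fin (m + 1) → N)},
      Def (m + 1) A → Def m {x | ∃ t : N, Fin.snoc x t ∈ A}
  def_lt : Def 2 {x | x 0 < x 1}
  def_pt : ∀ a : N, Def 1 {x | x 0 = a}
  o_min : ∀ {A : Set (Fin 1 → N)}, Def 1 A →
      IsFinUnionPtsIntervals {t : N | (fun _ : Fin 1 => t) ∈ A}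

/-- Index of the pair `(i,j)` in `Fin (n*m)`. -/
def finIdx {n m : ℕ} (i : Fin n) (j : Fin m) : Fin (n * m) :=
  ⟨i.1 * m + j.1, by
    have hi := i.isLt
    have hj := j.isLt
    calc i.1 * m + j.1 < i.1 * m + m := by omega
      _ = (i.1 + 1) * m := by ring
      _ ≤ n * m := Nat.mul_le_mul hi (le_refl m)⟩

def pFst {a b : ℕ} (p : Fin (a * b)) : Fin a :=
  ⟨p.1 / b, by
    have h := p.isLt
    have hb : 0 < b := by
      rcases Nat.eq_zero_or_pos b with h0 | h0
      · subst h0; simp at h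
      · exact h0
    exact (Nat.div_lt_iff_lt_mul hb).mpr h⟩

def pSnd {a b : ℕ} (p : Fin (a * b)) : Fin b :=
  ⟨p.1 % b, by
    have h := p.isLt
    have hb : 0 < b := by
      rcases Nat.eq_zero_or_pos b with h0 | h0
      · subst h0; simp at h
      · exact h0
    exact Nat.mod_lt _ hb⟩

/-- Horner evaluation of the polynomial with coefficients `c` (constant term first)
at `x`, relative to abstract operations. -/
def polyEval {α : Type*} (add mul : α → α → α) (zero : α) {n : ℕ} (c : Fin n → α)
    (x : α) : α :=
  (List.ofFn c).foldr (fun a acc => add a (mul x acc)) zero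

/-- `n`-th power relative to an abstract operation with identity `z`. -/
def opPow {α : Type*} (op : α → α → α) (z : α) (a : α) : ℕ → α
  | 0 => z
  | n + 1 => op a (opPow op z a n)

namespace Struc
variable (S : Struc N)

/-- The function `f`, restricted to the definable set `A ⊆ N^m` and with values in
`N^n`, is definable: its graph is a definable set. -/
def DefFunOn {m n : ℕ} (A : Set (Fin m → N)) (f : (Fin m → N) → (Fin n → N)) : Prop :=
  S.Def (m + n) {z | (z ∘ Fin.castAdd n) ∈ A ∧ f (z ∘ Fin.castAdd n) = z ∘ Fin.natAdd m}

/-- A definable function of two tuple variables. -/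
def DefFun2 {m n k : ℕ} (A : Set (Fin m → N)) (B : Set (Fin n → N))
    (f : (Fin m → N) → (Fin n → N) → (Fin k → N)) : Prop :=
  S.Def (m + n + k) {z |
    (z ∘ Fin.castAdd k ∘ Fin.castAdd n) ∈ A ∧
    (z ∘ Fin.castAdd k ∘ Fin.natAdd m) ∈ B ∧
    f (z ∘ Fin.castAdd k ∘ Fin.castAdd n) (z ∘ Fin.castAdd k ∘ Fin.natAdd m) =
      z ∘ Fin.natAdd (m + n)}

/-- A definable unary function `N → N` on the set `J ⊆ N`. -/
def DefFun1 (J : Set N) (f : N → N) : Prop :=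
  S.Def 2 {z | z 0 ∈ J ∧ f (z 0) = z 1}

/-- A definable curve in `N^k` defined on the set `J ⊆ N`. -/
def DefCurve {k : ℕ} (J : Set N) (σ : N → (Fin k → N)) : Prop :=
  S.DefFunOn {x : Fin 1 → N | x 0 ∈ J} (fun x => σ (x 0))

/-- A definable function of `n` tuple variables from `A^n ⊆ (N^m)^n` to `N^k`. -/
def DefFunN {m k : ℕ} (n : ℕ) (A : Set (Fin m → N))
    (c : (Fin n → (Fin m → N)) → (Fin k → N)) : Prop :=
  S.Def (n * m + k) {z |
    (∀ i : Fin n, (fun j : Fin m => z (Fin.castAdd k (finIdx i j))) ∈ A) ∧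
    c (fun i j => z (Fin.castAdd k (finIdx i j))) = fun j => z (Fin.natAdd (n * m) j)}

end Struc

/-- The filter of neighbourhoods of the "left end" of the set `J ⊆ N`. -/
def leftEndFilter (J : Set N) : Filter N := ⨅ x ∈ J, Filter.principal (J ∩ Set.Iio x)

/-- The filter of neighbourhoods of the "right end" of the set `J ⊆ N`
(for `J` unbounded above this is "`→ +∞` inside `J`"). -/
def rightEndFilter (J : Set N) : Filter N := ⨅ x ∈ J, Filter.principal (J ∩ Set.Ioi x)

/-- `J` is an open interval, with possibly infinite endpoints. -/
def IsOpenIntervalSet (J : Set N) : Prop :=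
  (∃ a b, a < b ∧ J = Set.Ioo a b) ∨ (∃ a, J = Set.Ioi a) ∨ (∃ b, J = Set.Iio b) ∨
    J = Set.univ

end Basic

section Groups
variable [LinearOrder N] [TopologicalSpace N]

/-- The o-minimal dimension of `A ⊆ N^m`: the largest `k` such that the image of `A`
under some projection onto `k` coordinates has nonempty interior in `N^k`
(`N` carrying the order topology and `N^k` the product topology). -/
noncomputable def odim {m : ℕ} (A : Set (Fin m → N)) : ℕ :=
  sSup {k | ∃ p : Fin k → Fin m, Function.Injective p ∧
    (interior ((fun x : Fin m → N => x ∘ p) '' A)).Nonempty}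

/-- A definable group: a definable subset of `N^m` with a group operation whose graph
is definable, together with its (unique) definable manifold topology, i.e. a group
topology which agrees with the ambient topology on a large definable subset. -/
structure DefGroup (S : Struc N) (m : ℕ) where
  carrier : Set (Fin m → N)
  carrier_def : S.Def m carrier
  mul : (Fin m → N) → (Fin m → N) → (Fin m → N)
  one : Fin m → N
  inv : (Fin m → N) → (Fin m → N)
  one_mem : one ∈ carrier
  mul_mem : ∀ ⦃x y : Fin m → N⦄, x ∈ carrier → y ∈ carrier → mul x y ∈ carrier
  inv_mem : ∀ ⦃x : Fin m → N⦄, x ∈ carrier → inv x ∈ carrier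
  mul_assoc' : ∀ ⦃x y z : Fin m → N⦄, x ∈ carrier → y ∈ carrier → z ∈ carrier →
      mul (mul x y) z = mul x (mul y z)
  one_mul' : ∀ ⦃x : Fin m → N⦄, x ∈ carrier → mul one x = x
  inv_mul' : ∀ ⦃x : Fin m → N⦄, x ∈ carrier → mul (inv x) x = one
  mul_graph_def : S.DefFun2 carrier carrier mul
  inv_graph_def : S.DefFunOn carrier inv
  top : TopologicalSpace (Fin m → N)
  contMul : @ContinuousOn ((Fin m → N) × (Fin m → N)) (Fin m → N)
      (@instTopologicalSpaceProd _ _ top top) top (fun p => mul p.1 p.2)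
      (carrier ×ˢ carrier)
  contInv : @ContinuousOn (Fin m → N) (Fin m → N) top top inv carrier
  pillay : ∃ V : Set (Fin m → N), V ⊆ carrier ∧ S.Def m V ∧
      (carrier \ V = ∅ ∨ odim (carrier \ V) < odim carrier) ∧
      (∃ O : Set (Fin m → N), IsOpen[top] O ∧ O ∩ carrier = V) ∧
      ∀ x ∈ V, @nhdsWithin (Fin m → N) top x carrier = nhdsWithin x V

variable {S : Struc N}

/-- The elements of a definable group, as a type. -/
def DefGroup.Elt {m : ℕ} (G : DefGroup S m) : Type u := {x : Fin m → N // x ∈ G.carrier}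

namespace DefGroup

instance {m : ℕ} {G : DefGroup S m} : Mul G.Elt :=
  ⟨fun a b => ⟨G.mul a.1 b.1, G.mul_mem a.2 b.2⟩⟩

instance {m : ℕ} {G : DefGroup S m} : One G.Elt := ⟨⟨G.one, G.one_mem⟩⟩

instance {m : ℕ} {G : DefGroup S m} : Inv G.Elt := ⟨fun a => ⟨G.inv a.1, G.inv_mem a.2⟩⟩

instance instGroupElt {m : ℕ} {G : DefGroup S m} : Group G.Elt :=
  Group.ofLeftAxioms
    (fun a b c => Subtype.ext (G.mul_assoc' a.2 b.2 c.2))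
    (fun a => Subtype.ext (G.one_mul' a.2))
    (fun a => Subtype.ext (G.inv_mul' a.2))

variable {m : ℕ} (G : DefGroup S m)

/-- `H` is a definable subgroup of `G`. -/
def IsDefSubgroup (H : Set (Fin m → N)) : Prop :=
  H ⊆ G.carrier ∧ S.Def m H ∧ G.one ∈ H ∧
    (∀ x ∈ H, ∀ y ∈ H, G.mul x y ∈ H) ∧ (∀ x ∈ H, G.inv x ∈ H)

/-- `H` is a definable normal subgroup of `G`. -/
def IsNormalDefSubgroup (H : Set (Fin m → N)) : Prop :=
  G.IsDefSubgroup H ∧ ∀ g ∈ G.carrier, ∀ h ∈ H, G.mul (G.mul g h) (G.inv g) ∈ H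

/-- The left coset `g·H`. -/
def lcoset (g : Fin m → N) (H : Set (Fin m → N)) : Set (Fin m → N) :=
  {y | ∃ h ∈ H, y = G.mul g h}

/-- `H` has finite index in `G`: finitely many left cosets cover `G`. -/
def FiniteIndex (H : Set (Fin m → N)) : Prop :=
  ∃ F : Finset (Fin m → N), ↑F ⊆ G.carrier ∧ G.carrier ⊆ ⋃ g ∈ F, G.lcoset g H

/-- `G` is definably connected: it has no proper definable subgroup of finite index. -/
def DefinablyConnected : Prop :=
  ∀ H : Set (Fin m → N), G.IsDefSubgroup H → G.FiniteIndex H → H = G.carrier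

def IsAbelian : Prop := ∀ x ∈ G.carrier, ∀ y ∈ G.carrier, G.mul x y = G.mul y x

/-- The center of `G`, as a definable subset. -/
def center : Set (Fin m → N) :=
  {x | x ∈ G.carrier ∧ ∀ y ∈ G.carrier, G.mul x y = G.mul y x}

def TorsionFree : Prop := ∀ x : G.Elt, x ≠ 1 → ∀ n : ℕ, 0 < n → x ^ n ≠ 1

/-- `G` is definably compact: every definable continuous embedding of an open
interval into `G` has limits at both ends of the interval (with respect to the
group's definable manifold topology). -/
def DefinablyCompact : Prop :=
  ∀ J : Set N, IsOpenIntervalSet J → ∀ σ : N → (Fin m → N),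
    S.DefCurve J σ → (∀ t ∈ J, σ t ∈ G.carrier) → Set.InjOn σ J →
    @ContinuousOn N (Fin m → N) _ G.top σ J →
    (∃ c ∈ G.carrier, Filter.Tendsto σ (leftEndFilter J) (@nhds _ G.top c)) ∧
    (∃ d ∈ G.carrier, Filter.Tendsto σ (rightEndFilter J) (@nhds _ G.top d))

/-- `G` is definably semisimple: it has no infinite proper abelian definable normal
subgroup. -/
def DefinablySemisimple : Prop :=
  ¬ ∃ H : Set (Fin m → N), G.IsNormalDefSubgroup H ∧ H.Infinite ∧ H ≠ G.carrier ∧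
      ∀ x ∈ H, ∀ y ∈ H, G.mul x y = G.mul y x

/-- The product of a list of elements of `G`. -/
def listProd : List (Fin m → N) → (Fin m → N)
  | [] => G.one
  | x :: xs => G.mul x (listProd xs)

end DefGroup

/-- A definable homomorphism between definable groups. -/
def IsDefHom {m n : ℕ} (G : DefGroup S m) (H : DefGroup S n)
    (f : (Fin m → N) → (Fin n → N)) : Prop :=
  (∀ x ∈ G.carrier, f x ∈ H.carrier) ∧ S.DefFunOn G.carrier f ∧
  ∀ x ∈ G.carrier, ∀ y ∈ G.carrier, f (G.mul x y) = H.mul (f x) (f y)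

/-- `π` realizes `Q` as the quotient of the subgroup `H` of `U` by the normal
subgroup `V ⊆ H`: a definable surjective homomorphism `H → Q` with fibers the
cosets of `V` (kernel exactly `V`). -/
def IsQuotMap {m k : ℕ} (U : DefGroup S m) (H V : Set (Fin m → N)) (Q : DefGroup S k)
    (π : (Fin m → N) → (Fin k → N)) : Prop :=
  (∀ x ∈ H, π x ∈ Q.carrier) ∧ S.DefFunOn H π ∧
  (∀ x ∈ H, ∀ y ∈ H, π (U.mul x y) = Q.mul (π x) (π y)) ∧
  π '' H = Q.carrier ∧ ∀ x ∈ H, (π x = Q.one ↔ x ∈ V)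

/-- A definable extension `1 → A → U → G → 1`. -/
def IsDefExtension {mA mU mG : ℕ} (A : DefGroup S mA) (U : DefGroup S mU)
    (G : DefGroup S mG) (i : (Fin mA → N) → (Fin mU → N))
    (j : (Fin mU → N) → (Fin mG → N)) : Prop :=
  IsDefHom A U i ∧ IsDefHom U G j ∧ Set.InjOn i A.carrier ∧
  j '' U.carrier = G.carrier ∧
  ∀ u ∈ U.carrier, (j u = G.one ↔ ∃ a ∈ A.carrier, u = i a)

/-- A definable `G`-module: a definable abelian group `A` together with a definable
action of `G` on `A` by (definable) automorphisms. -/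
structure DefModule {mG mA : ℕ} (G : DefGroup S mG) (A : DefGroup S mA) where
  abelian : A.IsAbelian
  act : (Fin mG → N) → (Fin mA → N) → (Fin mA → N)
  act_mem : ∀ ⦃x a⦄, x ∈ G.carrier → a ∈ A.carrier → act x a ∈ A.carrier
  act_one : ∀ ⦃a⦄, a ∈ A.carrier → act G.one a = a
  act_mul : ∀ ⦃x y⦄, x ∈ G.carrier → y ∈ G.carrier → ∀ ⦃a⦄, a ∈ A.carrier →
      act (G.mul x y) a = act x (act y a)
  act_hom : ∀ ⦃x⦄, x ∈ G.carrier → ∀ ⦃a b⦄, a ∈ A.carrier → b ∈ A.carrier →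
      act x (A.mul a b) = A.mul (act x a) (act x b)
  act_def : S.DefFun2 G.carrier A.carrier act

/-- The module `(A, γ)` is trivial. -/
def DefModule.IsTrivial {mG mA : ℕ} {G : DefGroup S mG} {A : DefGroup S mA}
    (γ : DefModule G A) : Prop :=
  ∀ x ∈ G.carrier, ∀ a ∈ A.carrier, γ.act x a = a

/-- The definable extension `1 → A → U → G → 1` is compatible with the `G`-module
`(A, γ)`: conjugation in `U` induces the action `γ` on `A`. -/
def ExtCompatible {mG mA mU : ℕ} {G : DefGroup S mG} {A : DefGroup S mA}
    (γ : DefModule G A) (U : DefGroup S mU) (i : (Fin mA → N) → (Fin mU → N))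
    (j : (Fin mU → N) → (Fin mG → N)) : Prop :=
  ∀ u ∈ U.carrier, ∀ a ∈ A.carrier, i (γ.act (j u) a) = U.mul (U.mul u (i a)) (U.inv u)

/-- Alternating "sum" `x₁ - (x₂ - (x₃ - ⋯))` in a (multiplicatively written abelian)
definable group. -/
def altSum {k : ℕ} (A : DefGroup S k) : List (Fin k → N) → (Fin k → N)
  | [] => A.one
  | x :: xs => A.mul x (A.inv (altSum A xs))

/-- The `i`-th term (`1 ≤ i ≤ n+1`) in the coboundary formula:
`c(g₁,…,g_i g_{i+1},…,g_{n+1})` for `1 ≤ i ≤ n`, and `c(g₁,…,g_n)` for `i = n+1`. -/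
def cobTerm {mG kA : ℕ} (G : DefGroup S mG) {n : ℕ}
    (c : (Fin n → (Fin mG → N)) → (Fin kA → N))
    (g : Fin (n + 1) → (Fin mG → N)) (i : ℕ) : Fin kA → N :=
  if i ≤ n then
    c (fun j : Fin n =>
      if j.1 + 1 < i then g (Fin.castSucc j)
      else if j.1 + 1 = i then G.mul (g (Fin.castSucc j)) (g j.succ)
      else g j.succ)
  else c (fun j : Fin n => g (Fin.castSucc j))

/-- The coboundary `δb` of the definable `n`-cochain `b`:
`δb(g₁,…,g_{n+1}) = γ(g₁)(b(g₂,…,g_{n+1})) + Σ_{i=1}^{n} (−1)^i b(…,g_i g_{i+1},…)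
+ (−1)^{n+1} b(g₁,…,g_n)` (written multiplicatively in the abelian group `A`). -/
def cob {mG kA : ℕ} {G : DefGroup S mG} {A : DefGroup S kA} (γ : DefModule G A)
    {n : ℕ} (b : (Fin n → (Fin mG → N)) → (Fin kA → N))
    (g : Fin (n + 1) → (Fin mG → N)) : Fin kA → N :=
  A.mul (γ.act (g 0) (b (Fin.tail g)))
    (A.inv (altSum A (List.ofFn fun i : Fin (n + 1) => cobTerm G b g (i.1 + 1))))

/-- There is no definable bijection between `X ⊆ N^m` and `Y ⊆ N^k`. -/
def NoDefBijection (S : Struc N) {m k : ℕ} (X : Set (Fin m → N))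
    (Y : Set (Fin k → N)) : Prop :=
  ¬ ∃ f : (Fin m → N) → (Fin k → N), S.DefFunOn X f ∧ (∀ x ∈ X, f x ∈ Y) ∧
      Set.InjOn f X ∧ f '' X = Y

/-- The subgroup `W` of `U` is definably isomorphic to a (finite) direct product of
copies of the one-dimensional group `(J, op)`. -/
def IsProdOfCopies {m : ℕ} (U : DefGroup S m) (W : Set (Fin m → N)) (J : Set N)
    (op : N → N → N) : Prop :=
  ∃ (d : ℕ) (φ : (Fin m → N) → (Fin d → N)),
    S.DefFunOn W φ ∧ Set.InjOn φ W ∧ φ '' W = {z | ∀ i, z i ∈ J} ∧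
    ∀ x ∈ W, ∀ y ∈ W, φ (U.mul x y) = fun i => op (φ x i) (φ y i)

/-- `V` is the internal direct product of the list `parts` of definable subgroups
of `U`: the parts commute pairwise and every element of `V` is uniquely a product
of elements of the parts. -/
def IsInternalDPList {m : ℕ} (U : DefGroup S m) (V : Set (Fin m → N))
    (parts : List (Set (Fin m → N))) : Prop :=
  (∀ P ∈ parts, U.IsDefSubgroup P) ∧
  List.Pairwise (fun P Q => ∀ x ∈ P, ∀ y ∈ Q, U.mul x y = U.mul y x) parts ∧
  (∀ v, v ∈ V ↔ ∃ f : Fin parts.length → (Fin m → N),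
      (∀ i, f i ∈ parts.get i) ∧ v = U.listProd (List.ofFn f)) ∧
  ∀ f g : Fin parts.length → (Fin m → N),
    (∀ i, f i ∈ parts.get i) → (∀ i, g i ∈ parts.get i) →
    U.listProd (List.ofFn f) = U.listProd (List.ofFn g) → f = g

/-- `K` is a definable subgroup of `U`, equipped with its group structure and with
the submanifold topology inherited from `U`. -/
def IsDefSubgroupGrp {m : ℕ} (U K : DefGroup S m) : Prop :=
  K.carrier ⊆ U.carrier ∧ K.one = U.one ∧
  (∀ x ∈ K.carrier, ∀ y ∈ K.carrier, K.mul x y = U.mul x y) ∧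
  (∀ x ∈ K.carrier, K.inv x = U.inv x) ∧
  ∀ x ∈ K.carrier, @nhdsWithin (Fin m → N) K.top x K.carrier
      = @nhdsWithin (Fin m → N) U.top x K.carrier

/-- The abelian definable group `U` has no definably compact parts: there is a chain
of definable subgroups each of whose successive quotients is a one-dimensional
definably connected torsion-free definable group. -/
def NoCompactParts {m : ℕ} (U : DefGroup S m) : Prop :=
  ∃ (n : ℕ) (ch : Fin (n + 1) → Set (Fin m → N)),
    ch 0 = {U.one} ∧ ch (Fin.last n) = U.carrier ∧
    (∀ j, U.IsDefSubgroup (ch j)) ∧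
    (∀ j : Fin n, ch j.castSucc ⊆ ch j.succ) ∧
    ∀ j : Fin n, ∃ (k : ℕ) (Q : DefGroup S k) (π : (Fin m → N) → (Fin k → N)),
      IsQuotMap U (ch j.succ) (ch j.castSucc) Q π ∧
      odim Q.carrier = 1 ∧ Q.DefinablyConnected ∧ Q.TorsionFree

/-- `H` is the definably connected component of the identity of `G`: the smallest
definable subgroup of finite index. -/
def IsIdentityComponent {m : ℕ} (G : DefGroup S m) (H : Set (Fin m → N)) : Prop :=
  G.IsDefSubgroup H ∧ G.FiniteIndex H ∧
    ∀ H' : Set (Fin m → N), G.IsDefSubgroup H' → G.FiniteIndex H' → H ⊆ H'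

/-- A definable (not necessarily unital or associative) ring: a definable abelian
group together with a definable bi-additive multiplication. -/
structure DefRing (S : Struc N) (m : ℕ) where
  grp : DefGroup S m
  comm : grp.IsAbelian
  rmul : (Fin m → N) → (Fin m → N) → (Fin m → N)
  rmul_mem : ∀ ⦃x y⦄, x ∈ grp.carrier → y ∈ grp.carrier → rmul x y ∈ grp.carrier
  left_distrib' : ∀ ⦃x y z⦄, x ∈ grp.carrier → y ∈ grp.carrier → z ∈ grp.carrier →
      rmul x (grp.mul y z) = grp.mul (rmul x y) (rmul x z)
  right_distrib' : ∀ ⦃x y z⦄, x ∈ grp.carrier → y ∈ grp.carrier → z ∈ grp.carrier →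
      rmul (grp.mul x y) z = grp.mul (rmul x z) (rmul y z)
  rmul_graph_def : S.DefFun2 grp.carrier grp.carrier rmul

/-- `H` is a definable left ideal of the definable ring `R`. -/
def DefRing.IsLeftIdeal {m : ℕ} (R : DefRing S m) (H : Set (Fin m → N)) : Prop :=
  R.grp.IsDefSubgroup H ∧ ∀ u ∈ R.grp.carrier, ∀ h ∈ H, R.rmul u h ∈ H

/-- `π` realizes `Q` as the quotient ring of `R` by the (two-sided) ideal `V`. -/
def IsRingQuotMap {m k : ℕ} (R : DefRing S m) (V : Set (Fin m → N)) (Q : DefRing S k)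
    (π : (Fin m → N) → (Fin k → N)) : Prop :=
  IsQuotMap R.grp R.grp.carrier V Q.grp π ∧
  ∀ x ∈ R.grp.carrier, ∀ y ∈ R.grp.carrier, π (R.rmul x y) = Q.rmul (π x) (π y)

/-- The two-sided annihilator of the definable ring `R`. -/
def ringAnn {m : ℕ} (R : DefRing S m) : Set (Fin m → N) :=
  {v | v ∈ R.grp.carrier ∧
    ∀ w ∈ R.grp.carrier, R.rmul v w = R.grp.one ∧ R.rmul w v = R.grp.one}

/-- Iterated ring product `((a·x₁)·x₂)⋯`. -/
def rFold {m : ℕ} (R : DefRing S m) : (Fin m → N) → List (Fin m → N) → (Fin m → N)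
  | a, [] => a
  | a, x :: xs => rFold R (R.rmul a x) xs

/-- An o-minimal expansion of an ordered group, definable in the ambient structure:
a definable subset `J ⊆ N` with a definable ordered abelian group structure
(the induced structure on `J` being the relevant o-minimal expansion). -/
structure OMinGrpExp (S : Struc N) where
  J : Set N
  Jdef : S.Def 1 {x | x 0 ∈ J}
  add : N → N → N
  zero : N
  neg : N → N
  zero_mem : zero ∈ J
  add_mem : ∀ ⦃a b⦄, a ∈ J → b ∈ J → add a b ∈ J
  neg_mem : ∀ ⦃a⦄, a ∈ J → neg a ∈ J
  add_assoc' : ∀ ⦃a b c⦄, a ∈ J → b ∈ J → c ∈ J → add (add a b) c = add a (add b c)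
  add_comm' : ∀ ⦃a b⦄, a ∈ J → b ∈ J → add a b = add b a
  zero_add' : ∀ ⦃a⦄, a ∈ J → add zero a = a
  neg_add' : ∀ ⦃a⦄, a ∈ J → add (neg a) a = zero
  add_lt' : ∀ ⦃a b c⦄, a ∈ J → b ∈ J → c ∈ J → b < c → add a b < add a c
  add_graph_def : S.Def 3 {z | z 0 ∈ J ∧ z 1 ∈ J ∧ add (z 0) (z 1) = z 2}

namespace OMinGrpExp
variable {S : Struc N} (E : OMinGrpExp S)

/-- A subset of `J^k` bounded in `J`. -/
def BoundedSet {k : ℕ} (B : Set (Fin k → N)) : Prop :=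
  ∃ lo ∈ E.J, ∃ hi ∈ E.J, ∀ x ∈ B, ∀ i, lo ≤ x i ∧ x i ≤ hi

/-- The induced structure on `J` is semi-bounded: every definable subset of `J^k`
belongs to every family of sets (closed under the first-order operations relative
to `J`) containing the ordered group structure, all bounded definable sets, and
all definable endomorphisms of `(J, 0, +)`. -/
def SemiBounded : Prop :=
  ∀ (D : ∀ k : ℕ, Set (Fin k → N) → Prop),
    (∀ {k : ℕ} {A B : Set (Fin k → N)}, D k A → D k B → D k (A ∩ B)) →
    (∀ {k : ℕ} {A : Set (Fin k → N)}, D k A → D k ({x | ∀ i, x i ∈ E.J} \ A)) →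
    (∀ k : ℕ, D k {x | ∀ i, x i ∈ E.J}) →
    (∀ {k l : ℕ} (g : Fin k → Fin l) {A : Set (Fin k → N)}, D k A →
        D l {x | (∀ i, x i ∈ E.J) ∧ x ∘ g ∈ A}) →
    (∀ {k : ℕ} {A : Set (Fin (k + 1) → N)}, D (k + 1) A →
        D k {x | (∀ i, x i ∈ E.J) ∧ ∃ t ∈ E.J, Fin.snoc x t ∈ A}) →
    (D 2 {x | (∀ i, x i ∈ E.J) ∧ x 0 < x 1}) →
    (∀ a ∈ E.J, D 1 {x | x 0 = a}) →
    (D 3 {z | (∀ i, z i ∈ E.J) ∧ E.add (z 0) (z 1) = z 2}) →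
    (∀ {k : ℕ} {B : Set (Fin k → N)}, S.Def k B → (∀ x ∈ B, ∀ i, x i ∈ E.J) →
        E.BoundedSet B → D k B) →
    (∀ f : N → N, S.DefFun1 E.J f → (∀ a ∈ E.J, f a ∈ E.J) →
        (∀ ⦃a b⦄, a ∈ E.J → b ∈ E.J → f (E.add a b) = E.add (f a) (f b)) →
        D 2 {z | z 0 ∈ E.J ∧ z 1 ∈ E.J ∧ f (z 0) = z 1}) →
    ∀ {k : ℕ} {A : Set (Fin k → N)}, S.Def k A → (∀ x ∈ A, ∀ i, x i ∈ E.J) → D k A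

end OMinGrpExp

/-- An o-minimal expansion of a real closed field, definable in the ambient
structure: a definable subset `J ⊆ N` with a definable real closed ordered field
structure. -/
structure OMinFieldExp (S : Struc N) where
  J : Set N
  Jdef : S.Def 1 {x | x 0 ∈ J}
  add : N → N → N
  mul : N → N → N
  zero : N
  one : N
  neg : N → N
  inv : N → N
  zero_mem : zero ∈ J
  one_mem : one ∈ J
  zero_ne_one : zero ≠ one
  add_mem : ∀ ⦃a b⦄, a ∈ J → b ∈ J → add a b ∈ J
  mul_mem : ∀ ⦃a b⦄, a ∈ J → b ∈ J → mul a b ∈ J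
  neg_mem : ∀ ⦃a⦄, a ∈ J → neg a ∈ J
  inv_mem : ∀ ⦃a⦄, a ∈ J → inv a ∈ J
  add_assoc' : ∀ ⦃a b c⦄, a ∈ J → b ∈ J → c ∈ J → add (add a b) c = add a (add b c)
  add_comm' : ∀ ⦃a b⦄, a ∈ J → b ∈ J → add a b = add b a
  zero_add' : ∀ ⦃a⦄, a ∈ J → add zero a = a
  neg_add' : ∀ ⦃a⦄, a ∈ J → add (neg a) a = zero
  mul_assoc' : ∀ ⦃a b c⦄, a ∈ J → b ∈ J → c ∈ J → mul (mul a b) c = mul a (mul b c)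
  mul_comm' : ∀ ⦃a b⦄, a ∈ J → b ∈ J → mul a b = mul b a
  one_mul' : ∀ ⦃a⦄, a ∈ J → mul one a = a
  mul_inv' : ∀ ⦃a⦄, a ∈ J → a ≠ zero → mul (inv a) a = one
  distrib' : ∀ ⦃a b c⦄, a ∈ J → b ∈ J → c ∈ J →
      mul a (add b c) = add (mul a b) (mul a c)
  add_lt' : ∀ ⦃a b c⦄, a ∈ J → b ∈ J → c ∈ J → b < c → add a b < add a c
  mul_pos' : ∀ ⦃a b⦄, a ∈ J → b ∈ J → zero < a → zero < b → zero < mul a b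
  sq_root : ∀ ⦃a⦄, a ∈ J → zero ≤ a → ∃ b ∈ J, mul b b = a
  odd_root : ∀ n : ℕ, Odd n → ∀ c : Fin (n + 1) → N, (∀ i, c i ∈ J) →
      c (Fin.last n) ≠ zero → ∃ x ∈ J, polyEval add mul zero c x = zero
  add_graph_def : S.Def 3 {z | z 0 ∈ J ∧ z 1 ∈ J ∧ add (z 0) (z 1) = z 2}
  mul_graph_def : S.Def 3 {z | z 0 ∈ J ∧ z 1 ∈ J ∧ mul (z 0) (z 1) = z 2}

/-- The linearly bounded one-dimensional torsion-free definable group of an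
o-minimal expansion of a real closed field: a definable ordered torsion-free group
structure on `J` with respect to which the induced structure is linearly bounded. -/
structure LinBddGrp {S : Struc N} (E : OMinFieldExp S) where
  op : N → N → N
  z : N
  opneg : N → N
  z_mem : z ∈ E.J
  op_mem : ∀ ⦃a b⦄, a ∈ E.J → b ∈ E.J → op a b ∈ E.J
  opneg_mem : ∀ ⦃a⦄, a ∈ E.J → opneg a ∈ E.J
  op_assoc : ∀ ⦃a b c⦄, a ∈ E.J → b ∈ E.J → c ∈ E.J → op (op a b) c = op a (op b c)
  op_comm : ∀ ⦃a b⦄, a ∈ E.J → b ∈ E.J → op a b = op b a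
  z_op : ∀ ⦃a⦄, a ∈ E.J → op z a = a
  opneg_op : ∀ ⦃a⦄, a ∈ E.J → op (opneg a) a = z
  op_lt : ∀ ⦃a b c⦄, a ∈ E.J → b ∈ E.J → c ∈ E.J → b < c → op a b < op a c
  op_graph_def : S.Def 3 {w | w 0 ∈ E.J ∧ w 1 ∈ E.J ∧ op (w 0) (w 1) = w 2}
  torsion_free : ∀ a ∈ E.J, a ≠ z → ∀ n : ℕ, 0 < n → opPow op z a n ≠ z
  lin_bdd : ∀ f : N → N, S.DefFun1 E.J f → (∀ a ∈ E.J, f a ∈ E.J) →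
      ∃ r : N → N, S.DefFun1 E.J r ∧ (∀ a ∈ E.J, r a ∈ E.J) ∧
        (∀ ⦃a b⦄, a ∈ E.J → b ∈ E.J → r (op a b) = op (r a) (r b)) ∧
        ∃ cst ∈ E.J, Filter.Tendsto (fun x => op (f x) (opneg (r x)))
            (rightEndFilter E.J) (nhds cst)

/-- Multiplication of `n × n` matrices with entries in the definable field `E`. -/
def matMul {S : Struc N} (E : OMinFieldExp S) (n : ℕ) (x y : Fin (n * n) → N) :
    Fin (n * n) → N :=
  fun p =>
    (List.ofFn (fun l : Fin n =>
        E.mul (x (finIdx (pFst p) l)) (y (finIdx l (pSnd p))))).foldr E.add E.zero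

/-- The identity `n × n` matrix with entries in the definable field `E`. -/
def matId {S : Struc N} (E : OMinFieldExp S) (n : ℕ) : Fin (n * n) → N :=
  fun p => if pFst p = pSnd p then E.one else E.zero

/-- The three kinds of division algebras over a real closed field. -/
inductive DivKind : Type
  | real : DivKind
  | cplx : DivKind
  | quat : DivKind

@[reducible] def dkDim : DivKind → ℕ
  | .real => 1
  | .cplx => 2
  | .quat => 4

/-- Multiplication in the division algebra of kind `d` (the field itself, the field
with `√-1` adjoined, or the quaternions), with coordinates in the definable field
`E`. -/
def dkMul {S : Struc N} (E : OMinFieldExp S) :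
    (d : DivKind) → (Fin (dkDim d) → N) → (Fin (dkDim d) → N) → (Fin (dkDim d) → N)
  | .real => fun x y _ => E.mul (x 0) (y 0)
  | .cplx => fun x y i =>
      if i.1 = 0 then E.add (E.mul (x 0) (y 0)) (E.neg (E.mul (x 1) (y 1)))
      else E.add (E.mul (x 0) (y 1)) (E.mul (x 1) (y 0))
  | .quat => fun x y i =>
      if i.1 = 0 then
        E.add (E.mul (x 0) (y 0)) (E.neg (E.add (E.mul (x 1) (y 1))
          (E.add (E.mul (x 2) (y 2)) (E.mul (x 3) (y 3)))))
      else if i.1 = 1 then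
        E.add (E.mul (x 0) (y 1)) (E.add (E.mul (x 1) (y 0))
          (E.add (E.mul (x 2) (y 3)) (E.neg (E.mul (x 3) (y 2)))))
      else if i.1 = 2 then
        E.add (E.mul (x 0) (y 2)) (E.add (E.neg (E.mul (x 1) (y 3)))
          (E.add (E.mul (x 2) (y 0)) (E.mul (x 3) (y 1))))
      else
        E.add (E.mul (x 0) (y 3)) (E.add (E.mul (x 1) (y 2))
          (E.add (E.neg (E.mul (x 2) (y 1))) (E.mul (x 3) (y 0))))

/-- Multiplication in the matrix algebra `M_k(D)` where `D` is the division algebra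
of kind `d` over the definable field `E`; elements are encoded as tuples in
`N^(k·k·dim D)`. -/
def matAlgMul {S : Struc N} (E : OMinFieldExp S) (d : DivKind) (k : ℕ)
    (x y : Fin (k * k * dkDim d) → N) : Fin (k * k * dkDim d) → N :=
  fun p =>
    ((List.ofFn (fun l : Fin k =>
        dkMul E d (fun cc => x (finIdx (finIdx (pFst (pFst p)) l) cc))
          (fun cc => y (finIdx (finIdx l (pSnd (pFst p))) cc)))).foldr
      (fun v w i => E.add (v i) (w i)) (fun _ => E.zero)) (pSnd p)

/-- `(F, +, ·, 0, 1, −, ⁻¹, <)` is a real closed ordered field structure on the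
subset `F ⊆ N^k`. -/
def IsRCFOn {k : ℕ} (F : Set (Fin k → N))
    (fadd fmul : (Fin k → N) → (Fin k → N) → (Fin k → N)) (fzero fone : Fin k → N)
    (fneg finv : (Fin k → N) → (Fin k → N))
    (flt : (Fin k → N) → (Fin k → N) → Prop) : Prop :=
  fzero ∈ F ∧ fone ∈ F ∧ fzero ≠ fone ∧
  (∀ x ∈ F, ∀ y ∈ F, fadd x y ∈ F ∧ fmul x y ∈ F) ∧
  (∀ x ∈ F, fneg x ∈ F ∧ finv x ∈ F) ∧
  (∀ x ∈ F, ∀ y ∈ F, ∀ z ∈ F, fadd (fadd x y) z = fadd x (fadd y z)) ∧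
  (∀ x ∈ F, ∀ y ∈ F, fadd x y = fadd y x) ∧
  (∀ x ∈ F, fadd fzero x = x) ∧
  (∀ x ∈ F, fadd (fneg x) x = fzero) ∧
  (∀ x ∈ F, ∀ y ∈ F, ∀ z ∈ F, fmul (fmul x y) z = fmul x (fmul y z)) ∧
  (∀ x ∈ F, ∀ y ∈ F, fmul x y = fmul y x) ∧
  (∀ x ∈ F, fmul fone x = x) ∧
  (∀ x ∈ F, x ≠ fzero → fmul (finv x) x = fone) ∧
  (∀ x ∈ F, ∀ y ∈ F, ∀ z ∈ F, fmul x (fadd y z) = fadd (fmul x y) (fmul x z)) ∧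
  (∀ x ∈ F, ∀ y ∈ F, flt x y ∨ x = y ∨ flt y x) ∧
  (∀ x ∈ F, ¬ flt x x) ∧
  (∀ x ∈ F, ∀ y ∈ F, ∀ z ∈ F, flt x y → flt y z → flt x z) ∧
  (∀ x ∈ F, ∀ y ∈ F, ∀ z ∈ F, flt y z → flt (fadd x y) (fadd x z)) ∧
  (∀ x ∈ F, ∀ y ∈ F, flt fzero x → flt fzero y → flt fzero (fmul x y)) ∧
  (∀ x ∈ F, (flt fzero x ∨ x = fzero) → ∃ y ∈ F, fmul y y = x) ∧
  (∀ n : ℕ, Odd n → ∀ c : Fin (n + 1) → (Fin k → N), (∀ i, c i ∈ F) →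
      c (Fin.last n) ≠ fzero → ∃ x ∈ F, polyEval fadd fmul fzero c x = fzero)

end Groups

end OMinPreamble

namespace OMin

section Snoc

variable {N : Type u}

/-- `Fin.snoc` with its non-dependent type. -/
def snocN {n : ℕ} (x : Fin n → N) (t : N) : Fin (n + 1) → N := Fin.snoc x t

@[simp] theorem snocN_castSucc {n : ℕ} (x : Fin n → N) (t : N) (i : Fin n) :
    snocN x t i.castSucc = x i := by simp [snocN]

@[simp] theorem snocN_last {n : ℕ} (x : Fin n → N) (t : N) :
    snocN x t (Fin.last n) = t := by simp [snocN]

theorem snocN_init {n : ℕ} (x : Fin (n + 1) → N) :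
    snocN (fun i => x i.castSucc) (x (Fin.last n)) = x := by
  funext i
  refine Fin.lastCases ?_ (fun i => ?_) i <;> simp

@[simp] theorem snocN_inj {n : ℕ} {x y : Fin n → N} {s t : N} :
    snocN x s = snocN y t ↔ x = y ∧ s = t := by
  constructor
  · intro h
    exact ⟨funext fun i => by simpa using congrFun h i.castSucc,
      by simpa using congrFun h (Fin.last n)⟩
  · rintro ⟨rfl, rfl⟩
    rfl

end Snoc

set_option linter.unusedSectionVars false

variable {N : Type u} [LinearOrder N]

/-- Definability of subsets of `N ^ ι` for a finite index type `ι`. -/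
def DI (S : Struc N) {ι : Type} [Fintype ι] (A : Set (ι → N)) : Prop :=
  S.Def (Fintype.card ι) {x | x ∘ Fintype.equivFin ι ∈ A}

section DI

variable {S : Struc N} {ι κ : Type} [Fintype ι] [Fintype κ]

theorem DI_fin {n : ℕ} {A : Set (Fin n → N)} : DI S A ↔ S.Def n A := by
  have key : ∀ (k : ℕ) (e : Fin n ≃ Fin k), S.Def k {x | x ∘ e ∈ A} ↔ S.Def n A := by
    intro k e
    constructor
    · intro h
      have := S.def_reindex e.symm h
      convert this using 1
      ext x
      simp [Function.comp_def]
    · intro h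
      exact S.def_reindex e h
  exact key _ _

theorem DI.reindex (g : ι → κ) {A : Set (ι → N)} (h : DI S A) :
    DI S {x : κ → N | x ∘ g ∈ A} := by
  have := S.def_reindex (fun i => Fintype.equivFin κ (g ((Fintype.equivFin ι).symm i))) h
  unfold DI
  convert this using 1
  ext x
  simp [Function.comp_def]

theorem DI.inter {A B : Set (ι → N)} (hA : DI S A) (hB : DI S B) : DI S (A ∩ B) :=
  S.def_inter hA hB

theorem DI.compl {A : Set (ι → N)} (hA : DI S A) : DI S Aᶜ :=
  S.def_compl hA

theorem DI.univ : DI S (Set.univ : Set (ι → N)) := S.def_univ _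

theorem DI.iInter {σ : Type} [Finite σ] {A : σ → Set (ι → N)} (h : ∀ i, DI S (A i)) :
    DI S (⋂ i, A i) := by
  have : ∀ s : Set σ, s.Finite → DI S (⋂ i ∈ s, A i) := by
    intro s hs
    induction s, hs using Set.Finite.induction_on with
    | empty => simpa using DI.univ
    | insert _ _ ih =>
      rw [Set.biInter_insert]
      exact (h _).inter ih
  simpa using this Set.univ Set.finite_univ

theorem def_proj_many {m n : ℕ} {A : Set (Fin (m + n) → N)} (h : S.Def (m + n) A) :
    S.Def m {x | ∃ t : Fin n → N, Fin.append x t ∈ A} := by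
  induction n with
  | zero =>
    refine Eq.subst (motive := S.Def m) (Set.ext fun x => ?_) h
    constructor
    rotate_left
    · rintro ⟨t, ht⟩
      rwa [Fin.append_right_nil _ _ rfl] at ht
    · intro hx
      refine ⟨Fin.elim0, ?_⟩
      rwa [Fin.append_right_nil _ _ rfl]
  | succ n ih =>
    have := ih (S.def_proj h)
    convert this using 1
    ext x
    constructor
    · rintro ⟨t, ht⟩
      refine ⟨Fin.init t, t (Fin.last n), ?_⟩
      have := Fin.append_snoc x (Fin.init t) (t (Fin.last n))
      rw [Fin.snoc_init_self] at this
      exact this ▸ ht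
    · rintro ⟨t, s, hs⟩
      exact ⟨Fin.snoc t s, by rw [Fin.append_snoc]; exact hs⟩

theorem DI.proj {A : Set (ι ⊕ κ → N)} (h : DI S A) :
    DI S {x : ι → N | ∃ y : κ → N, Sum.elim x y ∈ A} := by
  have h1 : S.Def (Fintype.card ι + Fintype.card κ)
      {z | z ∘ (fun i : ι ⊕ κ => finSumFinEquiv
        (Sum.map (Fintype.equivFin ι) (Fintype.equivFin κ) i)) ∈ A} :=
    DI_fin.1 (h.reindex _)
  have h2 := def_proj_many h1
  unfold DI
  convert h2 using 1
  ext x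
  have : ∀ t : Fin (Fintype.card κ) → N, (Fin.append x t ∘ fun i : ι ⊕ κ => finSumFinEquiv
        (Sum.map (Fintype.equivFin ι) (Fintype.equivFin κ) i)) =
        Sum.elim (x ∘ Fintype.equivFin ι) (t ∘ Fintype.equivFin κ) := by
    intro t
    funext i
    rcases i with i | i <;> simp
  constructor
  · rintro ⟨y, hy⟩
    refine ⟨y ∘ (Fintype.equivFin κ).symm, ?_⟩
    rw [mem_ofPred_eq, this]
    simpa [Function.comp_def] using hy
  · rintro ⟨t, ht⟩
    rw [mem_ofPred_eq, this] at ht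
    exact ⟨_, ht⟩

end DI

variable [DenselyOrdered N] [NoMinOrder N] [NoMaxOrder N] [Nonempty N]

variable (N) in
theorem exists_two_points : ∃ p : N × N, p.1 < p.2 := by
  obtain ⟨a⟩ := ‹Nonempty N›
  obtain ⟨b, hb⟩ := exists_gt a
  exact ⟨(a, b), hb⟩

/-- A type coded in the structure `S`: its points are identified with the points of a
definable set. -/
class DefTy (S : Struc N) (X : Type*) where
  Ix : Type
  [fin : Fintype Ix]
  emb : X → (Ix → N)
  inj : Function.Injective emb
  range_def : DI S (range emb)

attribute [instance] DefTy.fin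

open DefTy

theorem DI.pt {S : Struc N} (a : N) : DI S {x : Unit → N | x () = a} := by
  have := (DI_fin.2 (S.def_pt a)).reindex (κ := Unit) (fun _ => ())
  exact this

theorem DI.lt {S : Struc N} {ι : Type} [Fintype ι] (i j : ι) :
    DI S {x : ι → N | x i < x j} := by
  have := (DI_fin.2 S.def_lt).reindex (κ := ι) ![i, j]
  exact this

theorem DI.eq {S : Struc N} {ι : Type} [Fintype ι] (i j : ι) :
    DI S {x : ι → N | x i = x j} := by
  have := (DI.lt (S := S) i j).compl.inter (DI.lt j i).compl
  convert this using 1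
  ext x
  simp only [mem_ofPred_eq, mem_inter_iff, mem_compl_iff, not_lt]
  constructor
  · intro h; simp [h]
  · intro h; exact le_antisymm h.2 h.1

instance instDefTyBase (S : Struc N) : DefTy S N where
  Ix := Unit
  emb x := fun _ => x
  inj := fun _ _ h => congrFun h ()
  range_def := by
    convert DI.univ (S := S) (ι := Unit) using 1
    ext x
    simp only [mem_range, mem_univ, iff_true]
    exact ⟨x (), rfl⟩

instance instDefTyFin (S : Struc N) (n : ℕ) : DefTy S (Fin n → N) where
  Ix := Fin n
  emb := id
  inj := Function.injective_id
  range_def := by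
    simpa using DI.univ

noncomputable instance instDefTyProp (S : Struc N) : DefTy S Prop where
  Ix := Unit
  emb p := fun _ => open Classical in
    if p then (exists_two_points N).choose.1 else (exists_two_points N).choose.2
  inj := by
    intro p q h
    have h2 := congrFun h ()
    have h1 := (exists_two_points N).choose_spec
    by_cases hp : p <;> by_cases hq : q <;> simp_all [h1.ne, h1.ne']
  range_def := by
    have h := ((DI.pt (S := S) (exists_two_points N).choose.1).compl.inter
      (DI.pt (S := S) (exists_two_points N).choose.2).compl).compl
    convert h using 1
    ext x
    simp only [mem_range, mem_compl_iff, mem_inter_iff, mem_ofPred_eq]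
    constructor
    · rintro ⟨p, rfl⟩
      by_cases hp : p <;> simp [hp]
    · intro hx
      by_cases h1 : x () = (exists_two_points N).choose.1
      · exact ⟨True, by funext i; simp [← h1]⟩
      · have : x () = (exists_two_points N).choose.2 := by tauto
        exact ⟨False, by funext i; simp [← this]⟩

instance instDefTyProd (S : Struc N) (X Y : Type*) [DefTy S X] [DefTy S Y] :
    DefTy S (X × Y) where
  Ix := Ix S X ⊕ Ix S Y
  emb p := Sum.elim (emb p.1) (emb p.2)
  inj := by
    rintro ⟨a, b⟩ ⟨c, d⟩ h
    have h1 : emb (S := S) a = emb c := by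
      funext i; exact congrFun h (Sum.inl i)
    have h2 : emb (S := S) b = emb d := by
      funext i; exact congrFun h (Sum.inr i)
    rw [inj h1, inj h2]
  range_def := by
    have h := ((range_def (S := S) (X := X)).reindex (κ := Ix S X ⊕ Ix S Y) Sum.inl).inter
      ((range_def (S := S) (X := Y)).reindex (κ := Ix S X ⊕ Ix S Y) Sum.inr)
    convert h using 1
    ext z
    constructor
    · rintro ⟨⟨a, b⟩, rfl⟩
      exact ⟨⟨a, by funext i; simp⟩, ⟨b, by funext i; simp⟩⟩
    · rintro ⟨⟨a, ha⟩, ⟨b, hb⟩⟩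
      refine ⟨(a, b), ?_⟩
      simp only [ha, hb]
      funext i
      rcases i with i | i <;> rfl

/-- Definable subsets of a coded type. -/
def DSet (S : Struc N) {X : Type*} [DefTy S X] (A : Set X) : Prop :=
  DI S (emb (S := S) '' A)

variable {S : Struc N} {X Y Z W : Type*} [DefTy S X] [DefTy S Y] [DefTy S Z] [DefTy S W]

theorem DSet.congr {A B : Set X} (hA : DSet S A) (h : ∀ x, x ∈ B ↔ x ∈ A) : DSet S B := by
  rwa [Set.ext h]

theorem DSet.inter {A B : Set X} (hA : DSet S A) (hB : DSet S B) : DSet S (A ∩ B) := by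
  unfold DSet
  rw [image_inter inj]
  exact DI.inter hA hB

theorem DSet.univ : DSet S (Set.univ : Set X) := by
  unfold DSet
  rw [image_univ]
  exact range_def

theorem DSet.compl {A : Set X} (hA : DSet S A) : DSet S Aᶜ := by
  unfold DSet
  rw [← range_sdiff_image inj, diff_eq]
  exact DI.inter range_def (DI.compl hA)

/-- Maps that only rearrange coordinates. -/
def CoordMap (S : Struc N) {X Y : Type*} [DefTy S X] [DefTy S Y] (f : X → Y) : Prop :=
  ∃ g : Ix S Y → Ix S X, ∀ x, emb (S := S) (f x) = emb x ∘ g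

theorem DSet.coordPreimage {f : X → Y} (hf : CoordMap S f) {A : Set Y} (hA : DSet S A) :
    DSet S (f ⁻¹' A) := by
  obtain ⟨g, hg⟩ := hf
  unfold DSet
  convert DI.inter (range_def (S := S) (X := X)) (DI.reindex g hA) using 1
  ext z
  constructor
  · rintro ⟨x, hx, rfl⟩
    exact ⟨⟨x, rfl⟩, ⟨f x, hx, hg x⟩⟩
  · rintro ⟨⟨x, rfl⟩, ⟨y, hy, hxy⟩⟩
    refine ⟨x, ?_, rfl⟩
    rw [← hg] at hxy
    rw [mem_preimage, ← inj hxy]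
    exact hy

theorem CoordMap.id : CoordMap S (fun x : X => x) := ⟨_root_.id, fun _ => rfl⟩
theorem CoordMap.fst : CoordMap S (Prod.fst : X × Y → X) := ⟨Sum.inl, fun _ => rfl⟩
theorem CoordMap.snd : CoordMap S (Prod.snd : X × Y → Y) := ⟨Sum.inr, fun _ => rfl⟩
theorem CoordMap.comp {g : Y → Z} {f : X → Y} (hg : CoordMap S g) (hf : CoordMap S f) :
    CoordMap S (fun x => g (f x)) := by
  obtain ⟨a, ha⟩ := hf
  obtain ⟨b, hb⟩ := hg
  exact ⟨a ∘ b, fun x => by rw [hb, ha]; rfl⟩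
theorem CoordMap.prodMk {f : X → Y} {g : X → Z} (hf : CoordMap S f) (hg : CoordMap S g) :
    CoordMap S (fun x => (f x, g x)) := by
  obtain ⟨a, ha⟩ := hf
  obtain ⟨b, hb⟩ := hg
  refine ⟨Sum.elim a b, fun x => ?_⟩
  funext i
  rcases i with i | i
  · exact congrFun (ha x) i
  · exact congrFun (hb x) i
theorem CoordMap.apply {n : ℕ} (i : Fin n) : CoordMap S (fun x : Fin n → N => x i) :=
  ⟨fun _ => i, fun _ => rfl⟩

theorem DSet.proj {A : Set (X × Y)} (hA : DSet S A) : DSet S {x | ∃ y, (x, y) ∈ A} := by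
  have := DI.proj (ι := Ix S X) (κ := Ix S Y) hA
  unfold DSet
  convert this using 1
  ext z
  constructor
  · rintro ⟨x, ⟨y, hy⟩, rfl⟩
    exact ⟨emb y, ⟨(x, y), hy, rfl⟩⟩
  · rintro ⟨t, ⟨⟨x, y⟩, hxy, he⟩⟩
    refine ⟨x, ⟨y, hxy⟩, ?_⟩
    funext i
    exact congrFun he (Sum.inl i)

theorem DSet.diag : DSet S {p : X × X | p.1 = p.2} := by
  have h := (range_def (S := S) (X := X × X)).inter (DI.iInter (σ := Ix S X)
    (fun i => DI.eq (S := S) (ι := Ix S X ⊕ Ix S X) (Sum.inl i) (Sum.inr i)))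
  unfold DSet
  convert h using 1
  ext z
  constructor
  · rintro ⟨⟨x, y⟩, hxy, rfl⟩
    obtain rfl : x = y := hxy
    exact ⟨⟨_, rfl⟩, mem_iInter.2 fun _ => rfl⟩
  · rintro ⟨⟨⟨x, y⟩, rfl⟩, h⟩
    refine ⟨(x, y), ?_, rfl⟩
    apply inj (S := S)
    funext i
    exact mem_iInter.1 h i

/-- Definable maps between coded types. A map to `Prop` is definable when the set it
describes is. -/
@[fun_prop]
def DM (S : Struc N) {X Y : Type*} [DefTy S X] [DefTy S Y] (f : X → Y) : Prop :=
  DSet S {p : X × Y | p.2 = f p.1}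

theorem CoordMap.dm {f : X → Y} (hf : CoordMap S f) : DM S f :=
  DSet.diag.coordPreimage (CoordMap.snd.prodMk (hf.comp CoordMap.fst))

theorem DM.preimage {f : X → Y} (hf : DM S f) {A : Set Y} (hA : DSet S A) :
    DSet S (f ⁻¹' A) := by
  refine (DSet.inter hf (hA.coordPreimage CoordMap.snd)).proj.congr fun x => ?_
  simp

@[fun_prop]
theorem DM.id' : DM S (fun x : X => x) := CoordMap.id.dm

@[fun_prop]
theorem DM.comp' {g : Y → Z} {f : X → Y} (hg : DM S g) (hf : DM S f) :
    DM S (fun x => g (f x)) := by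
  have h1 : DSet S {q : (X × Z) × Y | q.2 = f q.1.1} :=
    hf.coordPreimage ((CoordMap.fst.comp CoordMap.fst).prodMk CoordMap.snd)
  have h2 : DSet S {q : (X × Z) × Y | q.1.2 = g q.2} :=
    hg.coordPreimage (CoordMap.snd.prodMk (CoordMap.snd.comp CoordMap.fst))
  have := (h1.inter h2).proj
  refine this.congr fun ⟨x, z⟩ => ?_
  simp

theorem DSet.point_Prop : DSet S {p : Prop | p} := by
  refine Eq.subst (motive := DI S) (Set.ext fun z => ?_)
    (DI.pt (S := S) (exists_two_points N).choose.1)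
  constructor
  rotate_left
  · rintro ⟨p, hp, rfl⟩
    simp only [mem_ofPred_eq] at hp
    simp only [emb, hp, if_true]
    exact rfl
  · intro hz
    refine ⟨True, trivial, ?_⟩
    funext i
    simp only [emb, if_true]
    exact Eq.symm hz

theorem dm_iff_dset {P : X → Prop} : DM S P ↔ DSet S {x | P x} := by
  constructor
  · intro h
    exact h.preimage DSet.point_Prop
  · intro h
    have h1 : DSet S {p : X × Prop | p.2} := DSet.point_Prop.coordPreimage CoordMap.snd
    have h2 : DSet S {p : X × Prop | P p.1} := h.coordPreimage CoordMap.fst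
    have := ((h1.inter h2).compl.inter (h1.compl.inter h2.compl).compl).compl
    refine Eq.subst (motive := DSet S) (Set.ext fun ⟨x, p⟩ => ?_) this
    simp only [mem_ofPred_eq, mem_compl_iff, mem_inter_iff, eq_iff_iff]
    tauto

theorem DM.pred {P : X → Prop} (h : DM S P) : DSet S {x | P x} := dm_iff_dset.1 h

theorem DM.congr {f g : X → Y} (hf : DM S f) (h : ∀ x, g x = f x) : DM S g := by
  rwa [show g = f from funext h]

theorem DM.iff_congr {P Q : X → Prop} (hf : DM S P) (h : ∀ x, Q x ↔ P x) : DM S Q :=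
  hf.congr fun x => propext (h x)

theorem DSet.mem {A : Set X} (hA : DSet S A) : DM S (fun x => x ∈ A) := dm_iff_dset.2 hA

theorem DSet.mem_comp {A : Set Y} (hA : DSet S A) {f : X → Y} (hf : DM S f) :
    DM S (fun x => f x ∈ A) := hA.mem.comp' hf

@[fun_prop]
theorem DM.fst' {f : X → Y × Z} (hf : DM S f) : DM S (fun x => (f x).1) :=
  CoordMap.fst.dm.comp' hf

@[fun_prop]
theorem DM.snd' {f : X → Y × Z} (hf : DM S f) : DM S (fun x => (f x).2) :=
  CoordMap.snd.dm.comp' hf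

@[fun_prop]
theorem DM.prodMk {f : X → Y} {g : X → Z} (hf : DM S f) (hg : DM S g) :
    DM S (fun x => (f x, g x)) := by
  have h1 : DSet S {q : X × (Y × Z) | q.2.1 = f q.1} :=
    hf.coordPreimage (CoordMap.fst.prodMk (CoordMap.fst.comp CoordMap.snd))
  have h2 : DSet S {q : X × (Y × Z) | q.2.2 = g q.1} :=
    hg.coordPreimage (CoordMap.fst.prodMk (CoordMap.snd.comp CoordMap.snd))
  refine (h1.inter h2).congr fun ⟨x, y, z⟩ => ?_
  simp

@[fun_prop]
theorem DM.eq {f g : X → Y} (hf : DM S f) (hg : DM S g) : DM S (fun x => f x = g x) :=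
  (dm_iff_dset.2 DSet.diag).comp' (hf.prodMk hg)

@[fun_prop]
theorem DM.and {P Q : X → Prop} (hP : DM S P) (hQ : DM S Q) : DM S (fun x => P x ∧ Q x) :=
  dm_iff_dset.2 (hP.pred.inter hQ.pred)

@[fun_prop]
theorem DM.not {P : X → Prop} (hP : DM S P) : DM S (fun x => ¬ P x) :=
  dm_iff_dset.2 hP.pred.compl

@[fun_prop]
theorem DM.or {P Q : X → Prop} (hP : DM S P) (hQ : DM S Q) : DM S (fun x => P x ∨ Q x) :=
  (hP.not.and hQ.not).not.iff_congr fun x => by tauto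

@[fun_prop]
theorem DM.imp {P Q : X → Prop} (hP : DM S P) (hQ : DM S Q) : DM S (fun x => P x → Q x) :=
  (hP.not.or hQ).iff_congr fun x => by tauto

@[fun_prop]
theorem DM.exists {P : X → Y → Prop} (hP : DM S (fun p : X × Y => P p.1 p.2)) :
    DM S (fun x => ∃ y, P x y) :=
  dm_iff_dset.2 hP.pred.proj

@[fun_prop]
theorem DM.forall {P : X → Y → Prop} (hP : DM S (fun p : X × Y => P p.1 p.2)) :
    DM S (fun x => ∀ y, P x y) :=
  (DM.exists (P := fun x y => ¬ P x y) hP.not).not.iff_congr fun x => by simp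

theorem DSet.singleton (c : X) : DSet S {c} := by
  refine Eq.subst (motive := DI S) (Set.ext fun z => ?_) (DI.inter (range_def (S := S) (X := X))
    (DI.iInter (σ := Ix S X) fun i =>
      (DI.pt (emb (S := S) c i)).reindex (κ := Ix S X) fun _ => i))
  constructor
  · rintro ⟨⟨x, rfl⟩, h⟩
    refine ⟨x, ?_, rfl⟩
    exact inj (funext fun i => mem_iInter.1 h i)
  · rintro ⟨x, rfl, rfl⟩
    exact ⟨⟨_, rfl⟩, mem_iInter.2 fun _ => rfl⟩

@[fun_prop]
theorem DM.const (c : Y) : DM S (fun _ : X => c) :=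
  ((DSet.singleton c).coordPreimage (CoordMap.snd (X := X) (Y := Y))).congr fun _ => Iff.rfl

theorem DSet.lt : DSet S {p : N × N | p.1 < p.2} := by
  refine Eq.subst (motive := DI S) (Set.ext fun z => ?_)
    (DI.lt (S := S) (ι := Unit ⊕ Unit) (Sum.inl ()) (Sum.inr ()))
  constructor
  · intro h
    refine ⟨(z (Sum.inl ()), z (Sum.inr ())), h, ?_⟩
    funext i
    rcases i with i | i <;> rfl
  · rintro ⟨⟨x, y⟩, h, rfl⟩
    exact h

@[fun_prop]
theorem DM.lt {f g : X → N} (hf : DM S f) (hg : DM S g) : DM S (fun x => f x < g x) :=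
  (dm_iff_dset.2 DSet.lt).comp' (hf.prodMk hg)

@[fun_prop]
theorem DM.le {f g : X → N} (hf : DM S f) (hg : DM S g) : DM S (fun x => f x ≤ g x) :=
  (hg.lt hf).not.iff_congr fun x => by simp

@[fun_prop]
theorem DM.apply' {n : ℕ} (i : Fin n) : DM S (fun x : Fin n → N => x i) :=
  (CoordMap.apply i).dm

theorem DM.apply {n : ℕ} {f : X → Fin n → N} (hf : DM S f) (i : Fin n) :
    DM S (fun x => f x i) := (CoordMap.apply i).dm.comp' hf

theorem DM.finForall {ι : Type*} [Finite ι] {P : ι → X → Prop} (h : ∀ i, DM S (P i)) :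
    DM S (fun x => ∀ i, P i x) := by
  have : ∀ s : Set ι, s.Finite → DM S (fun x => ∀ i ∈ s, P i x) := by
    intro s hs
    induction s, hs using Set.Finite.induction_on with
    | empty => exact (DM.const True).iff_congr fun x => by simp
    | @insert a s _ _ ih => exact ((h a).and ih).iff_congr fun x => by simp
  exact (this Set.univ Set.finite_univ).iff_congr fun x => by simp

theorem DM.finExists {ι : Type*} [Finite ι] {P : ι → X → Prop} (h : ∀ i, DM S (P i)) :
    DM S (fun x => ∃ i, P i x) :=
  (DM.finForall fun i => (h i).not).not.iff_congr fun x => by simp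

@[fun_prop]
theorem DM.pi {n : ℕ} {f : X → Fin n → N} (h : ∀ i, DM S (fun x => f x i)) : DM S f := by
  have : DM S (fun p : X × (Fin n → N) => ∀ i, p.2 i = f p.1 i) :=
    DM.finForall fun i => (DM.apply (by fun_prop) i).eq ((h i).comp' (by fun_prop))
  refine this.pred.congr fun p => ?_
  simp only [mem_ofPred_eq, funext_iff]

/-- A map whose graph is described by a definable relation is definable. -/
theorem DM.of_rel {f : X → Y} (R : X → Y → Prop) (hR : DM S (fun p : X × Y => R p.1 p.2))
    (h : ∀ x y, y = f x ↔ R x y) : DM S f :=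
  hR.pred.congr fun p => h p.1 p.2

theorem DM.ite {P : X → Prop} [DecidablePred P] {f g : X → Y} (hP : DM S P) (hf : DM S f)
    (hg : DM S g) : DM S (fun x => if P x then f x else g x) := by
  refine DM.of_rel (fun x y => (P x ∧ y = f x) ∨ (¬ P x ∧ y = g x)) (by fun_prop) fun x y => ?_
  by_cases h : P x <;> simp [h]

theorem DM.bijOn_inv {f : X → Y} (hf : DM S f) {g : Y → X} {A : Set X} (hA : DSet S A)
    (hinj : InjOn f A) (c : X) (hg : ∀ x ∈ A, g (f x) = x) (hg' : ∀ y, y ∉ f '' A → g y = c) :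
    DM S g := by
  have hA' := hA.mem
  refine DM.of_rel (fun y x => (x ∈ A ∧ f x = y) ∨ ((¬ ∃ z, z ∈ A ∧ f z = y) ∧ x = c)) ?_ ?_
  · have : DM S (fun p : Y × X => p.2 ∈ A) := hA.mem_comp (by fun_prop)
    have h2 : DM S (fun p : (Y × X) × X => p.2 ∈ A) := hA.mem_comp (by fun_prop)
    fun_prop
  · intro y x
    by_cases hy : y ∈ f '' A
    · obtain ⟨z, hz, rfl⟩ := hy
      rw [hg z hz]
      constructor
      · rintro rfl; exact Or.inl ⟨hz, rfl⟩
      · rintro (⟨h1, h2⟩ | ⟨h1, -⟩)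
        · exact hinj h1 hz h2
        · exact absurd ⟨z, hz, rfl⟩ h1
    · rw [hg' y hy]
      constructor
      · intro h; exact Or.inr ⟨hy, h⟩
      · rintro (⟨h1, h2⟩ | ⟨-, h⟩)
        · exact absurd ⟨x, h1, h2⟩ hy
        · exact h

theorem DSet.union {A B : Set X} (hA : DSet S A) (hB : DSet S B) : DSet S (A ∪ B) :=
  (hA.mem.or hB.mem).pred

theorem DSet.diff {A B : Set X} (hA : DSet S A) (hB : DSet S B) : DSet S (A \ B) :=
  (hA.mem.and hB.mem.not).pred

theorem DSet.image {A : Set X} (hA : DSet S A) {f : X → Y} (hf : DM S f) : DSet S (f '' A) := by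
  have : DM S (fun p : Y × X => p.2 ∈ A) := hA.mem_comp (by fun_prop)
  exact DM.pred (P := fun y => ∃ x, x ∈ A ∧ f x = y) (by fun_prop)

theorem DSet.fin_iff {n : ℕ} {A : Set (Fin n → N)} : DSet S A ↔ S.Def n A := by
  rw [← DI_fin]
  unfold DSet
  simp only [emb, image_id]

@[fun_prop]
theorem DM.update {n : ℕ} {f : X → Fin n → N} {g : X → N} (hf : DM S f) (hg : DM S g)
    (i : Fin n) : DM S (fun x => Function.update (f x) i (g x)) := by
  refine DM.pi fun j => ?_
  by_cases h : j = i
  · subst h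
    simpa using hg
  · simpa [h] using hf.apply j

@[fun_prop]
theorem DM.snocN {n : ℕ} {f : X → Fin n → N} {g : X → N} (hf : DM S f) (hg : DM S g) :
    DM S (fun x => snocN (f x) (g x)) := by
  refine DM.pi fun j => ?_
  refine Fin.lastCases ?_ (fun j => ?_) j
  · simpa using hg
  · simpa using hf.apply j

end OMin

namespace OMin

variable {N : Type u} [LinearOrder N] [DenselyOrdered N] [NoMinOrder N] [NoMaxOrder N]
  [Nonempty N] {S : Struc N} {X Y Z W : Type*} [DefTy S X] [DefTy S Y] [DefTy S Z] [DefTy S W]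

theorem DSet.isFinUnion {A : Set N} (hA : DSet S A) : IsFinUnionPtsIntervals A := by
  have h1 : DSet S {x : Fin 1 → N | x 0 ∈ A} := hA.coordPreimage (CoordMap.apply 0)
  have := S.o_min (DSet.fin_iff.1 h1)
  exact this

section Order

theorem DSet.exists_Ioo_subset {A : Set N} (hA : DSet S A) (hinf : A.Infinite) :
    ∃ a b, a < b ∧ Ioo a b ⊆ A := by
  obtain ⟨k, f, hf, rfl⟩ := hA.isFinUnion
  have : ∃ i, (f i).Infinite := by
    by_contra h
    push Not at h
    exact hinf (Set.finite_iUnion h)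
  obtain ⟨i, hi⟩ := this
  have hsub := subset_iUnion f i
  rcases hf i with ⟨a, h⟩ | ⟨a, b, h⟩ | ⟨a, h⟩ | ⟨b, h⟩ | h
  · rw [h] at hi
    exact absurd (Set.finite_singleton a) hi
  · rw [h] at hi hsub
    obtain ⟨c, hc⟩ := hi.nonempty
    exact ⟨a, b, hc.1.trans hc.2, hsub⟩
  · obtain ⟨b, hb⟩ := exists_gt a
    exact ⟨a, b, hb, fun x hx => hsub (h ▸ hx.1)⟩
  · obtain ⟨a, ha⟩ := exists_lt b
    exact ⟨a, b, ha, fun x hx => hsub (h ▸ hx.2)⟩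
  · obtain ⟨a⟩ := ‹Nonempty N›
    obtain ⟨b, hb⟩ := exists_gt a
    exact ⟨a, b, hb, fun x hx => hsub (h ▸ mem_univ x)⟩

theorem DSet.infinite_iff {A : Set N} (hA : DSet S A) :
    A.Infinite ↔ ∃ a b, a < b ∧ ∀ y, a < y → y < b → y ∈ A := by
  constructor
  · intro h
    obtain ⟨a, b, hab, h⟩ := hA.exists_Ioo_subset h
    exact ⟨a, b, hab, fun y h1 h2 => h ⟨h1, h2⟩⟩
  · rintro ⟨a, b, hab, h⟩
    exact (Ioo_infinite hab).mono fun y hy => h y hy.1 hy.2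

/-- Sections of definable families. -/
theorem DM.section {T : X → Y → Z} (hT : DM S (fun p : X × Y => T p.1 p.2)) (x : X) :
    DM S (T x) := hT.comp' (f := fun y => (x, y)) (by fun_prop)

theorem DM.sectionSet {T : X → Y → Prop} (hT : DM S (fun p : X × Y => T p.1 p.2)) (x : X) :
    DSet S {y | T x y} := (hT.section x).pred

@[fun_prop]
theorem DM.infinite {T : X → N → Prop} (hT : DM S (fun p : X × N => T p.1 p.2)) :
    DM S (fun x => {y | T x y}.Infinite) :=
  DM.iff_congr (P := fun x => ∃ a b, a < b ∧ ∀ y, a < y → y < b → T x y) (by fun_prop)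
    fun x => (hT.sectionSet x).infinite_iff

theorem DSet.exists_isLUB {A : Set N} (hA : DSet S A) (hne : A.Nonempty) (hb : BddAbove A) :
    ∃ s, IsLUB A s := by
  obtain ⟨k, f, hf, rfl⟩ := hA.isFinUnion
  have key : ∀ s : Finset (Fin k), (⋃ i ∈ s, f i).Nonempty → BddAbove (⋃ i ∈ s, f i) →
      ∃ c, IsLUB (⋃ i ∈ s, f i) c := by
    intro s
    induction s using Finset.induction_on with
    | empty => intro h; simp at h
    | insert i s _ ih =>
      intro hne' hbdd
      rw [Finset.set_biUnion_insert] at hne' hbdd ⊢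
      rw [bddAbove_union] at hbdd
      have hi : (f i).Nonempty → ∃ c, IsLUB (f i) c := by
        intro hne
        have hbd := hbdd.1
        rcases hf i with ⟨a, h⟩ | ⟨a, b, h⟩ | ⟨a, h⟩ | ⟨b, h⟩ | h
        · rw [h]; exact ⟨a, isLUB_singleton⟩
        · rw [h] at hne ⊢
          obtain ⟨c, hc⟩ := hne
          exact ⟨b, isLUB_Ioo (hc.1.trans hc.2)⟩
        · rw [h] at hbd; exact absurd hbd (not_bddAbove_Ioi a)
        · rw [h]; exact ⟨b, isLUB_Iio⟩
        · rw [h] at hbd; exact absurd hbd not_bddAbove_univ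
      rcases (f i).eq_empty_or_nonempty with h1 | h1
      · rw [h1, empty_union] at hne' ⊢
        exact ih hne' hbdd.2
      · obtain ⟨c, hc⟩ := hi h1
        rcases (⋃ i ∈ s, f i).eq_empty_or_nonempty with h2 | h2
        · rw [h2, union_empty]; exact ⟨c, hc⟩
        · obtain ⟨d, hd⟩ := ih h2 hbdd.2
          exact ⟨_, hc.union hd⟩
  simpa using key Finset.univ (by simpa using hne) (by simpa using hb)

theorem DSet.exists_isGLB {A : Set N} (hA : DSet S A) (hne : A.Nonempty) (hb : BddBelow A) :
    ∃ s, IsGLB A s := by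
  have h1 : DSet S (lowerBounds A) := by
    have := hA.mem
    exact DM.pred (P := fun b => ∀ a, a ∈ A → b ≤ a) (by fun_prop)
  obtain ⟨c, hc⟩ := h1.exists_isLUB hb hne.bddAbove_lowerBounds
  exact ⟨c, (isLUB_lowerBounds).1 hc⟩

open Classical in
/-- Supremum of a subset of `N`, with an arbitrary value when there is none. -/
noncomputable def dSup (A : Set N) : N :=
  if h : ∃ s, IsLUB A s then h.choose else Classical.arbitrary N

open Classical in
/-- Infimum of a subset of `N`, with an arbitrary value when there is none. -/
noncomputable def dInf (A : Set N) : N :=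
  if h : ∃ s, IsGLB A s then h.choose else Classical.arbitrary N

theorem dSup_eq {A : Set N} {s : N} (h : IsLUB A s) : dSup A = s := by
  have h' : ∃ s, IsLUB A s := ⟨s, h⟩
  rw [dSup, dif_pos h']
  exact h'.choose_spec.unique h

theorem dInf_eq {A : Set N} {s : N} (h : IsGLB A s) : dInf A = s := by
  have h' : ∃ s, IsGLB A s := ⟨s, h⟩
  rw [dInf, dif_pos h']
  exact h'.choose_spec.unique h

theorem DSet.isLUB_dSup {A : Set N} (hA : DSet S A) (hne : A.Nonempty) (hb : BddAbove A) :
    IsLUB A (dSup A) := by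
  obtain ⟨s, hs⟩ := hA.exists_isLUB hne hb
  rwa [dSup_eq hs]

theorem DSet.isGLB_dInf {A : Set N} (hA : DSet S A) (hne : A.Nonempty) (hb : BddBelow A) :
    IsGLB A (dInf A) := by
  obtain ⟨s, hs⟩ := hA.exists_isGLB hne hb
  rwa [dInf_eq hs]

@[fun_prop]
theorem DM.dSup {T : X → N → Prop} (hT : DM S (fun p : X × N => T p.1 p.2)) :
    DM S (fun x => dSup {y | T x y}) := by
  have h1 : DM S (fun p : X × N => IsLUB {y | T p.1 y} p.2) := by
    refine DM.iff_congr (P := fun p : X × N => (∀ y, T p.1 y → y ≤ p.2) ∧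
      ∀ b, (∀ y, T p.1 y → y ≤ b) → p.2 ≤ b) (by fun_prop) fun p => Iff.rfl
  refine DM.of_rel (fun x s => IsLUB {y | T x y} s ∨
    ((¬ ∃ s, IsLUB {y | T x y} s) ∧ s = Classical.arbitrary N)) ?_ ?_
  · have h2 : DM S (fun p : (X × N) × N => IsLUB {y | T p.1.1 y} p.2) :=
      h1.comp' (f := fun p : (X × N) × N => (p.1.1, p.2)) (by fun_prop)
    fun_prop
  · intro x s
    by_cases h : ∃ s, IsLUB {y | T x y} s
    · obtain ⟨t, ht⟩ := h
      rw [dSup_eq ht]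
      constructor
      · rintro rfl; exact Or.inl ht
      · rintro (h | ⟨h, -⟩)
        · exact h.unique ht
        · exact absurd ⟨t, ht⟩ h
    · rw [OMin.dSup, dif_neg h]
      push Not at h
      simp [h]

@[fun_prop]
theorem DM.dInf {T : X → N → Prop} (hT : DM S (fun p : X × N => T p.1 p.2)) :
    DM S (fun x => dInf {y | T x y}) := by
  have h1 : DM S (fun p : X × N => IsGLB {y | T p.1 y} p.2) := by
    refine DM.iff_congr (P := fun p : X × N => (∀ y, T p.1 y → p.2 ≤ y) ∧
      ∀ b, (∀ y, T p.1 y → b ≤ y) → b ≤ p.2) (by fun_prop) fun p => Iff.rfl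
  refine DM.of_rel (fun x s => IsGLB {y | T x y} s ∨
    ((¬ ∃ s, IsGLB {y | T x y} s) ∧ s = Classical.arbitrary N)) ?_ ?_
  · have h2 : DM S (fun p : (X × N) × N => IsGLB {y | T p.1.1 y} p.2) :=
      h1.comp' (f := fun p : (X × N) × N => (p.1.1, p.2)) (by fun_prop)
    fun_prop
  · intro x s
    by_cases h : ∃ s, IsGLB {y | T x y} s
    · obtain ⟨t, ht⟩ := h
      rw [dInf_eq ht]
      constructor
      · rintro rfl; exact Or.inl ht
      · rintro (h | ⟨h, -⟩)
        · exact h.unique ht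
        · exact absurd ⟨t, ht⟩ h
    · rw [OMin.dInf, dif_neg h]
      push Not at h
      simp [h]

end Order

section Top

variable [TopologicalSpace N] [OrderTopology N]

theorem eventually_nhdsGT_iff {a : N} {P : N → Prop} :
    (∀ᶠ y in 𝓝[>] a, P y) ↔ ∃ b, a < b ∧ ∀ y, a < y → y < b → P y := by
  obtain ⟨c, hc⟩ := exists_gt a
  rw [Filter.Eventually, mem_nhdsGT_iff_exists_Ioo_subset' hc]
  constructor
  · rintro ⟨b, hb, h⟩
    exact ⟨b, hb, fun y h1 h2 => h ⟨h1, h2⟩⟩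
  · rintro ⟨b, hb, h⟩
    exact ⟨b, hb, fun y hy => h y hy.1 hy.2⟩

theorem eventually_nhdsLT_iff {a : N} {P : N → Prop} :
    (∀ᶠ y in 𝓝[<] a, P y) ↔ ∃ b, b < a ∧ ∀ y, b < y → y < a → P y := by
  obtain ⟨c, hc⟩ := exists_lt a
  rw [Filter.Eventually, mem_nhdsLT_iff_exists_Ioo_subset' hc]
  constructor
  · rintro ⟨b, hb, h⟩
    exact ⟨b, hb, fun y h1 h2 => h ⟨h1, h2⟩⟩
  · rintro ⟨b, hb, h⟩
    exact ⟨b, hb, fun y hy => h y hy.1 hy.2⟩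

theorem eventually_nhds_iff_Ioo {a : N} {P : N → Prop} :
    (∀ᶠ y in 𝓝 a, P y) ↔ ∃ b c, b < a ∧ a < c ∧ ∀ y, b < y → y < c → P y := by
  rw [Filter.Eventually, mem_nhds_iff_exists_Ioo_subset]
  constructor
  · rintro ⟨b, c, hb, h⟩
    exact ⟨b, c, hb.1, hb.2, fun y h1 h2 => h ⟨h1, h2⟩⟩
  · rintro ⟨b, c, hb, hc, h⟩
    exact ⟨b, c, ⟨hb, hc⟩, fun y hy => h y hy.1 hy.2⟩

@[fun_prop]
theorem DM.eventually_nhdsGT {T : X → N → Prop} (hT : DM S (fun p : X × N => T p.1 p.2))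
    {f : X → N} (hf : DM S f) : DM S (fun x => ∀ᶠ y in 𝓝[>] f x, T x y) := by
  simp only [eventually_nhdsGT_iff]
  fun_prop

@[fun_prop]
theorem DM.eventually_nhdsLT {T : X → N → Prop} (hT : DM S (fun p : X × N => T p.1 p.2))
    {f : X → N} (hf : DM S f) : DM S (fun x => ∀ᶠ y in 𝓝[<] f x, T x y) := by
  simp only [eventually_nhdsLT_iff]
  fun_prop

@[fun_prop]
theorem DM.eventually_nhds {T : X → N → Prop} (hT : DM S (fun p : X × N => T p.1 p.2))
    {f : X → N} (hf : DM S f) : DM S (fun x => ∀ᶠ y in 𝓝 (f x), T x y) := by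
  simp only [eventually_nhds_iff_Ioo]
  fun_prop

theorem ordConnected_germ {A : Set N} (hA : A.OrdConnected) (a : N) :
    (A ∈ 𝓝[>] a ∨ Aᶜ ∈ 𝓝[>] a) ∧ (A ∈ 𝓝[<] a ∨ Aᶜ ∈ 𝓝[<] a) := by
  constructor
  · by_cases h : ∀ t, a < t → ∃ y ∈ A, a < y ∧ y < t
    · left
      obtain ⟨t, ht⟩ := exists_gt a
      obtain ⟨y, hy, hay, -⟩ := h t ht
      refine eventually_nhdsGT_iff.2 ⟨y, hay, fun z h1 h2 => ?_⟩
      obtain ⟨w, hw, -, hwz⟩ := h z h1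
      exact hA.out hw hy ⟨hwz.le, h2.le⟩
    · right
      push Not at h
      obtain ⟨t, ht, h⟩ := h
      refine eventually_nhdsGT_iff.2 ⟨t, ht, fun z h1 h2 hz => ?_⟩
      exact (h z hz h1).not_gt h2
  · by_cases h : ∀ t, t < a → ∃ y ∈ A, t < y ∧ y < a
    · left
      obtain ⟨t, ht⟩ := exists_lt a
      obtain ⟨y, hy, -, hay⟩ := h t ht
      refine eventually_nhdsLT_iff.2 ⟨y, hay, fun z h1 h2 => ?_⟩
      obtain ⟨w, hw, hwz, -⟩ := h z h2
      exact hA.out hy hw ⟨h1.le, hwz.le⟩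
    · right
      push Not at h
      obtain ⟨t, ht, h⟩ := h
      refine eventually_nhdsLT_iff.2 ⟨t, ht, fun z h1 h2 hz => ?_⟩
      exact (h z hz h1).not_gt h2

theorem DSet.germ {A : Set N} (hA : DSet S A) (a : N) :
    (A ∈ 𝓝[>] a ∨ Aᶜ ∈ 𝓝[>] a) ∧ (A ∈ 𝓝[<] a ∨ Aᶜ ∈ 𝓝[<] a) := by
  obtain ⟨k, f, hf, rfl⟩ := hA.isFinUnion
  have hc : ∀ i, (f i).OrdConnected := by
    intro i
    rcases hf i with ⟨a, h⟩ | ⟨a, b, h⟩ | ⟨a, h⟩ | ⟨b, h⟩ | h <;> rw [h] <;> infer_instance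
  have key : ∀ F : Filter N, (∀ i, f i ∈ F ∨ (f i)ᶜ ∈ F) →
      (⋃ i, f i) ∈ F ∨ (⋃ i, f i)ᶜ ∈ F := by
    intro F h
    by_cases h1 : ∃ i, f i ∈ F
    · obtain ⟨i, hi⟩ := h1
      exact Or.inl (mem_of_superset hi (subset_iUnion f i))
    · right
      rw [compl_iUnion, iInter_mem]
      intro i
      rcases h i with h | h
      · exact absurd ⟨i, h⟩ h1
      · exact h
  exact ⟨key _ fun i => (ordConnected_germ (hc i) a).1,
    key _ fun i => (ordConnected_germ (hc i) a).2⟩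

theorem DM.germ_right {P : N → Prop} (hP : DM S P) (a : N) :
    (∀ᶠ y in 𝓝[>] a, P y) ∨ ∀ᶠ y in 𝓝[>] a, ¬ P y := (hP.pred.germ a).1

theorem DM.germ_left {P : N → Prop} (hP : DM S P) (a : N) :
    (∀ᶠ y in 𝓝[<] a, P y) ∨ ∀ᶠ y in 𝓝[<] a, ¬ P y := (hP.pred.germ a).2

/-- Induction along an interval. -/
theorem DM.ioo_induction {P : N → Prop} (hP : DM S P) {a b : N}
    (h0 : ∀ᶠ y in 𝓝[>] a, P y)
    (h : ∀ c, a < c → c < b → (∀ y, a < y → y < c → P y) → P c ∧ ∀ᶠ y in 𝓝[>] c, P y) :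
    ∀ y, a < y → y < b → P y := by
  intro z haz hzb
  by_contra hz
  have hd : DSet S {y | a < y ∧ y < b ∧ ¬ P y} := DM.pred (by fun_prop)
  obtain ⟨c, hc⟩ := hd.exists_isGLB ⟨z, haz, hzb, hz⟩ ⟨a, fun y hy => hy.1.le⟩
  have hcb : c < b := (hc.1 ⟨haz, hzb, hz⟩).trans_lt hzb
  have hac : a < c := by
    obtain ⟨d, had, hd⟩ := eventually_nhdsGT_iff.1 h0
    refine had.trans_le (hc.2 fun y hy => ?_)
    by_contra hlt
    exact hy.2.2 (hd y hy.1 (not_le.1 hlt))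
  have hlow : ∀ y, a < y → y < c → P y := by
    intro y h1 h2
    by_contra h3
    exact (hc.1 ⟨h1, h2.trans hcb, h3⟩).not_gt h2
  obtain ⟨hPc, hev⟩ := h c hac hcb hlow
  obtain ⟨d, hcd, hd⟩ := eventually_nhdsGT_iff.1 hev
  have : d ≤ c := hc.2 fun y hy => by
    by_contra hlt
    have hcy := hc.1 hy
    rcases hcy.eq_or_lt with rfl | h1
    · exact hy.2.2 hPc
    · exact hy.2.2 (hd y h1 (not_le.1 hlt))
  exact this.not_gt hcd

theorem DM.const_of_locally_const {f : N → Y} (hf : DM S f) {a b : N}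
    (h : ∀ c, a < c → c < b → ∀ᶠ y in 𝓝 c, f y = f c) {x y : N}
    (hx : a < x ∧ x < b) (hy : a < y ∧ y < b) : f x = f y := by
  have key : ∀ x y, a < x → x < y → y < b → f y = f x := by
    intro x y hx hxy hy
    have h1 : DM S (fun z => f z = f x) := by fun_prop
    refine h1.ioo_induction (a := x) (b := b) ((h x hx (hxy.trans hy)).filter_mono
      nhdsWithin_le_nhds) (fun c hc hcb hlow => ?_) y hxy hy
    have h2 := h c (hx.trans hc) hcb
    have h3 : ∀ᶠ z in 𝓝[<] c, f z = f x :=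
      eventually_nhdsLT_iff.2 ⟨x, hc, fun z => hlow z⟩
    have hcx : f c = f x := by
      obtain ⟨z, hz1, hz2⟩ := ((h2.filter_mono nhdsWithin_le_nhds).and h3).exists
      rw [← hz1, hz2]
    refine ⟨hcx, ?_⟩
    filter_upwards [h2.filter_mono nhdsWithin_le_nhds] with z hz
    rw [hz, hcx]
  rcases lt_trichotomy x y with hxy | rfl | hxy
  · exact (key x y hx.1 hxy hy.2).symm
  · rfl
  · exact key y x hy.1 hxy hx.2

end Top

end OMin

namespace OMin

variable {N : Type u} [LinearOrder N]

/-- The structure on the reversed order. -/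
def dual (S : Struc N) : Struc Nᵒᵈ where
  Def m A := S.Def m (show Set (Fin m → N) from A)
  def_inter h1 h2 := S.def_inter h1 h2
  def_compl h := S.def_compl h
  def_univ m := S.def_univ m
  def_reindex g _ h := S.def_reindex g h
  def_proj h := S.def_proj h
  def_lt := S.def_reindex (m := 2) (k := 2) ![1, 0] S.def_lt
  def_pt a := S.def_pt a
  o_min {A} h := by
    obtain ⟨k, f, hf, hA⟩ := S.o_min h
    refine ⟨k, f, fun i => ?_, hA⟩
    rcases hf i with ⟨a, h⟩ | ⟨a, b, h⟩ | ⟨a, h⟩ | ⟨a, h⟩ | h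
    · exact Or.inl ⟨a, h⟩
    · refine Or.inr (Or.inl ⟨OrderDual.toDual b, OrderDual.toDual a, ?_⟩)
      rw [h]
      ext x
      exact and_comm
    · exact Or.inr (Or.inr (Or.inr (Or.inl ⟨a, h⟩)))
    · exact Or.inr (Or.inr (Or.inl ⟨a, h⟩))
    · exact Or.inr (Or.inr (Or.inr (Or.inr h)))

variable [DenselyOrdered N] [NoMinOrder N] [NoMaxOrder N]
  [Nonempty N] {S : Struc N} {X Y Z W : Type*} [DefTy S X] [DefTy S Y] [DefTy S Z] [DefTy S W]

theorem DM.dual_rel {L : N → N → Prop} (h : DM S (fun p : N × N => L p.1 p.2)) :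
    DM (dual S) (fun p : Nᵒᵈ × Nᵒᵈ => L (OrderDual.ofDual p.1) (OrderDual.ofDual p.2)) :=
  dm_iff_dset.2 (show DSet S _ from h.pred)

variable [TopologicalSpace N] [OrderTopology N]

/-- A relation for which every point of an interval is a strict local minimum drops across
some point of the interval. -/
theorem exists_drop {L : N → N → Prop} (hL : DM S (fun p : N × N => L p.1 p.2))
    (hirr : ∀ x, ¬ L x x) (htr : ∀ x y z, L x y → L y z → L x z)
    (htot : ∀ x y, x ≠ y → L x y ∨ L y x) {a b : N} (hab : a < b)
    (hr : ∀ x, a < x → x < b → ∀ᶠ y in 𝓝[>] x, L x y)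
    (hl : ∀ x, a < x → x < b → ∀ᶠ y in 𝓝[<] x, L x y) :
    ∃ β, a < β ∧ β < b ∧ ∃ y₁ y₂, y₁ < β ∧ β < y₂ ∧
      ∀ t s, y₁ < t → t < β → β < s → s < y₂ → L s t := by
  have hasym : ∀ {x y}, L x y → ¬ L y x := fun h1 h2 => hirr _ (htr _ _ _ h1 h2)
  have hB : DM S (fun x => ∀ y, x < y → y < b → L x y) := by fun_prop
  have hB' : ∀ᶠ x in 𝓝[<] b, ¬ ∀ y, x < y → y < b → L x y := by
    refine (hB.germ_left b).resolve_left fun h => ?_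
    obtain ⟨c, hcb, hc⟩ := eventually_nhdsLT_iff.1 h
    obtain ⟨x, hx1, hx2⟩ := exists_between (max_lt hab hcb)
    have h1 : ∀ᶠ y in 𝓝[<] x, max a c < y ∧ y < x :=
      eventually_nhdsLT_iff.2 ⟨_, hx1, fun y h1 h2 => ⟨h1, h2⟩⟩
    obtain ⟨t, ht, h2⟩ := ((hl x ((le_max_left _ _).trans_lt hx1) hx2).and h1).exists
    exact hasym ht (hc t ((le_max_right _ _).trans_lt h2.1) (h2.2.trans hx2) x h2.2 hx2)
  obtain ⟨a', ha'b, ha'⟩ := eventually_nhdsLT_iff.1 hB'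
  obtain ⟨x, hx1, hxb⟩ := exists_between (max_lt hab ha'b)
  have hax : a < x := (le_max_left _ _).trans_lt hx1
  have ha'x : a' < x := (le_max_right _ _).trans_lt hx1
  have hx : ∀ z, x ≤ z → z < b → ∃ y, z < y ∧ y < b ∧ L y z := by
    intro z hz hzb
    have := ha' z (ha'x.trans_le hz) hzb
    push Not at this
    obtain ⟨y, h1, h2, h3⟩ := this
    exact ⟨y, h1, h2, (htot _ _ h1.ne').resolve_right h3⟩
  have hend : ∀ᶠ y in 𝓝[<] b, L y x := by
    have hLx : DM S (fun y => L y x) := by fun_prop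
    refine (hLx.germ_left b).resolve_right fun h => ?_
    obtain ⟨d, hdb, hd⟩ := eventually_nhdsLT_iff.1 h
    obtain ⟨y, hxy, hyb, hyx⟩ := hx x le_rfl hxb
    have hDS : DSet S {y | x < y ∧ y < b ∧ L y x} := DM.pred (by fun_prop)
    obtain ⟨α, hα⟩ := hDS.exists_isLUB ⟨y, hxy, hyb, hyx⟩ ⟨b, fun z hz => hz.2.1.le⟩
    have hαx : x < α := hxy.trans_le (hα.1 ⟨hxy, hyb, hyx⟩)
    have hαb : α < b := by
      refine lt_of_le_of_lt (hα.2 fun z hz => ?_) hdb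
      by_contra hlt
      exact hd z (not_le.1 hlt) hz.2.1 hz.2.2
    have hαL : L α x := by
      by_contra hno
      obtain ⟨e, heα, he⟩ := eventually_nhdsLT_iff.1 (hl α (hax.trans hαx) hαb)
      obtain ⟨z, hz, hez, hzα⟩ := hα.exists_between heα
      rcases hzα.eq_or_lt with rfl | hzα
      · exact hno hz.2.2
      · exact hno (htr _ _ _ (he z hez hzα) hz.2.2)
    obtain ⟨y, h1, h2, h3⟩ := hx α hαx.le hαb
    exact (hα.1 ⟨hαx.trans h1, h2, htr _ _ _ h3 hαL⟩).not_gt h1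
  obtain ⟨e, heb, he⟩ := eventually_nhdsLT_iff.1 hend
  have hDS : DSet S {z | x < z ∧ z < b ∧ ∀ y, z < y → y < b → L y x} := DM.pred (by fun_prop)
  obtain ⟨z₀, hz₀, hz₀b⟩ := exists_between (max_lt heb hxb)
  have hz₀mem : z₀ ∈ {z | x < z ∧ z < b ∧ ∀ y, z < y → y < b → L y x} :=
    ⟨(le_max_right _ _).trans_lt hz₀, hz₀b, fun y h1 h2 =>
      he y (((le_max_left _ _).trans_lt hz₀).trans h1) h2⟩
  obtain ⟨β, hβ⟩ := hDS.exists_isGLB ⟨z₀, hz₀mem⟩ ⟨x, fun z hz => hz.1.le⟩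
  have hβb : β < b := (hβ.1 hz₀mem).trans_lt hz₀b
  have hright : ∀ y, β < y → y < b → L y x := by
    intro y h1 h2
    obtain ⟨z, hz, -, hzy⟩ := hβ.exists_between h1
    exact hz.2.2 y hzy h2
  have hxβ : x < β := by
    have hle : x ≤ β := hβ.2 fun z hz => hz.1.le
    refine hle.lt_of_ne ?_
    rintro rfl
    have h1 : ∀ᶠ y in 𝓝[>] x, x < y ∧ y < b :=
      eventually_nhdsGT_iff.2 ⟨b, hxb, fun y h1 h2 => ⟨h1, h2⟩⟩
    obtain ⟨y, hy1, hy2, hy3⟩ := ((hr x hax hxb).and h1).exists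
    exact hasym hy1 (hright y hy2 hy3)
  have hleft : ∀ᶠ y in 𝓝[<] β, L x y := by
    have hLx : DM S (fun y => L y x) := by fun_prop
    have hxlt : ∀ᶠ y in 𝓝[<] β, x < y :=
      eventually_nhdsLT_iff.2 ⟨x, hxβ, fun y h1 _ => h1⟩
    rcases hLx.germ_left β with h | h
    · exfalso
      by_cases hβx : L β x
      · obtain ⟨d, hd, hd'⟩ := eventually_nhdsLT_iff.1 (h.and hxlt)
        obtain ⟨z, hz1, hz2⟩ := exists_between hd
        have : β ≤ z := hβ.1 ⟨(hd' z hz1 hz2).2, hz2.trans hβb, fun y h1 h2 => by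
          rcases lt_trichotomy y β with h3 | rfl | h3
          · exact (hd' y (hz1.trans h1) h3).1
          · exact hβx
          · exact hright y h3 h2⟩
        exact this.not_gt hz2
      · have hxβ' : L x β := (htot _ _ hxβ.ne).resolve_right hβx
        obtain ⟨y, h1, h2⟩ := (h.and (hl β (hax.trans hxβ) hβb)).exists
        exact hasym h2 (htr _ _ _ h1 hxβ')
    · filter_upwards [h, hxlt] with y h1 h2
      exact (htot _ _ h2.ne).resolve_right h1
  obtain ⟨y₁, hy₁, hy₁'⟩ := eventually_nhdsLT_iff.1 hleft
  exact ⟨β, hax.trans hxβ, hβb, y₁, b, hy₁, hβb, fun t s h1 h2 h3 h4 =>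
    htr _ _ _ (hright s h3 h4) (hy₁' t h1 h2)⟩

theorem exists_jump {L : N → N → Prop} (hL : DM S (fun p : N × N => L p.1 p.2))
    (hirr : ∀ x, ¬ L x x) (htr : ∀ x y z, L x y → L y z → L x z)
    (htot : ∀ x y, x ≠ y → L x y ∨ L y x) {a b : N} (hab : a < b)
    (hr : ∀ x, a < x → x < b → ∀ᶠ y in 𝓝[>] x, L x y)
    (hl : ∀ x, a < x → x < b → ∀ᶠ y in 𝓝[<] x, L x y) :
    ∃ β, a < β ∧ β < b ∧ ∃ y₁ y₂, y₁ < β ∧ β < y₂ ∧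
      ∀ t s, y₁ < t → t < β → β < s → s < y₂ → L t s := by
  obtain ⟨β, h1, h2, y₁, y₂, h3, h4, h⟩ := exists_drop (N := Nᵒᵈ) (S := dual S)
    (L := fun x y => L (OrderDual.ofDual x) (OrderDual.ofDual y)) hL.dual_rel
    (fun x => hirr _) (fun x y z => htr _ _ _) (fun x y h => htot _ _ h)
    (a := OrderDual.toDual b) (b := OrderDual.toDual a) hab
    (fun x h1 h2 => hl _ h2 h1) (fun x h1 h2 => hr _ h2 h1)
  exact ⟨β, h2, h1, y₂, y₁, h4, h3, fun t s k1 k2 k3 k4 => h s t k4 k3 k2 k1⟩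

theorem not_local_min {L : N → N → Prop} (hL : DM S (fun p : N × N => L p.1 p.2))
    (hirr : ∀ x, ¬ L x x) (htr : ∀ x y z, L x y → L y z → L x z)
    (htot : ∀ x y, x ≠ y → L x y ∨ L y x) (a : N)
    (hr : ∀ᶠ x in 𝓝[>] a, ∀ᶠ y in 𝓝[>] x, L x y)
    (hl : ∀ᶠ x in 𝓝[>] a, ∀ᶠ y in 𝓝[<] x, L x y) : False := by
  obtain ⟨b, hab, hb⟩ := eventually_nhdsGT_iff.1 (hr.and hl)
  have h1 : ∀ᶠ β in 𝓝[>] a, ∃ y₁ y₂, y₁ < β ∧ β < y₂ ∧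
      ∀ t s, y₁ < t → t < β → β < s → s < y₂ → L s t := by
    have hd : DM S (fun β => ∃ y₁ y₂, y₁ < β ∧ β < y₂ ∧
      ∀ t s, y₁ < t → t < β → β < s → s < y₂ → L s t) := by fun_prop
    refine (hd.germ_right a).resolve_right fun h => ?_
    obtain ⟨d, had, hd⟩ := eventually_nhdsGT_iff.1 h
    obtain ⟨β, k1, k2, k3⟩ := exists_drop hL hirr htr htot (lt_min hab had)
      (fun x h1 h2 => (hb x h1 (h2.trans_le (min_le_left _ _))).1)
      (fun x h1 h2 => (hb x h1 (h2.trans_le (min_le_left _ _))).2)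
    exact hd β k1 (k2.trans_le (min_le_right _ _)) k3
  have h2 : ∀ᶠ β in 𝓝[>] a, ∃ y₁ y₂, y₁ < β ∧ β < y₂ ∧
      ∀ t s, y₁ < t → t < β → β < s → s < y₂ → L t s := by
    have hd : DM S (fun β => ∃ y₁ y₂, y₁ < β ∧ β < y₂ ∧
      ∀ t s, y₁ < t → t < β → β < s → s < y₂ → L t s) := by fun_prop
    refine (hd.germ_right a).resolve_right fun h => ?_
    obtain ⟨d, had, hd⟩ := eventually_nhdsGT_iff.1 h
    obtain ⟨β, k1, k2, k3⟩ := exists_jump hL hirr htr htot (lt_min hab had)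
      (fun x h1 h2 => (hb x h1 (h2.trans_le (min_le_left _ _))).1)
      (fun x h1 h2 => (hb x h1 (h2.trans_le (min_le_left _ _))).2)
    exact hd β k1 (k2.trans_le (min_le_right _ _)) k3
  obtain ⟨β, ⟨y₁, y₂, k1, k2, k3⟩, ⟨z₁, z₂, l1, l2, l3⟩⟩ := (h1.and h2).exists
  obtain ⟨t, ht1, ht2⟩ := exists_between (max_lt k1 l1)
  obtain ⟨s, hs1, hs2⟩ := exists_between (lt_min k2 l2)
  exact hirr _ (htr _ _ _
    (k3 t s ((le_max_left _ _).trans_lt ht1) ht2 hs1 (hs2.trans_le (min_le_left _ _)))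
    (l3 t s ((le_max_right _ _).trans_lt ht1) ht2 hs1 (hs2.trans_le (min_le_right _ _))))

theorem rel_increasing {L : N → N → Prop} (hL : DM S (fun p : N × N => L p.1 p.2))
    (htr : ∀ x y z, L x y → L y z → L x z) {a : N}
    (hr : ∀ᶠ x in 𝓝[>] a, ∀ᶠ y in 𝓝[>] x, L x y)
    (hl : ∀ᶠ x in 𝓝[>] a, ∀ᶠ y in 𝓝[<] x, L y x) :
    ∃ d, a < d ∧ ∀ x y, a < x → x < y → y < d → L x y := by
  obtain ⟨b, hab, hb⟩ := eventually_nhdsGT_iff.1 (hr.and hl)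
  refine ⟨b, hab, fun x y hax hxy hyb => ?_⟩
  have hLx : DM S (fun y => L x y) := by fun_prop
  refine hLx.ioo_induction (hb x hax (hxy.trans hyb)).1 (fun c hxc hcb hlow => ?_) y hxy hyb
  have h1 : ∀ᶠ y in 𝓝[<] c, L x y := eventually_nhdsLT_iff.2 ⟨x, hxc, hlow⟩
  obtain ⟨z, hz1, hz2⟩ := (h1.and (hb c (hax.trans hxc) hcb).2).exists
  have hxc' := htr _ _ _ hz1 hz2
  exact ⟨hxc', (hb c (hax.trans hxc) hcb).1.mono fun y hy => htr _ _ _ hxc' hy⟩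

/-- A definable strict total order agrees with `<` or with `>` on some interval `(a, d)`. -/
theorem rel_monotone {L : N → N → Prop} (hL : DM S (fun p : N × N => L p.1 p.2))
    (hirr : ∀ x, ¬ L x x) (htr : ∀ x y z, L x y → L y z → L x z)
    (htot : ∀ x y, x ≠ y → L x y ∨ L y x) (a : N) :
    ∃ d, a < d ∧ ((∀ x y, a < x → x < y → y < d → L x y) ∨
      (∀ x y, a < x → x < y → y < d → L y x)) := by
  have hr : DM S (fun x => ∀ᶠ y in 𝓝[>] x, L x y) := by fun_prop
  have hl : DM S (fun x => ∀ᶠ y in 𝓝[<] x, L x y) := by fun_prop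
  have hL' : DM S (fun p : N × N => L p.2 p.1) := by fun_prop
  have hr' : ∀ x, (¬ ∀ᶠ y in 𝓝[>] x, L x y) → ∀ᶠ y in 𝓝[>] x, L y x := by
    intro x hx
    have hLx : DM S (fun y => L x y) := by fun_prop
    filter_upwards [(hLx.germ_right x).resolve_left hx, self_mem_nhdsWithin] with y h1 h2
    exact (htot x y (ne_of_lt h2)).resolve_left h1
  have hl' : ∀ x, (¬ ∀ᶠ y in 𝓝[<] x, L x y) → ∀ᶠ y in 𝓝[<] x, L y x := by
    intro x hx
    have hLx : DM S (fun y => L x y) := by fun_prop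
    filter_upwards [(hLx.germ_left x).resolve_left hx, self_mem_nhdsWithin] with y h1 h2
    exact (htot x y (ne_of_gt h2)).resolve_left h1
  rcases hr.germ_right a with h1 | h1 <;> rcases hl.germ_right a with h2 | h2
  · exact (not_local_min hL hirr htr htot a h1 h2).elim
  · obtain ⟨d, had, hd⟩ := rel_increasing hL htr h1 (h2.mono hl')
    exact ⟨d, had, Or.inl hd⟩
  · obtain ⟨d, had, hd⟩ := rel_increasing (L := fun x y => L y x) hL'
      (fun x y z h1 h2 => htr _ _ _ h2 h1)
      (h1.mono hr') h2
    exact ⟨d, had, Or.inr hd⟩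
  · exact (not_local_min (L := fun x y => L y x) hL' hirr (fun x y z h1 h2 => htr _ _ _ h2 h1)
      (fun x y h => (htot x y h).symm) a (h1.mono hr') (h2.mono hl')).elim

/-- `f` is constant near `x`. -/
def LC (f : N → N) (x : N) : Prop := ∀ᶠ y in 𝓝 x, f y = f x

/-- `f` is continuous and increasing at `x`. -/
def LI (f : N → N) (x : N) : Prop :=
  Tendsto f (𝓝[>] x) (𝓝[>] (f x)) ∧ Tendsto f (𝓝[<] x) (𝓝[<] (f x))

/-- `f` is continuous and decreasing at `x`. -/
def LD (f : N → N) (x : N) : Prop :=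
  Tendsto f (𝓝[>] x) (𝓝[<] (f x)) ∧ Tendsto f (𝓝[<] x) (𝓝[>] (f x))

theorem tendsto_nhdsGT_iff {Y : Type*} {F : Filter Y} {f : Y → N} {b : N} :
    Tendsto f F (𝓝[>] b) ↔ ∀ u, b < u → ∀ᶠ y in F, b < f y ∧ f y < u := by
  constructor
  · intro h u hu
    exact h.eventually (p := fun z => b < z ∧ z < u) (eventually_nhdsGT_iff.2 ⟨u, hu, fun y h1 h2 => ⟨h1, h2⟩⟩)
  · intro h s hs
    obtain ⟨u, hu, hu'⟩ := eventually_nhdsGT_iff.1 (show ∀ᶠ y in 𝓝[>] b, y ∈ s from hs)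
    exact (h u hu).mono fun y hy => hu' _ hy.1 hy.2

theorem tendsto_nhdsLT_iff {Y : Type*} {F : Filter Y} {f : Y → N} {b : N} :
    Tendsto f F (𝓝[<] b) ↔ ∀ u, u < b → ∀ᶠ y in F, u < f y ∧ f y < b := by
  constructor
  · intro h u hu
    exact h.eventually (p := fun z => u < z ∧ z < b) (eventually_nhdsLT_iff.2 ⟨u, hu, fun y h1 h2 => ⟨h1, h2⟩⟩)
  · intro h s hs
    obtain ⟨u, hu, hu'⟩ := eventually_nhdsLT_iff.1 (show ∀ᶠ y in 𝓝[<] b, y ∈ s from hs)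
    exact (h u hu).mono fun y hy => hu' _ hy.1 hy.2

theorem DM.exists_monotone {f : N → N} (hf : DM S f) {a b : N} (hab : a < b) :
    ∃ c d, a ≤ c ∧ c < d ∧ d ≤ b ∧ ((∀ x y, c < x → x < d → c < y → y < d → f x = f y) ∨
      (∀ x y, c < x → x < y → y < d → f x < f y) ∨
      (∀ x y, c < x → x < y → y < d → f y < f x)) := by
  obtain ⟨d, had, hd⟩ := rel_monotone (S := S)
    (L := fun x y => f x < f y ∨ (f x = f y ∧ x < y)) (by fun_prop)
    (by intro x; simp)
    (by
      rintro x y z (h1 | ⟨h1, h1'⟩) (h2 | ⟨h2, h2'⟩)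
      · exact Or.inl (h1.trans h2)
      · exact Or.inl (h1.trans_eq h2)
      · exact Or.inl (h1.trans_lt h2)
      · exact Or.inr ⟨h1.trans h2, h1'.trans h2'⟩)
    (by
      intro x y h
      rcases lt_trichotomy (f x) (f y) with h1 | h1 | h1
      · exact Or.inl (Or.inl h1)
      · rcases h.lt_or_gt with h2 | h2
        · exact Or.inl (Or.inr ⟨h1, h2⟩)
        · exact Or.inr (Or.inr ⟨h1.symm, h2⟩)
      · exact Or.inr (Or.inl h1)) a
  rcases hd with hd | hd
  · have hA : DM S (fun x => ∀ᶠ y in 𝓝[>] x, f y = f x) := by fun_prop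
    rcases hA.germ_right a with h | h
    · obtain ⟨e, hae, he⟩ := eventually_nhdsGT_iff.1 h
      obtain ⟨x, hax, hx⟩ := exists_between (lt_min hae hab)
      obtain ⟨z, hxz, hz⟩ := eventually_nhdsGT_iff.1
        (he x hax (hx.trans_le (min_le_left _ _)))
      refine ⟨x, min z b, hax.le, lt_min hxz (hx.trans_le (min_le_right _ _)), min_le_right _ _,
        Or.inl fun y w h1 h2 h3 h4 => ?_⟩
      rw [hz y h1 (h2.trans_le (min_le_left _ _)), hz w h3 (h4.trans_le (min_le_left _ _))]
    · obtain ⟨e, hae, he⟩ := eventually_nhdsGT_iff.1 h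
      refine ⟨a, min (min e d) b, le_rfl, by simp [*], min_le_right _ _,
        Or.inr (Or.inl fun x y h1 h2 h3 => ?_)⟩
      simp only [lt_min_iff] at h3
      refine (hd x y h1 h2 h3.1.2).resolve_right ?_
      rintro ⟨hxy, -⟩
      refine he x h1 (h2.trans h3.1.1) (eventually_nhdsGT_iff.2 ⟨y, h2, fun z hz1 hz2 => ?_⟩)
      have k1 : f x ≤ f z := by
        rcases hd x z h1 hz1 (hz2.trans h3.1.2) with h | h
        · exact h.le
        · exact h.1.le
      have k2 : f z ≤ f y := by
        rcases hd z y (h1.trans hz1) hz2 h3.1.2 with h | h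
        · exact h.le
        · exact h.1.le
      exact le_antisymm (hxy ▸ k2) k1
  · refine ⟨a, min d b, le_rfl, lt_min had hab, min_le_right _ _,
      Or.inr (Or.inr fun x y h1 h2 h3 => ?_)⟩
    rcases hd x y h1 h2 (h3.trans_le (min_le_left _ _)) with h | h
    · exact h
    · exact absurd h.2 h2.not_gt

theorem DM.exists_monotone_at {f : N → N} (hf : DM S f) {a b : N} (hab : a < b) :
    ∃ x, a < x ∧ x < b ∧ (LC f x ∨ LI f x ∨ LD f x) := by
  obtain ⟨c, d, hac, hcd, hdb, h⟩ := hf.exists_monotone hab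
  have himg : DSet S (f '' Ioo c d) := by
    have : DSet S (Ioo c d) := DM.pred (P := fun y => c < y ∧ y < d) (by fun_prop)
    exact this.image hf
  rcases h with h | h | h
  · obtain ⟨x, hx1, hx2⟩ := exists_between hcd
    refine ⟨x, hac.trans_lt hx1, hx2.trans_le hdb, Or.inl ?_⟩
    exact eventually_nhds_iff_Ioo.2 ⟨c, d, hx1, hx2, fun y h1 h2 => h y x h1 h2 hx1 hx2⟩
  · have hinj : InjOn f (Ioo c d) := by
      intro x hx y hy hxy
      by_contra hne
      rcases lt_or_gt_of_ne hne with h1 | h1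
      · exact (h x y hx.1 h1 hy.2).ne hxy
      · exact (h y x hy.1 h1 hx.2).ne hxy.symm
    have hlt : ∀ x y, c < x → x < d → c < y → y < d → f x < f y → x < y := by
      intro x y h1 h2 h3 h4 h5
      by_contra hle
      rcases (not_lt.1 hle).eq_or_lt with rfl | h6
      · exact h5.false
      · exact (h y x h3 h6 h2).not_gt h5
    obtain ⟨p, q, hpq, hsub⟩ := himg.exists_Ioo_subset ((Ioo_infinite hcd).image hinj)
    obtain ⟨v, hv⟩ := exists_between hpq
    obtain ⟨x, hx, rfl⟩ := hsub hv
    refine ⟨x, hac.trans_lt hx.1, hx.2.trans_le hdb, Or.inr (Or.inl ⟨?_, ?_⟩)⟩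
    · rw [tendsto_nhdsGT_iff]
      intro u hu
      obtain ⟨w, hw1, hw2⟩ := exists_between (lt_min hu hv.2)
      obtain ⟨z, hz, rfl⟩ := hsub ⟨hv.1.trans hw1, hw2.trans_le (min_le_right _ _)⟩
      refine eventually_nhdsGT_iff.2 ⟨z, hlt _ _ hx.1 hx.2 hz.1 hz.2 hw1, fun y h1 h2 => ?_⟩
      exact ⟨h x y hx.1 h1 (h2.trans hz.2), (h y z (hx.1.trans h1) h2 hz.2).trans
        (hw2.trans_le (min_le_left _ _))⟩
    · rw [tendsto_nhdsLT_iff]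
      intro u hu
      obtain ⟨w, hw1, hw2⟩ := exists_between (max_lt hu hv.1)
      obtain ⟨z, hz, rfl⟩ := hsub ⟨(le_max_right _ _).trans_lt hw1, hw2.trans hv.2⟩
      refine eventually_nhdsLT_iff.2 ⟨z, hlt _ _ hz.1 hz.2 hx.1 hx.2 hw2, fun y h1 h2 => ?_⟩
      exact ⟨((le_max_left _ _).trans_lt hw1).trans (h z y hz.1 h1 (h2.trans hx.2)),
        h y x (hz.1.trans h1) h2 hx.2⟩
  · have hinj : InjOn f (Ioo c d) := by
      intro x hx y hy hxy
      by_contra hne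
      rcases lt_or_gt_of_ne hne with h1 | h1
      · exact (h x y hx.1 h1 hy.2).ne hxy.symm
      · exact (h y x hy.1 h1 hx.2).ne hxy
    have hlt : ∀ x y, c < x → x < d → c < y → y < d → f x < f y → y < x := by
      intro x y h1 h2 h3 h4 h5
      by_contra hle
      rcases (not_lt.1 hle).eq_or_lt with rfl | h6
      · exact h5.false
      · exact (h x y h1 h6 h4).not_gt h5
    obtain ⟨p, q, hpq, hsub⟩ := himg.exists_Ioo_subset ((Ioo_infinite hcd).image hinj)
    obtain ⟨v, hv⟩ := exists_between hpq
    obtain ⟨x, hx, rfl⟩ := hsub hv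
    refine ⟨x, hac.trans_lt hx.1, hx.2.trans_le hdb, Or.inr (Or.inr ⟨?_, ?_⟩)⟩
    · rw [tendsto_nhdsLT_iff]
      intro u hu
      obtain ⟨w, hw1, hw2⟩ := exists_between (max_lt hu hv.1)
      obtain ⟨z, hz, rfl⟩ := hsub ⟨(le_max_right _ _).trans_lt hw1, hw2.trans hv.2⟩
      refine eventually_nhdsGT_iff.2 ⟨z, hlt _ _ hz.1 hz.2 hx.1 hx.2 hw2, fun y h1 h2 => ?_⟩
      exact ⟨((le_max_left _ _).trans_lt hw1).trans (h y z (hx.1.trans h1) h2 hz.2),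
        h x y hx.1 h1 (h2.trans hz.2)⟩
    · rw [tendsto_nhdsGT_iff]
      intro u hu
      obtain ⟨w, hw1, hw2⟩ := exists_between (lt_min hu hv.2)
      obtain ⟨z, hz, rfl⟩ := hsub ⟨hv.1.trans hw1, hw2.trans_le (min_le_right _ _)⟩
      refine eventually_nhdsLT_iff.2 ⟨z, hlt _ _ hx.1 hx.2 hz.1 hz.2 hw1, fun y h1 h2 => ?_⟩
      exact ⟨h y x (hz.1.trans h1) h2 hx.2,
        (h z y hz.1 h1 (h2.trans hx.2)).trans (hw2.trans_le (min_le_left _ _))⟩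

section

variable {f : X → N → N}

@[fun_prop]
theorem DM.locConst (hf : DM S (fun p : X × N => f p.1 p.2)) {g : X → N} (hg : DM S g) :
    DM S (fun x => LC (f x) (g x)) := by
  unfold LC
  fun_prop

@[fun_prop]
theorem DM.locIncr (hf : DM S (fun p : X × N => f p.1 p.2)) {g : X → N} (hg : DM S g) :
    DM S (fun x => LI (f x) (g x)) := by
  simp only [LI, tendsto_nhdsGT_iff, tendsto_nhdsLT_iff]
  fun_prop

@[fun_prop]
theorem DM.locDecr (hf : DM S (fun p : X × N => f p.1 p.2)) {g : X → N} (hg : DM S g) :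
    DM S (fun x => LD (f x) (g x)) := by
  simp only [LD, tendsto_nhdsGT_iff, tendsto_nhdsLT_iff]
  fun_prop

end

theorem LI.continuousAt {f : N → N} {x : N} (h : LI f x) : ContinuousAt f x := by
  rw [continuousAt_iff_punctured_nhds, ← nhdsLT_sup_nhdsGT, tendsto_sup]
  exact ⟨h.2.mono_right nhdsWithin_le_nhds, h.1.mono_right nhdsWithin_le_nhds⟩

theorem LD.continuousAt {f : N → N} {x : N} (h : LD f x) : ContinuousAt f x := by
  rw [continuousAt_iff_punctured_nhds, ← nhdsLT_sup_nhdsGT, tendsto_sup]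
  exact ⟨h.2.mono_right nhdsWithin_le_nhds, h.1.mono_right nhdsWithin_le_nhds⟩

theorem LC.continuousAt {f : N → N} {x : N} (h : LC f x) : ContinuousAt f x :=
  tendsto_const_nhds.congr' (h.mono fun _ hy => hy.symm)

theorem DM.finite_not_monotone {f : N → N} (hf : DM S f) :
    {x | ¬ (LC f x ∨ LI f x ∨ LD f x)}.Finite := by
  by_contra hinf
  have hA : DM S (fun x => ¬ (LC f x ∨ LI f x ∨ LD f x)) := by fun_prop
  obtain ⟨p, q, hpq, hsub⟩ := hA.pred.exists_Ioo_subset hinf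
  obtain ⟨x, hx1, hx2, hx⟩ := hf.exists_monotone_at hpq
  exact hsub ⟨hx1, hx2⟩ hx

theorem DM.finite_discontinuous {f : N → N} (hf : DM S f) :
    {x | ¬ ContinuousAt f x}.Finite := by
  refine hf.finite_not_monotone.subset fun x hx h => hx ?_
  rcases h with h | h | h
  exacts [h.continuousAt, h.continuousAt, h.continuousAt]

end OMin

namespace OMin

section Planar

variable {N : Type u} [LinearOrder N] [DenselyOrdered N] [NoMinOrder N] [NoMaxOrder N]
  [Nonempty N] {S : Struc N} [TopologicalSpace N] [OrderTopology N]

theorem exists_rectangle_right {T : N → N → Prop} (hT : DM S (fun p : N × N => T p.1 p.2))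
    {a b c : N} (hab : a < b) (h : ∀ x, a < x → x < b → {y | c < y ∧ T x y}.Infinite) :
    ∃ a' b' c' d', a ≤ a' ∧ a' < b' ∧ b' ≤ b ∧ c' < d' ∧
      ∀ x y, a' < x → x < b' → c' < y → y < d' → T x y := by
  let α : N → N := fun x => dInf {y | c ≤ y ∧ ∀ᶠ z in 𝓝[>] y, T x z}
  have hα : DM S α := by fun_prop
  have hα' : ∀ x, a < x → x < b → ∀ᶠ z in 𝓝[>] (α x), T x z := by
    intro x hax hxb
    have hTx : DM S (fun y => T x y) := by fun_prop
    have hglb : IsGLB {y | c ≤ y ∧ ∀ᶠ z in 𝓝[>] y, T x z} (α x) := by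
      refine DSet.isGLB_dInf (S := S) (DM.pred (by fun_prop)) ?_ ⟨c, fun y hy => hy.1⟩
      have hd : DSet S {y | c < y ∧ T x y} := DM.pred (by fun_prop)
      obtain ⟨p, q, hpq, hsub⟩ := hd.exists_Ioo_subset (h x hax hxb)
      obtain ⟨r, hr⟩ := exists_between hpq
      exact ⟨r, (hsub hr).1.le, eventually_nhdsGT_iff.2
        ⟨q, hr.2, fun y h1 h2 => (hsub ⟨hr.1.trans h1, h2⟩).2⟩⟩
    refine (hTx.germ_right _).resolve_right fun hn => ?_
    obtain ⟨e, hae, he⟩ := eventually_nhdsGT_iff.1 hn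
    obtain ⟨y, hy, hαy, hye⟩ := hglb.exists_between hae
    have hlt : ∀ᶠ z in 𝓝[>] y, y < z ∧ z < e :=
      eventually_nhdsGT_iff.2 ⟨e, hye, fun z h1 h2 => ⟨h1, h2⟩⟩
    obtain ⟨z, hz1, hz2, hz3⟩ := (hy.2.and hlt).exists
    exact he z (hαy.trans_lt hz2) hz3 hz1
  obtain ⟨x₀, hx₀, hx₀c⟩ := ((Ioo_infinite hab).diff hα.finite_discontinuous).nonempty
  simp only [mem_ofPred_eq, not_not] at hx₀c
  obtain ⟨e, he⟩ := exists_gt (α x₀)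
  obtain ⟨a₁, b₁, ha₁, hb₁, h₁⟩ := eventually_nhds_iff_Ioo.1
    ((hx₀c.eventually (gt_mem_nhds he)).and (Ioo_mem_nhds hx₀.1 hx₀.2))
  let β : N → N := fun x => dSup {y | α x < y ∧ y < e ∧ ∀ z, α x < z → z < y → T x z}
  have hβ : DM S β := by fun_prop
  have hβ' : ∀ x, a₁ < x → x < b₁ → α x < β x ∧ ∀ z, α x < z → z < β x → T x z := by
    intro x hx1 hx2
    obtain ⟨hαe, hx⟩ := h₁ x hx1 hx2
    obtain ⟨f, hf, hf'⟩ := eventually_nhdsGT_iff.1 (hα' x hx.1 hx.2)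
    obtain ⟨g, hg1, hg2⟩ := exists_between (lt_min hf hαe)
    have hmem : α x < g ∧ g < e ∧ ∀ z, α x < z → z < g → T x z :=
      ⟨hg1, hg2.trans_le (min_le_right _ _), fun z h1 h2 =>
        hf' z h1 ((h2.trans hg2).trans_le (min_le_left _ _))⟩
    have hlub : IsLUB {y | α x < y ∧ y < e ∧ ∀ z, α x < z → z < y → T x z} (β x) :=
      DSet.isLUB_dSup (S := S) (DM.pred (by fun_prop)) ⟨g, hmem⟩ ⟨e, fun y hy => hy.2.1.le⟩
    refine ⟨hg1.trans_le (hlub.1 hmem), fun z h1 h2 => ?_⟩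
    obtain ⟨y, hy, hzy, -⟩ := hlub.exists_between h2
    exact hy.2.2 z h1 hzy
  obtain ⟨x₁, hx₁, hx₁c⟩ := ((Ioo_infinite (ha₁.trans hb₁)).diff
    (hα.finite_discontinuous.union hβ.finite_discontinuous)).nonempty
  simp only [mem_union, mem_ofPred_eq, not_or, not_not] at hx₁c
  obtain ⟨c', hc1, hc2⟩ := exists_between (hβ' x₁ hx₁.1 hx₁.2).1
  obtain ⟨d', hd1, hd2⟩ := exists_between hc2
  obtain ⟨a', b', ha', hb', h'⟩ := eventually_nhds_iff_Ioo.1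
    (((hx₁c.1.eventually (gt_mem_nhds hc1)).and (hx₁c.2.eventually (lt_mem_nhds hd2))).and
      (Ioo_mem_nhds hx₁.1 hx₁.2))
  have hsub := Ioo_subset_Ioo_iff (ha'.trans hb') |>.1 fun x hx => (h' x hx.1 hx.2).2
  have hsub' := Ioo_subset_Ioo_iff (ha₁.trans hb₁) |>.1 fun x hx => (h₁ x hx.1 hx.2).2
  refine ⟨a', b', c', d', hsub'.1.trans hsub.1, ha'.trans hb', hsub.2.trans hsub'.2, hd1,
    fun x y k1 k2 k3 k4 => ?_⟩
  obtain ⟨⟨l1, l2⟩, l3⟩ := h' x k1 k2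
  exact (hβ' x l3.1 l3.2).2 y (l1.trans k3) (k4.trans l2)

/-- A definable planar set with infinite fibers over an interval contains a rectangle. -/
theorem exists_rectangle {T : N → N → Prop} (hT : DM S (fun p : N × N => T p.1 p.2))
    {a b : N} (hab : a < b) (h : ∀ x, a < x → x < b → {y | T x y}.Infinite) :
    ∃ a' b' c d, a ≤ a' ∧ a' < b' ∧ b' ≤ b ∧ c < d ∧
      ∀ x y, a' < x → x < b' → c < y → y < d → T x y := by
  obtain ⟨c⟩ := ‹Nonempty N›
  have hd : DM S (fun x => {y | c < y ∧ T x y}.Infinite) := by fun_prop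
  rcases hd.germ_right a with h1 | h1
  · obtain ⟨e, hae, he⟩ := eventually_nhdsGT_iff.1 h1
    obtain ⟨a', b', c', d', k1, k2, k3, k4⟩ := exists_rectangle_right hT (lt_min hae hab)
      fun x h1 h2 => he x h1 (h2.trans_le (min_le_left _ _))
    exact ⟨a', b', c', d', k1, k2, k3.trans (min_le_right _ _), k4⟩
  · obtain ⟨e, hae, he⟩ := eventually_nhdsGT_iff.1 h1
    have key : ∀ x, a < x → x < min e b → {y | y < c ∧ T x y}.Infinite := by
      intro x h1 h2
      have h3 := h x h1 (h2.trans_le (min_le_right _ _))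
      have h4 := not_infinite.1 (he x h1 (h2.trans_le (min_le_left _ _)))
      by_contra h5
      refine h3 (((h4.union (not_infinite.1 h5)).union (finite_singleton c)).subset ?_)
      intro y hy
      rcases lt_trichotomy y c with h | h | h
      · exact Or.inl (Or.inr ⟨h, hy⟩)
      · exact Or.inr h
      · exact Or.inl (Or.inl ⟨h, hy⟩)
    obtain ⟨b', a', d', c', k1, k2, k3, k4, k5⟩ := exists_rectangle_right (N := Nᵒᵈ)
      (S := dual S) (T := fun x y => T (OrderDual.ofDual x) (OrderDual.ofDual y)) hT.dual_rel
      (a := OrderDual.toDual (min e b)) (b := OrderDual.toDual a) (c := OrderDual.toDual c)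
      (lt_min hae hab) fun x h1 h2 => key _ h2 h1
    exact ⟨a', b', c', d', k3, k2, le_trans k1 (min_le_right _ _), k4,
      fun x y l1 l2 l3 l4 => k5 x y l2 l1 l4 l3⟩

theorem infinite_fibers_swap {T : N → N → Prop} (hT : DM S (fun p : N × N => T p.1 p.2))
    (h : {x | {y | T x y}.Infinite}.Infinite) : {y | {x | T x y}.Infinite}.Infinite := by
  have hd : DSet S {x | {y | T x y}.Infinite} := DM.pred (by fun_prop)
  obtain ⟨a, b, hab, hsub⟩ := hd.exists_Ioo_subset h
  obtain ⟨a', b', c, d, -, h1, -, h2, h3⟩ :=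
    exists_rectangle hT hab fun x h1 h2 => hsub ⟨h1, h2⟩
  exact (Ioo_infinite h2).mono fun y hy =>
    (Ioo_infinite h1).mono fun x hx => h3 x y hx.1 hx.2 hy.1 hy.2

end Planar

end OMin

namespace OMin

section RawRank

variable {N : Type u}

/-- Projection of a set forgetting the last coordinate. -/
def base {n : ℕ} (A : Set (Fin (n + 1) → N)) : Set (Fin n → N) := {x | ∃ t, snocN x t ∈ A}

/-- Points with infinite fiber in the last coordinate. -/
def infBase {n : ℕ} (A : Set (Fin (n + 1) → N)) : Set (Fin n → N) :=
  {x | {t | snocN x t ∈ A}.Infinite}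

/-- `0` goes to `0`, and other numbers to their successor. -/
def bump (k : ℕ) : ℕ := if k = 0 then 0 else k + 1

theorem bump_le_succ {a b : ℕ} : bump a ≤ b + 1 ↔ a ≤ b := by
  unfold bump; split <;> omega

theorem bump_max (a b : ℕ) : bump (max a b) = max (bump a) (bump b) := by
  unfold bump; split_ifs <;> omega

theorem bump_mono {a b : ℕ} (h : a ≤ b) : bump a ≤ bump b := by
  unfold bump; split_ifs <;> omega

open Classical in
/-- The dimension plus one of a set of `n`-tuples (zero for the empty set), computed one
coordinate at a time. -/
noncomputable def rkN : (n : ℕ) → Set (Fin n → N) → ℕ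
  | 0, A => if A.Nonempty then 1 else 0
  | n + 1, A => max (rkN n (base A)) (bump (rkN n (infBase A)))

theorem infBase_subset_base {n : ℕ} (A : Set (Fin (n + 1) → N)) : infBase A ⊆ base A :=
  fun _ hx => hx.nonempty

theorem base_mono {n : ℕ} {A B : Set (Fin (n + 1) → N)} (h : A ⊆ B) : base A ⊆ base B :=
  fun _ ⟨t, ht⟩ => ⟨t, h ht⟩

theorem infBase_mono {n : ℕ} {A B : Set (Fin (n + 1) → N)} (h : A ⊆ B) :
    infBase A ⊆ infBase B :=
  fun _ hx => Set.Infinite.mono (fun _ ht => h ht) hx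

theorem rkN_mono {n : ℕ} {A B : Set (Fin n → N)} (h : A ⊆ B) : rkN n A ≤ rkN n B := by
  induction n with
  | zero =>
    unfold rkN
    split_ifs with h1 h2
    · rfl
    · exact (h2 (h1.mono h)).elim
    · simp
    · rfl
  | succ n ih => exact max_le_max (ih (base_mono h)) (bump_mono (ih (infBase_mono h)))

theorem rkN_union {n : ℕ} (A B : Set (Fin n → N)) : rkN n (A ∪ B) = max (rkN n A) (rkN n B) := by
  induction n with
  | zero =>
    simp only [rkN, union_nonempty]
    by_cases h1 : A.Nonempty <;> by_cases h2 : B.Nonempty <;> simp [h1, h2]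
  | succ n ih =>
    have h1 : base (A ∪ B) = base A ∪ base B := by
      ext x
      exact exists_or
    have h2 : infBase (A ∪ B) = infBase A ∪ infBase B := by
      ext x
      exact infinite_union
    simp only [rkN, h1, h2, ih, bump_max]
    omega

theorem rkN_eq_zero {n : ℕ} {A : Set (Fin n → N)} : rkN n A = 0 ↔ A = ∅ := by
  induction n with
  | zero =>
    unfold rkN
    split_ifs with h
    · simp [h.ne_empty]
    · simp [not_nonempty_iff_eq_empty.1 h]
  | succ n ih =>
    constructor
    · intro h
      have h1 : base A = ∅ := ih.1 (by simp only [rkN] at h; omega)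
      refine eq_empty_of_forall_notMem fun x hx => ?_
      have : (fun i => x (Fin.castSucc i)) ∈ base A := ⟨x (Fin.last n), by rwa [snocN_init]⟩
      rw [h1] at this
      exact this
    · rintro rfl
      have h1 : base (∅ : Set (Fin (n + 1) → N)) = ∅ := by simp [base]
      have h2 : infBase (∅ : Set (Fin (n + 1) → N)) = ∅ := by simp [infBase]
      simp [rkN, h1, h2, ih.2 rfl, bump]

theorem rkN_le {n : ℕ} (A : Set (Fin n → N)) : rkN n A ≤ n + 1 := by
  induction n with
  | zero => unfold rkN; split <;> simp
  | succ n ih => exact max_le ((ih _).trans (by omega)) (bump_le_succ.2 (ih _))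

/-- Fiber of a set of tuples over a tuple of initial coordinates. -/
def fib {m n : ℕ} (A : Set (Fin (m + n) → N)) (x : Fin m → N) : Set (Fin n → N) :=
  {y | Fin.append x y ∈ A}

theorem append_snocN {m n : ℕ} (x : Fin m → N) (y : Fin n → N) (t : N) :
    (Fin.append x (snocN y t) : Fin (m + (n + 1)) → N) = snocN (Fin.append x y) t := by
  funext i
  refine Fin.addCases (fun i => ?_) (fun i => ?_) i
  · rw [Fin.append_left]
    have : Fin.castAdd (n + 1) i = (Fin.castAdd n i).castSucc := rfl
    rw [this, snocN_castSucc, Fin.append_left]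
  · rw [Fin.append_right]
    refine Fin.lastCases ?_ (fun i => ?_) i
    · have : Fin.natAdd m (Fin.last n) = Fin.last (m + n) := rfl
      rw [this, snocN_last, snocN_last]
    · have : Fin.natAdd m i.castSucc = (Fin.natAdd m i).castSucc := rfl
      rw [this, snocN_castSucc, snocN_castSucc, Fin.append_right]

theorem fib_base {m n : ℕ} (A : Set (Fin (m + (n + 1)) → N)) (x : Fin m → N) :
    fib (n := n) (base (n := m + n) A) x = base (fib A x) := by
  ext y
  simp only [fib, base, mem_ofPred_eq, append_snocN]

theorem fib_infBase {m n : ℕ} (A : Set (Fin (m + (n + 1)) → N)) (x : Fin m → N) :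
    fib (n := n) (infBase (n := m + n) A) x = infBase (fib A x) := by
  ext y
  simp only [fib, infBase, mem_ofPred_eq, append_snocN]

theorem append_elim {m : ℕ} (x : Fin m → N) (y : Fin 0 → N) :
    (Fin.append x y : Fin m → N) = x := by
  funext i
  exact Fin.append_left x y i

theorem rkN_add_le {m n k : ℕ} {A : Set (Fin (m + n) → N)} {C : Set (Fin m → N)}
    (hC : ∀ x, (fib A x).Nonempty → x ∈ C)
    (h : ∀ x, rkN n (fib A x) ≤ k + 1) : rkN (m + n) A ≤ rkN m C + k := by
  induction n generalizing k with
  | zero =>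
    refine (rkN_mono (B := C) fun x hx => hC x ⟨Fin.elim0, ?_⟩).trans (Nat.le_add_right _ _)
    change Fin.append x Fin.elim0 ∈ A
    rwa [append_elim]
  | succ n ih =>
    have hb : ∀ x, (fib (m := m) (n := n) (base (n := m + n) A) x).Nonempty → x ∈ C := by
      rintro x ⟨y, hy⟩
      rw [fib_base] at hy
      obtain ⟨t, ht⟩ := hy
      exact hC x ⟨_, ht⟩
    refine max_le (ih hb fun x => ?_) ?_
    · rw [fib_base]
      exact (le_max_left _ _).trans (h x)
    · have hi : ∀ x, rkN n (fib (n := n) (infBase (n := m + n) A) x) ≤ k := by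
        intro x
        rw [fib_infBase, ← bump_le_succ]
        exact (le_max_right _ _).trans (h x)
      rcases k with - | k
      · have : infBase (n := m + n) A = ∅ := by
          refine eq_empty_of_forall_notMem fun z hz => ?_
          have h1 := rkN_eq_zero.1 (Nat.le_zero.1 (hi fun i => z (Fin.castAdd n i)))
          have : (fun i => z (Fin.natAdd m i)) ∈
              fib (infBase (n := m + n) A) fun i => z (Fin.castAdd n i) := by
            change Fin.append (fun i => z (Fin.castAdd n i)) (fun i => z (Fin.natAdd m i)) ∈
              infBase (n := m + n) A
            convert hz using 1
            exact Fin.append_castAdd_natAdd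
          rw [h1] at this
          exact this
        change bump (rkN (m + n) (infBase (n := m + n) A)) ≤ _
        rw [rkN_eq_zero.2 this]
        simp [bump]
      · rw [← add_assoc, bump_le_succ]
        refine ih (fun x hx => hb x (hx.mono ?_)) hi
        exact fun y hy => infBase_subset_base (n := m + n) A hy

theorem rkN_add_ge {m n k : ℕ} {A : Set (Fin (m + n) → N)} {C : Set (Fin m → N)}
    (hC : C.Nonempty) (h : ∀ x ∈ C, k + 1 ≤ rkN n (fib A x)) : rkN m C + k ≤ rkN (m + n) A := by
  induction n generalizing k C with
  | zero =>
    obtain ⟨x, hx⟩ := hC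
    have hk : k = 0 := by
      have := (h x hx).trans (rkN_le _)
      omega
    subst hk
    refine rkN_mono (B := A) fun x hx => ?_
    have h1 : rkN 0 (fib A x) ≠ 0 := by have := h x hx; omega
    obtain ⟨y, hy⟩ := nonempty_iff_ne_empty.2 (mt rkN_eq_zero.2 h1)
    change Fin.append x y ∈ A at hy
    rwa [append_elim] at hy
  | succ n ih =>
    change _ ≤ max (rkN (m + n) (base (n := m + n) A)) (bump (rkN (m + n) (infBase (n := m + n) A)))
    set C₁ := {x ∈ C | k + 1 ≤ rkN n (base (fib A x))}
    set C₂ := {x ∈ C | k + 1 ≤ bump (rkN n (infBase (fib A x)))}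
    have hCU : C = C₁ ∪ C₂ := by
      ext x
      constructor
      · intro hx
        rcases le_max_iff.1 (h x hx) with h1 | h1
        · exact Or.inl ⟨hx, h1⟩
        · exact Or.inr ⟨hx, h1⟩
      · rintro (hx | hx) <;> exact hx.1
    have hCr := rkN_union C₁ C₂
    rw [← hCU] at hCr
    have hC0 : rkN m C ≠ 0 := fun h0 => hC.ne_empty (rkN_eq_zero.1 h0)
    have hne : ∀ {B : Set (Fin m → N)}, rkN m C = rkN m B → B.Nonempty := fun hB =>
      nonempty_iff_ne_empty.2 fun h0 => hC0 (hB.trans (rkN_eq_zero.2 h0))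
    rcases max_choice (rkN m C₁) (rkN m C₂) with h1 | h1 <;> rw [h1] at hCr
    · refine le_max_of_le_left ?_
      rw [hCr]
      refine ih (hne hCr) fun x hx => ?_
      rw [fib_base]
      exact hx.2
    · refine le_max_of_le_right ?_
      have h2 : ∀ x ∈ C₂, 1 ≤ rkN n (infBase (fib A x)) ∧ k ≤ rkN n (infBase (fib A x)) := by
        intro x hx
        have := hx.2
        unfold bump at this
        split_ifs at this <;> omega
      have key : ∀ j, (∀ x ∈ C₂, j + 1 ≤ rkN n (infBase (fib A x))) →
          rkN m C + j + 1 ≤ bump (rkN (m + n) (infBase (n := m + n) A)) := by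
        intro j hj
        have h3 := ih (k := j) (A := infBase (n := m + n) A) (hne hCr) (by
          intro x hx
          rw [fib_infBase]
          exact hj x hx)
        unfold bump
        split_ifs <;> omega
      rcases k with - | k
      · exact (Nat.le_succ _).trans (key 0 fun x hx => (h2 x hx).1)
      · exact key k fun x hx => (h2 x hx).2

end RawRank

section Definable

variable {N : Type u} [LinearOrder N] [DenselyOrdered N] [NoMinOrder N] [NoMaxOrder N]
  [Nonempty N] {S : Struc N} {X Y Z : Type*} [DefTy S X] [DefTy S Y] [DefTy S Z]

theorem DM.le_rkN {n : ℕ} {T : X → (Fin n → N) → Prop}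
    (hT : DM S (fun p : X × (Fin n → N) => T p.1 p.2)) (k : ℕ) :
    DM S (fun x => k ≤ rkN n {y | T x y}) := by
  induction n generalizing k with
  | zero =>
    rcases k with - | k
    · exact DM.iff_congr (P := fun _ => True) (by fun_prop) (by simp)
    · refine DM.iff_congr (P := fun x => k = 0 ∧ ∃ y, T x y) (by fun_prop) fun x => ?_
      simp only [rkN]
      split_ifs with h
      · exact ⟨fun h1 => ⟨by omega, h⟩, fun h1 => by omega⟩
      · exact ⟨fun h1 => by omega, fun h1 => (h h1.2).elim⟩
  | succ n ih =>
    have h1 := ih (T := fun x y => ∃ t, T x (OMin.snocN y t)) (by fun_prop)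
    have h2 := ih (T := fun x y => {t | T x (OMin.snocN y t)}.Infinite) (by fun_prop)
    have h3 := h1 k
    have h4 := h2 (k - 1)
    have h5 := h2 1
    refine DM.iff_congr (P := fun x => k ≤ rkN n {y | ∃ t, T x (OMin.snocN y t)} ∨
      (k - 1 ≤ rkN n {y | {t | T x (OMin.snocN y t)}.Infinite} ∧
        1 ≤ rkN n {y | {t | T x (OMin.snocN y t)}.Infinite})) (by fun_prop) fun x => ?_
    change k ≤ max (rkN n {y | ∃ t, T x (OMin.snocN y t)})
      (bump (rkN n {y | {t | T x (OMin.snocN y t)}.Infinite})) ↔ _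
    rw [le_max_iff]
    unfold bump
    split_ifs <;> omega

end Definable

end OMin

namespace OMin

section Perm

theorem infinite_proj_or_fiber {α β : Type*} (P : α → β → Prop) :
    ({s | ∃ t, P s t}.Infinite ∨ ∃ s, {t | P s t}.Infinite) ↔
      {p : α × β | P p.1 p.2}.Infinite := by
  constructor
  · rintro (h | ⟨s, h⟩)
    · refine Infinite.of_image Prod.fst (h.mono ?_)
      rintro s ⟨t, ht⟩
      exact ⟨(s, t), ht, rfl⟩
    · refine Infinite.of_image Prod.snd (h.mono ?_)
      exact fun t ht => ⟨(s, t), ht, rfl⟩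
  · intro h
    by_contra! hcon
    obtain ⟨h1, h2⟩ := hcon
    refine h ((h1.biUnion
      (fun s _ => (h2 s).image (Prod.mk s))).subset ?_)
    rintro ⟨s, t⟩ hst
    exact mem_iUnion₂.2 ⟨s, ⟨t, hst⟩, t, hst, rfl⟩

variable {N : Type u}

theorem snocN_comp_swap_last {n : ℕ} (x : Fin n → N) (s t : N) :
    snocN (snocN x s) t ∘ Equiv.swap (Fin.last n).castSucc (Fin.last n).succ =
      snocN (snocN x t) s := by
  funext i
  refine Fin.lastCases ?_ (fun i => Fin.lastCases ?_ (fun i => ?_) i) i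
  · rw [Function.comp_apply, ← Fin.succ_last, Equiv.swap_apply_right, Fin.succ_last]
    simp
  · rw [Function.comp_apply, Equiv.swap_apply_left, Fin.succ_last]
    simp
  · rw [Function.comp_apply, Equiv.swap_apply_of_ne_of_ne]
    · simp
    · simp [Fin.ext_iff, i.2.ne]
    · simp only [ne_eq, Fin.ext_iff, Fin.val_castSucc, Fin.val_succ, Fin.val_last]
      omega

theorem snocN_comp_swap_castSucc {n : ℕ} (x : Fin (n + 1) → N) (t : N) (i : Fin n) :
    snocN x t ∘ Equiv.swap i.castSucc.castSucc i.castSucc.succ =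
      snocN (x ∘ Equiv.swap i.castSucc i.succ) t := by
  funext j
  refine Fin.lastCases ?_ (fun j => ?_) j
  · rw [Function.comp_apply, Equiv.swap_apply_of_ne_of_ne]
    · simp
    · exact (Fin.castSucc_lt_last _).ne'
    · rw [Fin.succ_castSucc]
      exact (Fin.castSucc_lt_last _).ne'
  · rw [Function.comp_apply, snocN_castSucc, Function.comp_apply, Fin.succ_castSucc,
      ← Function.Injective.map_swap (Fin.castSucc_injective _), snocN_castSucc]

theorem rkN_succ_succ {n : ℕ} (A : Set (Fin (n + 2) → N)) :
    rkN (n + 2) A = max (max (rkN n {x | ∃ s t, snocN (snocN x s) t ∈ A})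
      (bump (rkN n {x | {p : N × N | snocN (snocN x p.1) p.2 ∈ A}.Infinite})))
      (bump (bump (rkN n {x | {s | {t | snocN (snocN x s) t ∈ A}.Infinite}.Infinite}))) := by
  have h : {x | {p : N × N | snocN (snocN x p.1) p.2 ∈ A}.Infinite} =
      infBase (base A) ∪ base (infBase A) := by
    ext x
    exact (infinite_proj_or_fiber fun s t => snocN (snocN x s) t ∈ A).symm
  rw [h, rkN_union, bump_max]
  change max (max _ _) (bump (max _ (bump _))) = _
  rw [bump_max, max_assoc, max_assoc, max_assoc]
  rfl

variable [LinearOrder N] [DenselyOrdered N] [NoMinOrder N] [NoMaxOrder N]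
  [Nonempty N] {S : Struc N} [TopologicalSpace N] [OrderTopology N]

theorem rkN_swap_last {n : ℕ} {A : Set (Fin (n + 2) → N)} (hA : DSet S A) :
    rkN (n + 2) {x | x ∘ Equiv.swap (Fin.last n).castSucc (Fin.last n).succ ∈ A} =
      rkN (n + 2) A := by
  rw [rkN_succ_succ, rkN_succ_succ]
  simp only [mem_ofPred_eq, snocN_comp_swap_last]
  have hA' : DM S (fun x => x ∈ A) := dm_iff_dset.2 hA
  have h1 : {x : Fin n → N | ∃ s t, snocN (snocN x t) s ∈ A} =
      {x | ∃ s t, snocN (snocN x s) t ∈ A} := by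
    ext x
    exact exists_comm
  have h2 : {x : Fin n → N | {p : N × N | snocN (snocN x p.2) p.1 ∈ A}.Infinite} =
      {x | {p : N × N | snocN (snocN x p.1) p.2 ∈ A}.Infinite} := by
    ext x
    constructor
    · intro h
      refine (h.image (f := Prod.swap) Prod.swap_injective.injOn).mono ?_
      rintro _ ⟨p, hp, rfl⟩
      exact hp
    · intro h
      refine (h.image (f := Prod.swap) Prod.swap_injective.injOn).mono ?_
      rintro _ ⟨p, hp, rfl⟩
      exact hp
  have h3 : {x : Fin n → N | {s | {t | snocN (snocN x t) s ∈ A}.Infinite}.Infinite} =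
      {x | {s | {t | snocN (snocN x s) t ∈ A}.Infinite}.Infinite} := by
    ext x
    exact ⟨infinite_fibers_swap (S := S) (T := fun s t => snocN (snocN x t) s ∈ A) (by fun_prop),
      infinite_fibers_swap (S := S) (T := fun s t => snocN (snocN x s) t ∈ A) (by fun_prop)⟩
  rw [h1, h2, h3]

theorem rkN_swap {n : ℕ} (i : Fin n) {A : Set (Fin (n + 1) → N)} (hA : DSet S A) :
    rkN (n + 1) {x | x ∘ Equiv.swap i.castSucc i.succ ∈ A} = rkN (n + 1) A := by
  induction n with
  | zero => exact i.elim0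
  | succ n ih =>
    refine Fin.lastCases ?_ (fun i => ?_) i
    · exact rkN_swap_last hA
    · have hA' : DM S (fun x => x ∈ A) := dm_iff_dset.2 hA
      change max (rkN (n + 1) {x | ∃ t, snocN x t ∘ _ ∈ A})
        (bump (rkN (n + 1) {x | {t | snocN x t ∘ _ ∈ A}.Infinite})) = _
      simp only [snocN_comp_swap_castSucc]
      change max (rkN (n + 1) {x | x ∘ _ ∈ base A})
        (bump (rkN (n + 1) {x | x ∘ _ ∈ infBase A})) = _
      rw [ih i (A := base A) (DM.pred (by fun_prop)), ih i (A := infBase A) (DM.pred (by fun_prop))]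
      rfl

theorem DSet.comp_fin {m n : ℕ} {A : Set (Fin m → N)} (hA : DSet S A) (g : Fin m → Fin n) :
    DSet S {x : Fin n → N | x ∘ g ∈ A} :=
  DM.preimage (f := fun x : Fin n → N => x ∘ g) (DM.pi fun i => DM.apply' (g i)) hA

theorem rkN_perm {n : ℕ} (σ : Equiv.Perm (Fin n)) {A : Set (Fin n → N)} (hA : DSet S A) :
    rkN n {x | x ∘ σ ∈ A} = rkN n A := by
  rcases n with - | n
  · congr 1
    ext x
    rw [mem_ofPred_eq, Subsingleton.elim (x ∘ σ) x]
  · have hσ : σ ∈ Submonoid.closure (range fun i : Fin n => Equiv.swap i.castSucc i.succ) := by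
      rw [Equiv.Perm.mclosure_swap_castSucc_succ]
      exact Submonoid.mem_top σ
    induction hσ using Submonoid.closure_induction generalizing A with
    | mem σ h =>
      obtain ⟨i, rfl⟩ := h
      exact rkN_swap i hA
    | one => rfl
    | mul σ τ _ _ h1 h2 =>
      rw [← h2 hA, ← h1 (hA.comp_fin τ)]
      rfl

theorem rkN_equiv {m n : ℕ} (e : Fin m ≃ Fin n) {A : Set (Fin m → N)} (hA : DSet S A) :
    rkN n {x | x ∘ e ∈ A} = rkN m A := by
  obtain rfl : m = n := by simpa using Fintype.card_congr e
  exact rkN_perm e hA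

end Perm

end OMin

namespace OMin

open DefTy

section Rank

variable {N : Type u} [LinearOrder N] [DenselyOrdered N] [NoMinOrder N] [NoMaxOrder N]
  [Nonempty N] {S : Struc N} {X Y Z : Type*} [DefTy S X] [DefTy S Y] [DefTy S Z]

variable (S) in
/-- The coordinates of a point, listed. -/
noncomputable def code (x : X) : Fin (Fintype.card (Ix S X)) → N :=
  emb (S := S) x ∘ (Fintype.equivFin (Ix S X)).symm

theorem code_injective : Function.Injective (code S : X → _) := by
  intro x y h
  apply inj (S := S)
  funext i
  simpa [code] using congrFun h (Fintype.equivFin (Ix S X) i)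

@[fun_prop]
theorem DM.code : DM S (fun x : X => code S x) :=
  DM.pi fun i => CoordMap.dm ⟨fun _ => (Fintype.equivFin (Ix S X)).symm i, fun _ => rfl⟩

variable (S) in
/-- The dimension plus one of a set of points (zero for the empty set). -/
noncomputable def rk (A : Set X) : ℕ := rkN _ (code S '' A)

theorem rk_mono {A B : Set X} (h : A ⊆ B) : rk S A ≤ rk S B := rkN_mono (image_mono h)

theorem rk_union (A B : Set X) : rk S (A ∪ B) = max (rk S A) (rk S B) := by
  unfold rk
  rw [image_union, rkN_union]

theorem rk_eq_zero {A : Set X} : rk S A = 0 ↔ A = ∅ := by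
  unfold rk
  rw [rkN_eq_zero, image_eq_empty]

theorem rk_pos {A : Set X} : 1 ≤ rk S A ↔ A.Nonempty := by
  rw [nonempty_iff_ne_empty, ne_eq, ← rk_eq_zero (S := S)]
  omega

variable [TopologicalSpace N] [OrderTopology N]

theorem rk_fin {n : ℕ} {A : Set (Fin n → N)} (hA : DSet S A) : rk S A = rkN n A := by
  have h : code S '' A = {z | z ∘ (Fintype.equivFin (Fin n)) ∈ A} := by
    ext z
    constructor
    · rintro ⟨x, hx, rfl⟩
      have : code S x ∘ Fintype.equivFin (Fin n) = x :=
        funext fun i => congrArg x ((Fintype.equivFin (Fin n)).symm_apply_apply i)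
      change code S x ∘ Fintype.equivFin (Fin n) ∈ A
      rwa [this]
    · intro h
      exact ⟨_, h, funext fun i => congrArg z ((Fintype.equivFin (Fin n)).apply_symm_apply i)⟩
  unfold rk
  rw [h]
  exact rkN_equiv _ hA

/-- The sum of the code lengths, as the code length of the product. -/
noncomputable def prodEquiv (S : Struc N) (X Y : Type*) [DefTy S X] [DefTy S Y] :
    Fin (Fintype.card (Ix S (X × Y))) ≃ Fin (Fintype.card (Ix S X) + Fintype.card (Ix S Y)) :=
  (Fintype.equivFin (Ix S (X × Y))).symm.trans
    ((Equiv.sumCongr (Fintype.equivFin _) (Fintype.equivFin _)).trans finSumFinEquiv)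

theorem code_prod (x : X) (y : Y) :
    code S (x, y) = Fin.append (code S x) (code S y) ∘ prodEquiv S X Y := by
  funext i
  obtain ⟨j, rfl⟩ := (Fintype.equivFin (Ix S (X × Y))).surjective i
  simp only [code, Function.comp_apply, Equiv.symm_apply_apply, prodEquiv, Equiv.trans_apply]
  rcases j with j | j
  · change emb x j = _
    rw [Equiv.sumCongr_apply, Sum.map_inl, finSumFinEquiv_apply_left, Fin.append_left]
    simp
  · change emb y j = _
    rw [Equiv.sumCongr_apply, Sum.map_inr, finSumFinEquiv_apply_right, Fin.append_right]
    simp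

/-- Codes of the elements of a subset of a product, with the two parts separated. -/
def prodCode (S : Struc N) {X Y : Type*} [DefTy S X] [DefTy S Y] (A : Set (X × Y)) :
    Set (Fin (Fintype.card (Ix S X) + Fintype.card (Ix S Y)) → N) :=
  {z | z ∘ prodEquiv S X Y ∈ code S '' A}

theorem append_mem_prodCode {A : Set (X × Y)} {z w} : Fin.append z w ∈ prodCode S A ↔
    ∃ x y, (x, y) ∈ A ∧ code S x = z ∧ code S y = w := by
  constructor
  · rintro ⟨⟨x, y⟩, h, he⟩
    rw [code_prod] at he
    have he' := (prodEquiv S X Y).surjective.injective_comp_right he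
    refine ⟨x, y, h, ?_, ?_⟩
    · funext i
      simpa using congrFun he' (Fin.castAdd _ i)
    · funext i
      simpa using congrFun he' (Fin.natAdd _ i)
  · rintro ⟨x, y, h, rfl, rfl⟩
    exact ⟨(x, y), h, code_prod x y⟩

theorem mem_fib {m n : ℕ} {A : Set (Fin (m + n) → N)} {x : Fin m → N} {y : Fin n → N} :
    y ∈ fib A x ↔ Fin.append x y ∈ A := Iff.rfl

theorem fib_prodCode (A : Set (X × Y)) (x : X) :
    fib (prodCode S A) (code S x) = code S '' {y | (x, y) ∈ A} := by
  ext w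
  rw [mem_fib, append_mem_prodCode]
  constructor
  · rintro ⟨x', y, h, hx, rfl⟩
    exact ⟨y, code_injective hx ▸ h, rfl⟩
  · rintro ⟨y, h, rfl⟩
    exact ⟨x, y, h, rfl, rfl⟩

theorem rk_prodCode {A : Set (X × Y)} (hA : DSet S A) : rkN _ (prodCode S A) = rk S A :=
  rkN_equiv _ (hA.image DM.code)

theorem rk_le_fst {A : Set (X × Y)} (hA : DSet S A) {k : ℕ}
    (h : ∀ x, rk S {y | (x, y) ∈ A} ≤ k + 1) : rk S A ≤ rk S {x | ∃ y, (x, y) ∈ A} + k := by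
  rw [← rk_prodCode hA]
  refine rkN_add_le (A := prodCode S A) (C := code S '' {x | ∃ y, (x, y) ∈ A}) ?_ ?_
  · rintro z ⟨w, hw⟩
    have hw := append_mem_prodCode.1 (show Fin.append z w ∈ prodCode S A from hw)
    obtain ⟨x, y, h, rfl, rfl⟩ := hw
    exact ⟨x, ⟨y, h⟩, rfl⟩
  · intro z
    rcases (fib (prodCode S A) z).eq_empty_or_nonempty with h0 | ⟨w, hw⟩
    · rw [rkN_eq_zero.2 h0]
      exact Nat.zero_le _
    · have hw := append_mem_prodCode.1 (show Fin.append z w ∈ prodCode S A from hw)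
      obtain ⟨x, y, -, rfl, rfl⟩ := hw
      rw [fib_prodCode]
      exact h x

theorem le_rk_fst {A : Set (X × Y)} (hA : DSet S A) {C : Set X} (hC : C.Nonempty) {k : ℕ}
    (h : ∀ x ∈ C, k + 1 ≤ rk S {y | (x, y) ∈ A}) : rk S C + k ≤ rk S A := by
  rw [← rk_prodCode hA]
  refine rkN_add_ge (hC.image _) ?_
  rintro _ ⟨x, hx, rfl⟩
  rw [fib_prodCode]
  exact h x hx

theorem rk_swap {A : Set (X × Y)} (hA : DSet S A) : rk S {p : Y × X | (p.2, p.1) ∈ A} = rk S A := by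
  have hA' : DSet S {p : Y × X | (p.2, p.1) ∈ A} :=
    DM.preimage (f := fun p : Y × X => (p.2, p.1)) (by fun_prop) hA
  let e : Fin (Fintype.card (Ix S X) + Fintype.card (Ix S Y)) ≃
      Fin (Fintype.card (Ix S Y) + Fintype.card (Ix S X)) :=
    finSumFinEquiv.symm.trans ((Equiv.sumComm _ _).trans finSumFinEquiv)
  rw [← rk_prodCode hA, ← rk_prodCode hA', ← rkN_equiv e]
  · congr 1
    ext z
    obtain ⟨z₁, z₂, rfl⟩ : ∃ z₁ z₂, z = Fin.append z₁ z₂ :=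
      ⟨_, _, (Fin.append_castAdd_natAdd).symm⟩
    have he : Fin.append z₁ z₂ ∘ e = Fin.append z₂ z₁ := by
      funext i
      refine Fin.addCases (fun i => ?_) (fun i => ?_) i <;> simp [e]
    rw [mem_ofPred_eq, he, append_mem_prodCode, append_mem_prodCode]
    constructor
    · rintro ⟨y, x, h, h1, h2⟩
      exact ⟨x, y, h, h2, h1⟩
    · rintro ⟨y, x, h, h1, h2⟩
      exact ⟨x, y, h, h2, h1⟩
  · exact (hA.image DM.code).comp_fin _

@[fun_prop]
theorem DM.le_rk {T : X → Y → Prop} (hT : DM S (fun p : X × Y => T p.1 p.2)) (k : ℕ) :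
    DM S (fun x => k ≤ rk S {y | T x y}) :=
  DM.le_rkN (T := fun x z => ∃ y, T x y ∧ OMin.code S y = z) (by fun_prop) k

@[fun_prop]
theorem DM.rk_lt {T : X → Y → Prop} (hT : DM S (fun p : X × Y => T p.1 p.2)) (k : ℕ) :
    DM S (fun x => rk S {y | T x y} < k) :=
  (hT.le_rk k).not.iff_congr fun x => by omega

end Rank

end OMin

namespace OMin

section Rank

variable {N : Type u} [LinearOrder N] [DenselyOrdered N] [NoMinOrder N] [NoMaxOrder N]
  [Nonempty N] {S : Struc N} {X Y Z : Type*} [DefTy S X] [DefTy S Y] [DefTy S Z]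
  [TopologicalSpace N] [OrderTopology N]

theorem DSet.dm {A : Set X} (hA : DSet S A) : DM S (fun x => x ∈ A) := dm_iff_dset.2 hA

theorem rk_le_snd {A : Set (X × Y)} (hA : DSet S A) {k : ℕ}
    (h : ∀ y, rk S {x | (x, y) ∈ A} ≤ k + 1) : rk S A ≤ rk S {y | ∃ x, (x, y) ∈ A} + k := by
  have hA' := hA.dm
  rw [← rk_swap hA]
  exact rk_le_fst (A := {p : Y × X | (p.2, p.1) ∈ A}) (DM.pred (by fun_prop)) h

theorem le_rk_snd {A : Set (X × Y)} (hA : DSet S A) {C : Set Y} (hC : C.Nonempty) {k : ℕ}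
    (h : ∀ y ∈ C, k + 1 ≤ rk S {x | (x, y) ∈ A}) : rk S C + k ≤ rk S A := by
  have hA' := hA.dm
  rw [← rk_swap hA]
  exact le_rk_fst (A := {p : Y × X | (p.2, p.1) ∈ A}) (DM.pred (by fun_prop)) hC h

theorem rkN_singleton {n : ℕ} (x : Fin n → N) : rkN n {x} ≤ 1 := by
  induction n with
  | zero => exact rkN_le _
  | succ n ih =>
    have h1 : base {x} ⊆ {fun i => x i.castSucc} := by
      rintro y ⟨t, ht⟩
      obtain rfl : snocN y t = x := ht
      simp
    have h2 : infBase {x} = ∅ := by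
      refine eq_empty_of_forall_notMem fun y hy => hy ?_
      refine Set.Subsingleton.finite fun s hs t ht => ?_
      exact (snocN_inj.1 ((show snocN y s = x from hs).trans (show snocN y t = x from ht).symm)).2
    change max _ (bump _) ≤ 1
    rw [h2, rkN_eq_zero.2 rfl]
    exact max_le ((rkN_mono h1).trans (ih _)) (by simp [bump])

theorem rk_singleton (x : X) : rk S {x} = 1 := by
  refine le_antisymm ?_ (rk_pos.2 (singleton_nonempty x))
  unfold rk
  rw [image_singleton]
  exact rkN_singleton _

theorem rk_le_one_of_subsingleton {A : Set X} (hA : A.Subsingleton) : rk S A ≤ 1 := by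
  rcases hA.eq_empty_or_singleton with rfl | ⟨x, rfl⟩
  · rw [rk_eq_zero.2 rfl]
    exact Nat.zero_le _
  · exact (rk_singleton x).le

theorem rk_biUnion_le {ι : Type*} {s : Set ι} (hs : s.Finite) {A : ι → Set X} {k : ℕ}
    (h : ∀ i ∈ s, rk S (A i) ≤ k) : rk S (⋃ i ∈ s, A i) ≤ k := by
  induction s, hs using Set.Finite.induction_on with
  | empty =>
    simp only [mem_empty_iff_false, iUnion_of_empty, iUnion_empty]
    rw [rk_eq_zero.2 rfl]
    exact Nat.zero_le _
  | insert _ _ ih =>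
    rw [biUnion_insert, rk_union]
    exact max_le (h _ (mem_insert _ _)) (ih fun i hi => h i (mem_insert_of_mem _ hi))

theorem rk_iUnion_le {ι : Type*} [Finite ι] {A : ι → Set X} {k : ℕ}
    (h : ∀ i, rk S (A i) ≤ k) : rk S (⋃ i, A i) ≤ k := by
  simpa using rk_biUnion_le (S := S) (s := univ) finite_univ fun i _ => h i

theorem rk_le_one_of_finite {A : Set X} (hA : A.Finite) : rk S A ≤ 1 := by
  have := rk_biUnion_le (S := S) hA (A := fun x => {x}) fun x _ => (rk_singleton x).le
  rwa [biUnion_of_singleton] at this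

/-- The rank of a set in terms of the fibers of a map. -/
theorem rk_le_of_fibers {f : X → Y} (hf : DM S f) {A : Set X} (hA : DSet S A) {k : ℕ}
    (h : ∀ y, rk S {x | x ∈ A ∧ f x = y} ≤ k + 1) : rk S A ≤ rk S (f '' A) + k := by
  have hA' := hA.dm
  have hd : DSet S {p : X × Y | p.1 ∈ A ∧ f p.1 = p.2} := DM.pred (by fun_prop)
  refine le_trans ?_ (rk_le_snd hd h)
  rcases A.eq_empty_or_nonempty with rfl | hne
  · rw [rk_eq_zero.2 rfl]
    exact Nat.zero_le _
  · exact le_rk_fst (k := 0) hd hne fun x hx => rk_pos.2 ⟨f x, hx, rfl⟩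

theorem le_rk_of_fibers {f : X → Y} (hf : DM S f) {A : Set X} (hA : DSet S A) {k : ℕ}
    {C : Set Y} (hC : C.Nonempty)
    (h : ∀ y ∈ C, k + 1 ≤ rk S {x | x ∈ A ∧ f x = y}) : rk S C + k ≤ rk S A := by
  have hA' := hA.dm
  have hd : DSet S {p : X × Y | p.1 ∈ A ∧ f p.1 = p.2} := DM.pred (by fun_prop)
  refine (le_rk_snd hd hC h).trans ((rk_le_fst (k := 0) hd fun x => ?_).trans (rk_mono ?_))
  · refine rk_le_one_of_subsingleton fun y hy z hz => ?_
    exact hy.2.symm.trans hz.2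
  · rintro x ⟨y, hy⟩
    exact hy.1

theorem rk_image_le {f : X → Y} (hf : DM S f) {A : Set X} (hA : DSet S A) :
    rk S (f '' A) ≤ rk S A := by
  rcases A.eq_empty_or_nonempty with rfl | hne
  · rw [image_empty, rk_eq_zero.2 rfl]
    exact Nat.zero_le _
  · refine le_rk_of_fibers (k := 0) hf hA (hne.image f) ?_
    rintro _ ⟨x, hx, rfl⟩
    exact rk_pos.2 ⟨x, hx, rfl⟩

theorem rk_le_image {f : X → Y} (hf : DM S f) {A : Set X} (hA : DSet S A) (hi : InjOn f A) :
    rk S A ≤ rk S (f '' A) :=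
  rk_le_of_fibers (k := 0) hf hA fun _ => rk_le_one_of_subsingleton fun _ hx _ hz =>
    hi hx.1 hz.1 (hx.2.trans hz.2.symm)

theorem rk_image_eq {f : X → Y} (hf : DM S f) {A : Set X} (hA : DSet S A) (hi : InjOn f A) :
    rk S (f '' A) = rk S A := le_antisymm (rk_image_le hf hA) (rk_le_image hf hA hi)

theorem rk_le_of_injOn {f : X → Y} (hf : DM S f) {A : Set X} (hA : DSet S A) (hi : InjOn f A)
    {B : Set Y} (hm : MapsTo f A B) : rk S A ≤ rk S B :=
  (rk_le_image hf hA hi).trans (rk_mono hm.image_subset)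

theorem rk_prod {A : Set X} {B : Set Y} (hA : DSet S A) (hB : DSet S B) (hA0 : A.Nonempty)
    (hB0 : B.Nonempty) : rk S {p : X × Y | p.1 ∈ A ∧ p.2 ∈ B} + 1 = rk S A + rk S B := by
  have hA' := hA.dm
  have hB' := hB.dm
  have hd : DSet S {p : X × Y | p.1 ∈ A ∧ p.2 ∈ B} := DM.pred (by fun_prop)
  have h1 := rk_pos (S := S).2 hB0
  have h2 := rk_le_fst (k := rk S B - 1) hd fun x => by
    rw [Nat.sub_add_cancel h1]
    exact rk_mono fun y hy => hy.2
  have h3 := le_rk_fst (k := rk S B - 1) hd hA0 fun x hx => by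
    rw [Nat.sub_add_cancel h1]
    exact rk_mono fun y hy => ⟨hx, hy⟩
  have h4 : rk S {x | ∃ y, (x, y) ∈ {p : X × Y | p.1 ∈ A ∧ p.2 ∈ B}} ≤ rk S A :=
    rk_mono fun x ⟨y, hy⟩ => hy.1
  omega

theorem rk_N_le_one {A : Set N} (hA : DSet S A) : rk S A ≤ 1 ↔ A.Finite := by
  refine ⟨fun h => ?_, rk_le_one_of_finite⟩
  have h1 : InjOn (fun (t : N) (_ : Fin 1) => t) A := fun s _ t _ h => congrFun h 0
  have hd : DM S (fun (t : N) (_ : Fin 1) => t) := DM.pi fun i => by fun_prop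
  by_contra hinf
  rw [← rk_image_eq hd hA h1, rk_fin (hA.image hd)] at h
  have h2 := rkN_eq_zero.1 (Nat.le_zero.1 (bump_le_succ.1 (show _ ≤ 0 + 1 from
    (le_max_right _ _).trans h)))
  have h3 : Fin.elim0 ∈ infBase ((fun (t : N) (_ : Fin 1) => t) '' A) := by
    refine Infinite.mono (fun t ht => ⟨t, ht, ?_⟩) hinf
    funext i
    rw [Subsingleton.elim i (Fin.last 0), snocN_last]
  rw [h2] at h3
  exact h3

theorem two_le_rk_N {A : Set N} (hA : DSet S A) : 2 ≤ rk S A ↔ A.Infinite := by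
  rw [Set.Infinite, ← rk_N_le_one hA]
  omega

theorem rk_N_le {A : Set N} (hA : DSet S A) : rk S A ≤ 2 := by
  have h1 : InjOn (fun (t : N) (_ : Fin 1) => t) A := fun s _ t _ h => congrFun h 0
  have hd : DM S (fun (t : N) (_ : Fin 1) => t) := DM.pi fun i => by fun_prop
  rw [← rk_image_eq hd hA h1, rk_fin (hA.image hd)]
  exact rkN_le _

theorem rk_fin_le {n : ℕ} {A : Set (Fin n → N)} (hA : DSet S A) : rk S A ≤ n + 1 :=
  (rk_fin hA).trans_le (rkN_le A)

/-- The preimage of a set of tuples under appending a coordinate. -/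
theorem rk_snoc {n : ℕ} {A : Set (Fin (n + 1) → N)} (hA : DSet S A) :
    rk S {p : (Fin n → N) × N | snocN p.1 p.2 ∈ A} = rk S A := by
  have hA' := hA.dm
  have h : A = (fun p : (Fin n → N) × N => snocN p.1 p.2) ''
      {p : (Fin n → N) × N | snocN p.1 p.2 ∈ A} := by
    ext z
    constructor
    · intro hz
      exact ⟨(_, _), by rwa [mem_ofPred_eq, snocN_init], snocN_init z⟩
    · rintro ⟨p, hp, rfl⟩
      exact hp
  conv_rhs => rw [h]
  refine (rk_image_eq (by fun_prop) (DM.pred (by fun_prop)) fun p _ q _ h => ?_).symm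
  exact Prod.ext (snocN_inj.1 h).1 (snocN_inj.1 h).2

end Rank

end OMin

namespace OMin

section Box

variable {N : Type u} [LinearOrder N] {n : ℕ}

/-- The open box with corners `l` and `r`. -/
def box (l r : Fin n → N) : Set (Fin n → N) := {z | ∀ i, l i < z i ∧ z i < r i}

theorem box_mono {l r l' r' : Fin n → N} (hl : ∀ i, l i ≤ l' i) (hr : ∀ i, r' i ≤ r i) :
    box l' r' ⊆ box l r :=
  fun _ hz i => ⟨(hl i).trans_lt (hz i).1, (hz i).2.trans_le (hr i)⟩

theorem box_nonempty [DenselyOrdered N] {l r : Fin n → N} (h : ∀ i, l i < r i) :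
    (box l r).Nonempty := by
  choose z hz using fun i => exists_between (h i)
  exact ⟨z, hz⟩

variable [TopologicalSpace N] [OrderTopology N]

theorem isOpen_box (l r : Fin n → N) : IsOpen (box l r) := by
  have h : box l r = ⋂ i, (fun z : Fin n → N => z i) ⁻¹' Ioo (l i) (r i) := by
    ext z
    simp [box]
  rw [h]
  exact isOpen_iInter_of_finite fun i => isOpen_Ioo.preimage (continuous_apply i)

theorem mem_nhds_iff_box [NoMinOrder N] [NoMaxOrder N] {A : Set (Fin n → N)} {x : Fin n → N} :
    A ∈ 𝓝 x ↔ ∃ l r, x ∈ box l r ∧ box l r ⊆ A := by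
  refine ⟨fun h => ?_, fun ⟨l, r, hx, h⟩ => mem_of_superset ((isOpen_box l r).mem_nhds hx) h⟩
  rw [nhds_pi, mem_pi'] at h
  obtain ⟨I, t, ht, hA⟩ := h
  choose l r hx hlr using fun i => mem_nhds_iff_exists_Ioo_subset.1 (ht i)
  exact ⟨l, r, fun i => hx i, fun z hz => hA fun i _ => hlr i (hz i)⟩

end Box

section BoxRank

variable {N : Type u} [LinearOrder N] [DenselyOrdered N] [NoMinOrder N] [NoMaxOrder N]
  [Nonempty N] {S : Struc N} {X Y Z : Type*} [DefTy S X] [DefTy S Y] [DefTy S Z]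
  [TopologicalSpace N] [OrderTopology N]

@[fun_prop]
theorem DM.mem_box {n : ℕ} {f l r : X → Fin n → N} (hf : DM S f) (hl : DM S l) (hr : DM S r) :
    DM S (fun x => f x ∈ OMin.box (l x) (r x)) := by
  refine DM.iff_congr (P := fun x => ∀ i, l x i < f x i ∧ f x i < r x i) ?_ fun x => Iff.rfl
  exact DM.finForall fun i => by fun_prop

@[fun_prop]
theorem DM.mem_closure {m : ℕ} {T : X → (Fin m → N) → Prop}
    (hT : DM S (fun p : X × (Fin m → N) => T p.1 p.2)) {f : X → Fin m → N} (hf : DM S f) :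
    DM S (fun x => f x ∈ closure {y | T x y}) := by
  refine DM.iff_congr (P := fun x => ∀ l r, f x ∈ box l r → ∃ y, y ∈ box l r ∧ T x y)
    (by fun_prop) fun x => ?_
  rw [mem_closure_iff_nhds]
  constructor
  · intro h l r hx
    exact h _ ((isOpen_box l r).mem_nhds hx)
  · intro h t ht
    obtain ⟨l, r, hx, hlr⟩ := mem_nhds_iff_box.1 ht
    obtain ⟨y, hy, hT⟩ := h l r hx
    exact ⟨y, hlr hy, hT⟩

theorem DSet.closure {m : ℕ} {A : Set (Fin m → N)} (hA : DSet S A) : DSet S (closure A) := by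
  have := hA.dm
  exact DM.pred (P := fun x => x ∈ _root_.closure {y | y ∈ A}) (by fun_prop)

theorem DSet.box {n : ℕ} (l r : Fin n → N) : DSet S (OMin.box l r) :=
  DM.pred (P := fun x => x ∈ OMin.box l r) (by fun_prop)

theorem DSet.Ioo (a b : N) : DSet S (Ioo a b) :=
  DM.pred (P := fun t => a < t ∧ t < b) (by fun_prop)

theorem rk_Ioo {a b : N} (h : a < b) : rk S (Ioo a b) = 2 :=
  le_antisymm (rk_N_le (DSet.Ioo a b)) ((two_le_rk_N (DSet.Ioo a b)).2 (Ioo_infinite h))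

theorem rk_box {n : ℕ} {l r : Fin n → N} (h : ∀ i, l i < r i) : rk S (box l r) = n + 1 := by
  induction n with
  | zero =>
    exact le_antisymm (rk_fin_le (DSet.box l r)) (rk_pos.2 (box_nonempty h))
  | succ n ih =>
    rw [← rk_snoc (DSet.box l r)]
    have h1 : {p : (Fin n → N) × N | snocN p.1 p.2 ∈ box l r} =
        {p | p.1 ∈ box (fun i => l i.castSucc) (fun i => r i.castSucc) ∧
          p.2 ∈ Ioo (l (Fin.last n)) (r (Fin.last n))} := by
      ext p
      change (∀ i, _) ↔ (∀ i, _) ∧ _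
      rw [Fin.forall_fin_succ']
      simp
    have h2 := rk_prod (S := S) (DSet.box (fun i => l (Fin.castSucc i)) (fun i => r i.castSucc))
      (DSet.Ioo (l (Fin.last n)) (r (Fin.last n)))
      (box_nonempty fun i => h _) (nonempty_Ioo.2 (h _))
    rw [h1]
    have h3 := rk_Ioo (S := S) (h (Fin.last n))
    have h4 := ih fun i => h i.castSucc
    omega

theorem rk_univ_fin (n : ℕ) : rk S (univ : Set (Fin n → N)) = n + 1 := by
  obtain ⟨a⟩ := ‹Nonempty N›
  obtain ⟨b, hb⟩ := exists_gt a
  exact le_antisymm (rk_fin_le DSet.univ) ((rk_box fun _ => hb).symm.trans_le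
    (rk_mono (subset_univ (box (fun _ : Fin n => a) fun _ => b))))

theorem rk_univ_N : rk S (univ : Set N) = 2 :=
  le_antisymm (rk_N_le DSet.univ) ((two_le_rk_N DSet.univ).2 infinite_univ)

theorem rk_univ_prod [Nonempty X] [Nonempty Y] :
    rk S (univ : Set (X × Y)) + 1 = rk S (univ : Set X) + rk S (univ : Set Y) := by
  rw [← rk_prod DSet.univ DSet.univ univ_nonempty univ_nonempty]
  simp

/-- If every point of `C` has a full-dimensional set of witnesses, then some witness works for
a subset of `C`'s dimension. -/
theorem exists_uniform {E : Set (X × Y)} (hE : DSet S E) {C : Set X} (hC : C.Nonempty)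
    (h : ∀ x ∈ C, rk S (univ : Set Y) ≤ rk S {y | (x, y) ∈ E}) (hY : Nonempty Y) :
    ∃ y, rk S C ≤ rk S {x | (x, y) ∈ E} := by
  have h1 := rk_pos (S := S).2 (univ_nonempty (α := Y))
  have h2 := le_rk_fst (k := rk S (univ : Set Y) - 1) hE hC (by
    rwa [Nat.sub_add_cancel h1])
  have h3 := rk_pos (S := S).2 hC
  by_contra! h4
  obtain hk | ⟨k, hk⟩ : rk S C = 1 ∨ ∃ k, rk S C = k + 2 := by
    obtain ⟨k, hk⟩ := Nat.exists_eq_add_of_le' h3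
    cases k with
    | zero => exact Or.inl hk
    | succ k => exact Or.inr ⟨k, hk⟩
  · obtain ⟨⟨x, y⟩, hxy⟩ := rk_pos (S := S).1 (show 1 ≤ rk S E by omega)
    have h5 := h4 y
    have h6 := rk_pos (S := S).2 (show {x | (x, y) ∈ E}.Nonempty from ⟨x, hxy⟩)
    omega
  · have h5 := rk_le_snd (k := k) hE fun y => by
      have := h4 y
      omega
    have h6 := rk_mono (S := S) (subset_univ {y | ∃ x, (x, y) ∈ E})
    omega

theorem exists_box {n : ℕ} {A : Set (Fin n → N)} (hA : DSet S A) (h : n + 1 ≤ rk S A) :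
    ∃ l r, (∀ i, l i < r i) ∧ box l r ⊆ A := by
  induction n with
  | zero =>
    obtain ⟨z, hz⟩ := rk_pos.1 h
    refine ⟨z, z, fun i => i.elim0, fun w _ => ?_⟩
    rwa [Subsingleton.elim w z]
  | succ n ih =>
    have hA' := hA.dm
    let C : Set (Fin n → N) := infBase A
    have hCd : DSet S C := DM.pred (P := fun x => {t | snocN x t ∈ A}.Infinite) (by fun_prop)
    have hC : n + 1 ≤ rk S C := by
      rw [rk_fin hA] at h
      rw [rk_fin hCd]
      change _ ≤ max _ (bump _) at h
      have h1 := rkN_le (base A)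
      by_contra! h2
      have h3 : bump (rkN n (infBase A)) ≤ n + 1 := bump_le_succ.2 (Nat.le_of_lt_succ h2)
      omega
    let E : Set ((Fin n → N) × (N × N)) :=
      {p | p.2.1 < p.2.2 ∧ ∀ t, p.2.1 < t → t < p.2.2 → snocN p.1 t ∈ A}
    have hE : DSet S E := DM.pred (by fun_prop)
    obtain ⟨⟨p, q⟩, hpq⟩ := exists_uniform hE (rk_pos.1 (le_trans (by omega) hC)) (fun x hx => by
      have hd : DSet S {t | snocN x t ∈ A} := DM.pred (by fun_prop)
      obtain ⟨a, b, hab, hsub⟩ := hd.exists_Ioo_subset hx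
      obtain ⟨c, hac, hcb⟩ := exists_between hab
      have h1 := rk_univ_prod (S := S) (X := N) (Y := N)
      have h2 := rk_prod (S := S) (DSet.Ioo a c) (DSet.Ioo c b) (nonempty_Ioo.2 hac) (nonempty_Ioo.2 hcb)
      rw [rk_Ioo hac, rk_Ioo hcb] at h2
      rw [rk_univ_N] at h1
      have h3 : rk S {p : N × N | p.1 ∈ Ioo a c ∧ p.2 ∈ Ioo c b} ≤
          rk S {y : N × N | (x, y) ∈ E} :=
        rk_mono fun y hy => ⟨hy.1.2.trans hy.2.1, fun t ht1 ht2 =>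
          hsub ⟨hy.1.1.trans ht1, ht2.trans hy.2.2⟩⟩
      omega) inferInstance
    obtain ⟨l, r, hlr, hsub⟩ := ih (A := {x | (x, (p, q)) ∈ E}) (DM.pred
      (P := fun x => p < q ∧ ∀ t, p < t → t < q → snocN x t ∈ A) (by fun_prop)) (hC.trans hpq)
    obtain ⟨x0, hx0⟩ := box_nonempty hlr
    have hpq' : p < q := (hsub hx0).1
    refine ⟨snocN l p, snocN r q, fun i => ?_, fun z hz => ?_⟩
    · induction i using Fin.lastCases with
      | last => simpa using hpq'
      | cast i => simpa using hlr i
    · have h1 := (hsub (a := fun i => z i.castSucc) fun i => by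
        simpa using hz i.castSucc).2 (z (Fin.last n)) (by simpa using (hz (Fin.last n)).1)
        (by simpa using (hz (Fin.last n)).2)
      rwa [snocN_init] at h1

theorem exists_rkN_proj {m : ℕ} {A : Set (Fin m → N)} {k : ℕ} (h : rkN m A = k + 1) :
    ∃ p : Fin k → Fin m, Function.Injective p ∧ rkN k ((fun x => x ∘ p) '' A) = k + 1 := by
  induction m generalizing k with
  | zero =>
    have h1 := rkN_le A
    obtain rfl : k = 0 := by omega
    refine ⟨id, Function.injective_id, ?_⟩
    simpa using h
  | succ m ih =>
    have hmax : max (rkN m (base A)) (bump (rkN m (infBase A))) = k + 1 := h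
    obtain h1 | h1 : rkN m (base A) = k + 1 ∨ bump (rkN m (infBase A)) = k + 1 := by omega
    · obtain ⟨p, hp, h2⟩ := ih h1
      refine ⟨fun i => (p i).castSucc, fun i j hij => hp (Fin.castSucc_injective _ hij),
        le_antisymm (rkN_le _) (h2.symm.trans_le (rkN_mono ?_))⟩
      rintro _ ⟨x, ⟨t, ht⟩, rfl⟩
      refine ⟨_, ht, ?_⟩
      funext i
      simp
    · obtain ⟨k, rfl, h2⟩ : ∃ k', k = k' + 1 ∧ rkN m (infBase A) = k' + 1 := by
        unfold bump at h1
        split_ifs at h1 with h0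
        exact ⟨k - 1, by omega, by omega⟩
      obtain ⟨p, hp, h3⟩ := ih h2
      refine ⟨Fin.snoc (α := fun _ => Fin (m + 1)) (fun i => (p i).castSucc) (Fin.last m), ?_,
        le_antisymm (rkN_le _) ?_⟩
      · intro i j
        induction i using Fin.lastCases with
        | last =>
          induction j using Fin.lastCases with
          | last => simp
          | cast j => simpa using fun h => (Fin.castSucc_ne_last _ h.symm).elim
        | cast i =>
          induction j using Fin.lastCases with
          | last => simpa using fun h => (Fin.castSucc_ne_last _ h).elim
          | cast j => simpa using fun h => hp h
      · refine le_trans ?_ (le_max_right _ _)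
        have h4 : (fun x => x ∘ p) '' infBase A ⊆ infBase ((fun x => x ∘ Fin.snoc
            (α := fun _ => Fin (m + 1)) (fun i => (p i).castSucc) (Fin.last m)) '' A) := by
          rintro _ ⟨x, hx, rfl⟩
          refine Set.Infinite.mono (fun t ht => ⟨_, ht, ?_⟩) hx
          funext i
          induction i using Fin.lastCases <;> simp
        have h5 := bump_mono (rkN_mono h4)
        rw [h3] at h5
        exact le_trans (by simp [bump]) h5

theorem DM.reindex {m k : ℕ} (p : Fin k → Fin m) :
    DM S (fun x : Fin m → N => x ∘ p) := DM.pi fun i => by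
  change DM S (fun x : Fin m → N => x (p i))
  fun_prop

theorem exists_rk_proj {m : ℕ} {A : Set (Fin m → N)} (hA : DSet S A) {k : ℕ}
    (h : rk S A = k + 1) : ∃ p : Fin k → Fin m, Function.Injective p ∧
      rk S ((fun x => x ∘ p) '' A) = k + 1 := by
  rw [rk_fin hA] at h
  obtain ⟨p, hp, h1⟩ := exists_rkN_proj h
  exact ⟨p, hp, by rwa [rk_fin (hA.image (DM.reindex p))]⟩

end BoxRank

end OMin

namespace OMin

section Frontier

variable {N : Type u} [LinearOrder N] [DenselyOrdered N] [NoMinOrder N] [NoMaxOrder N]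
  [Nonempty N] {S : Struc N} {X Y Z : Type*} [DefTy S X] [DefTy S Y] [DefTy S Z]
  [TopologicalSpace N] [OrderTopology N]

theorem DSet.finite_of_rk_le {m : ℕ} {A : Set (Fin m → N)} (hA : DSet S A) (h : rk S A ≤ 1) :
    A.Finite := by
  have h1 : A ⊆ Set.pi Set.univ fun i => (fun x : Fin m → N => x i) '' A :=
    fun x hx i _ => ⟨x, hx, rfl⟩
  refine (Finite.pi fun i => ?_).subset h1
  have hd : DM S (fun x : Fin m → N => x i) := by fun_prop
  exact (rk_N_le_one (hA.image hd)).1 ((rk_image_le hd hA).trans h)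

theorem rk_corner_pairs {m : ℕ} {l r z : Fin m → N} (hz : z ∈ box l r)
    {E : Set ((Fin m → N) × (Fin m → N))}
    (h : ∀ p : (Fin m → N) × (Fin m → N), p.1 ∈ box l z → p.2 ∈ box z r → p ∈ E) :
    rk S (univ : Set ((Fin m → N) × (Fin m → N))) ≤ rk S E := by
  have hl := fun i => (hz i).1
  have hr := fun i => (hz i).2
  have h1 := rk_prod (S := S) (DSet.box l z) (DSet.box z r) (box_nonempty hl) (box_nonempty hr)
  have h2 := rk_univ_prod (S := S) (X := Fin m → N) (Y := Fin m → N)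
  have h3 := rk_mono (S := S) (show {p : (Fin m → N) × (Fin m → N) | p.1 ∈ box l z ∧
    p.2 ∈ box z r} ⊆ E from fun p hp => h p hp.1 hp.2)
  rw [rk_box hl, rk_box hr] at h1
  rw [rk_univ_fin] at h2
  omega

theorem rk_frontier_lt {m : ℕ} {F A : Set (Fin m → N)} (hF : DSet S F) (hA : DSet S A)
    (hA0 : A.Nonempty) (h : F ⊆ closure A \ A) : rk S F < rk S A := by
  have hF' := hF.dm
  have hA' := hA.dm
  by_contra! hle
  obtain ⟨k, hk⟩ := Nat.exists_eq_add_of_le' ((rk_pos (S := S).2 hA0).trans hle)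
  obtain ⟨p, -, hp⟩ := exists_rk_proj hF hk
  have hpd : DM S (fun x : Fin m → N => x ∘ p) := DM.reindex p
  have hpd' : DM S (fun q : ((Fin k → N) × (Fin m → N)) => q.2 ∘ p) := hpd.comp' (by fun_prop)
  let J : Set ((Fin k → N) × (Fin m → N)) := {q | q.2 ∈ A ∧ q.2 ∘ p = q.1}
  have hJ : DSet S J := DM.pred (by fun_prop)
  have hJA : rk S J ≤ rk S A := by
    refine rk_le_of_injOn (f := Prod.snd) (by fun_prop) hJ (fun a ha b hb hab => ?_)
      (fun q hq => hq.1)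
    exact Prod.ext (ha.2.symm.trans ((congrArg (· ∘ p) hab).trans hb.2)) hab
  let I : Set (Fin k → N) := {y | 2 ≤ rk S {x | (y, x) ∈ J}}
  have hId : DSet S I := DM.pred (DM.le_rk (T := fun y x => (y, x) ∈ J) (hJ.dm.comp'
    (by fun_prop)) 2)
  have hI : rk S I ≤ k := by
    obtain hI0 | hI0 := I.eq_empty_or_nonempty
    · simp [rk_eq_zero.2 hI0]
    have := le_rk_fst (k := 1) hJ hI0 fun y hy => hy
    omega
  let C : Set (Fin k → N) := ((fun x => x ∘ p) '' F) \ I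
  have hC : k + 1 ≤ rk S C := by
    have h1 := rk_mono (S := S) (show (fun x => x ∘ p) '' F ⊆ C ∪ I from fun y hy => by
      by_cases hyI : y ∈ I
      · exact Or.inr hyI
      · exact Or.inl ⟨hy, hyI⟩)
    rw [rk_union] at h1
    omega
  let E : Set ((Fin k → N) × ((Fin m → N) × (Fin m → N))) :=
    {q | (∃ f, f ∈ F ∧ f ∘ p = q.1 ∧ f ∈ box q.2.1 q.2.2) ∧
      ∀ z, z ∈ box q.2.1 q.2.2 → ¬ (q.1, z) ∈ J}
  have hE : DSet S E := by
    have hJ' := hJ.dm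
    have hpd'' : DM S (fun q : ((Fin k → N) × ((Fin m → N) × (Fin m → N))) × (Fin m → N) =>
      q.2 ∘ p) := hpd.comp' (by fun_prop)
    exact DM.pred (by fun_prop)
  obtain ⟨a⟩ := ‹Nonempty N›
  obtain ⟨⟨l, r⟩, hlr⟩ := exists_uniform hE (rk_pos.1 (le_trans (by omega) hC)) (fun y hy => by
    obtain ⟨⟨f, hf, rfl⟩, hyI⟩ := hy
    have hfin : {x | (f ∘ p, x) ∈ J}.Finite := by
      refine DSet.finite_of_rk_le (S := S) (hJ.dm.comp' (f := fun x => (f ∘ p, x))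
        (by fun_prop)).pred ?_
      have : ¬ 2 ≤ rk S {x | (f ∘ p, x) ∈ J} := hyI
      omega
    have hn : {x | (f ∘ p, x) ∈ J}ᶜ ∈ 𝓝 f :=
      hfin.isClosed.isOpen_compl.mem_nhds fun hJf => (h hf).2 hJf.1
    obtain ⟨l, r, hflr, hsub⟩ := mem_nhds_iff_box.1 hn
    refine rk_corner_pairs hflr fun q hq1 hq2 => ⟨⟨f, hf, rfl, fun i => ⟨(hq1 i).2, (hq2 i).1⟩⟩,
      fun z hz => hsub (box_mono (fun i => (hq1 i).1.le) (fun i => (hq2 i).2.le) hz)⟩) ⟨fun _ => a, fun _ => a⟩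
  have hd2 : DSet S {y | (y, (l, r)) ∈ E} :=
    (hE.dm.comp' (f := fun y : Fin k → N => (y, (l, r))) (by fun_prop)).pred
  obtain ⟨l', r', hlr', hsub⟩ := exists_box hd2 (hC.trans hlr)
  obtain ⟨y, hy⟩ := box_nonempty hlr'
  obtain ⟨f, hf, rfl, hfb⟩ := (hsub hy).1
  have hopen : box l r ∩ (fun z => z ∘ p) ⁻¹' box l' r' ∈ 𝓝 f :=
    inter_mem ((isOpen_box l r).mem_nhds hfb) (((isOpen_box l' r').preimage
      (continuous_pi fun i => continuous_apply (p i))).mem_nhds hy)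
  obtain ⟨z, ⟨hz1, hz2⟩, hzA⟩ := mem_closure_iff_nhds.1 (h hf).1 _ hopen
  exact (hsub hz2).2 z hz1 ⟨hzA, rfl⟩

theorem rk_frontier_lt' {m : ℕ} {F A B : Set (Fin m → N)} (hF : DSet S F) (hA : DSet S A)
    (hB : B.Nonempty) (hAB : A ⊆ B) (h : F ⊆ closure A \ A) : rk S F < rk S B := by
  obtain rfl | hA0 := A.eq_empty_or_nonempty
  · rw [rk_eq_zero.2 (subset_empty_iff.1 (h.trans (by simp)))]
    exact rk_pos.2 hB
  · exact (rk_frontier_lt hF hA hA0 h).trans_le (rk_mono hAB)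

/-- The points where a set fails to be a relative neighbourhood form a small set. -/
theorem rk_not_mem_nhdsWithin_lt {m : ℕ} {R A : Set (Fin m → N)} (hR : DSet S R) (hA : DSet S A)
    (hA0 : A.Nonempty) : DSet S {x | x ∈ R ∧ x ∈ A ∧ R ∉ 𝓝[A] x} ∧
      rk S {x | x ∈ R ∧ x ∈ A ∧ R ∉ 𝓝[A] x} < rk S A := by
  have h1 : {x | x ∈ R ∧ x ∈ A ∧ R ∉ 𝓝[A] x} = R ∩ (A ∩ closure (A \ R)) := by
    ext x
    refine and_congr_right fun _ => and_congr_right fun _ => ?_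
    rw [mem_closure_iff_nhdsWithin_neBot, ← not_iff_not, not_neBot, not_not,
      mem_nhdsWithin_iff_eventually, ← Filter.empty_mem_iff_bot, mem_nhdsWithin_iff_eventually]
    refine eventually_congr (Eventually.of_forall fun y => ?_)
    simp [not_and_or, imp_iff_not_or]
  have h2 : DSet S {x | x ∈ R ∧ x ∈ A ∧ R ∉ 𝓝[A] x} := by
    rw [h1]
    exact hR.inter (hA.inter (hA.diff hR).closure)
  refine ⟨h2, rk_frontier_lt' h2 (hA.diff hR) hA0 diff_subset ?_⟩
  rw [h1]
  exact fun x hx => ⟨hx.2.2, fun h => h.2 hx.1⟩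

theorem rk_infinite_frontier_lt {m : ℕ} {T : N → Set (Fin m → N)} {A : Set (Fin m → N)}
    (hT : DM S (fun p : N × (Fin m → N) => p.2 ∈ T p.1)) (hA : DSet S A) (hA0 : A.Nonempty)
    (hTA : ∀ q, T q ⊆ A) :
    DSet S {x | x ∈ A ∧ {q | x ∈ closure (T q) \ T q}.Infinite} ∧
      rk S {x | x ∈ A ∧ {q | x ∈ closure (T q) \ T q}.Infinite} < rk S A := by
  have hA' := hA.dm
  let J : Set ((Fin m → N) × N) := {p | p.1 ∈ closure {y | y ∈ T p.2} ∧ ¬ p.1 ∈ T p.2}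
  have hT1 : DM S (fun p : (Fin m → N) × N => p.1 ∈ T p.2) :=
    hT.comp' (f := fun p : (Fin m → N) × N => (p.2, p.1)) (by fun_prop)
  have hT2 : DM S (fun p : ((Fin m → N) × N) × (Fin m → N) => p.2 ∈ T p.1.2) :=
    hT.comp' (f := fun p : ((Fin m → N) × N) × (Fin m → N) => (p.1.2, p.2)) (by fun_prop)
  have hJ : DSet S J := DM.pred (by fun_prop)
  have hJ' := hJ.dm
  let H : Set (Fin m → N) := {x | x ∈ A ∧ {q | (x, q) ∈ J}.Infinite}
  have hH : DSet S H := DM.pred (by fun_prop)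
  refine ⟨hH, ?_⟩
  change rk S H < rk S A
  by_contra! hle
  have hA1 := rk_pos (S := S).2 hA0
  have hH0 := rk_pos.1 (hA1.trans hle)
  have h1 := le_rk_fst (k := 1) hJ hH0 fun x hx => (two_le_rk_N (DM.pred (by fun_prop))).2 hx.2
  have h2 : ∀ q, rk S {x | (x, q) ∈ J} < rk S A := fun q =>
    rk_frontier_lt' (A := T q) (DM.pred (by fun_prop))
      (hT.comp' (f := fun y : Fin m → N => (q, y)) (by fun_prop)).pred hA0 (hTA q) fun x hx => hx
  obtain hk | ⟨k, hk⟩ : rk S A = 1 ∨ ∃ k, rk S A = k + 2 := by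
    obtain ⟨k, hk⟩ := Nat.exists_eq_add_of_le' hA1
    cases k with
    | zero => exact Or.inl hk
    | succ k => exact Or.inr ⟨k, hk⟩
  · obtain ⟨⟨x, q⟩, hxq⟩ := rk_pos.1 (show 1 ≤ rk S J by omega)
    have h3 := h2 q
    have h4 := rk_pos (S := S).2 (show {x | (x, q) ∈ J}.Nonempty from ⟨x, hxq⟩)
    omega
  · have h3 := rk_le_snd (k := k) hJ fun q => by
      have := h2 q
      omega
    have h4 := rk_mono (S := S) (subset_univ {q | ∃ x, (x, q) ∈ J})
    rw [rk_univ_N] at h4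
    omega

/-- A definable function is continuous off a small set. -/
theorem DM.continuousOn_off_small {m : ℕ} {A : Set (Fin m → N)} (hA : DSet S A)
    (hA0 : A.Nonempty) {f : (Fin m → N) → N} (hf : DM S f) :
    ∃ B, DSet S B ∧ rk S B < rk S A ∧ ∀ x ∈ A, x ∉ B → ContinuousWithinAt f A x := by
  have hA' := hA.dm
  obtain ⟨h1, h2⟩ := rk_infinite_frontier_lt (T := fun q => {x | x ∈ A ∧ f x ≤ q})
    (by have := hA.mem_comp (f := fun p : N × (Fin m → N) => p.2) (by fun_prop)
        exact (by fun_prop : DM S (fun p : N × (Fin m → N) => p.2 ∈ A ∧ f p.2 ≤ p.1)))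
    hA hA0 fun q x hx => hx.1
  obtain ⟨h3, h4⟩ := rk_infinite_frontier_lt (T := fun q => {x | x ∈ A ∧ q ≤ f x})
    (by have := hA.mem_comp (f := fun p : N × (Fin m → N) => p.2) (by fun_prop)
        exact (by fun_prop : DM S (fun p : N × (Fin m → N) => p.2 ∈ A ∧ p.1 ≤ f p.2)))
    hA hA0 fun q x hx => hx.1
  refine ⟨_, h1.union h3, by rw [rk_union]; exact max_lt h2 h4, fun x hx hxB => ?_⟩
  refine tendsto_order.2 ⟨fun p hp => ?_, fun p hp => ?_⟩
  · by_contra hcon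
    refine hxB (Or.inl ⟨hx, (Ioo_infinite hp).mono fun q hq => ⟨?_, fun h => hq.2.not_ge h.2⟩⟩)
    rw [mem_closure_iff_nhdsWithin_neBot, neBot_iff, ne_eq, ← Filter.empty_mem_iff_bot,
      mem_nhdsWithin_iff_eventually]
    intro h
    refine hcon (mem_nhdsWithin_iff_eventually.2 (h.mono fun y hy hyA => ?_))
    by_contra hpy
    exact hy ⟨hyA, (not_lt.1 hpy).trans hq.1.le⟩
  · by_contra hcon
    refine hxB (Or.inr ⟨hx, (Ioo_infinite hp).mono fun q hq => ⟨?_, fun h => hq.1.not_ge h.2⟩⟩)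
    rw [mem_closure_iff_nhdsWithin_neBot, neBot_iff, ne_eq, ← Filter.empty_mem_iff_bot,
      mem_nhdsWithin_iff_eventually]
    intro h
    refine hcon (mem_nhdsWithin_iff_eventually.2 (h.mono fun y hy hyA => ?_))
    by_contra hpy
    exact hy ⟨hyA, hq.2.le.trans (not_lt.1 hpy)⟩

theorem DM.continuousOn_pi_off_small {m k : ℕ} {A : Set (Fin m → N)} (hA : DSet S A)
    (hA0 : A.Nonempty) {f : (Fin m → N) → (Fin k → N)} (hf : DM S f) :
    ∃ B, DSet S B ∧ rk S B < rk S A ∧ ∀ x ∈ A, x ∉ B → ContinuousWithinAt f A x := by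
  choose B hBd hB hc using fun i => DM.continuousOn_off_small hA hA0 (hf.apply i)
  have hBd' := fun i => (hBd i).dm
  refine ⟨⋃ i, B i, (DM.finExists (P := fun i x => x ∈ B i) hBd').pred.congr fun x => by simp,
    ?_, fun x hx hxB => continuousWithinAt_pi.2 fun i => hc i x hx fun h => hxB ?_⟩
  · obtain ⟨j, hj⟩ := Nat.exists_eq_add_of_le' (rk_pos (S := S).2 hA0)
    rw [hj]
    refine Nat.lt_succ_of_le (rk_iUnion_le fun i => ?_)
    have := hB i
    omega
  · exact mem_iUnion.2 ⟨i, h⟩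

/-- Every definable set is parametrized, up to a set of smaller dimension, by an open subset of
a power of `N`. -/
theorem exists_param {m : ℕ} {A : Set (Fin m → N)} (hA : DSet S A) {k : ℕ}
    (h : rk S A = k + 1) : ∃ (B : Set (Fin k → N)) (β : (Fin k → N) → (Fin m → N)),
      DSet S B ∧ rk S B = k + 1 ∧ DM S β ∧ InjOn β B ∧ MapsTo β B A := by
  induction m generalizing k with
  | zero =>
    have h1 := rk_fin_le hA
    obtain rfl : k = 0 := by omega
    obtain ⟨a, ha⟩ := rk_pos.1 h.ge
    refine ⟨univ, fun x => x, DSet.univ, rk_univ_fin 0, by fun_prop, fun _ _ _ _ h => h,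
      fun x _ => ?_⟩
    rwa [Subsingleton.elim x a]
  | succ m ih =>
    have hA' := hA.dm
    have hmax : max (rkN m (base A)) (bump (rkN m (infBase A))) = k + 1 := by
      rw [rk_fin hA] at h
      exact h
    have hb : DSet S (base A) := DM.pred (P := fun x => ∃ t, snocN x t ∈ A) (by fun_prop)
    have hi : DSet S (infBase A) :=
      DM.pred (P := fun x => {t | snocN x t ∈ A}.Infinite) (by fun_prop)
    obtain ⟨k, rfl, h2⟩ | ⟨h1, h2⟩ : (∃ k', k = k' + 1 ∧ rkN m (infBase A) = k' + 1) ∨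
        rkN m (base A) = k + 1 ∧ rkN m (infBase A) ≤ k := by
      by_cases h2 : bump (rkN m (infBase A)) = k + 1
      · left
        unfold bump at h2
        split_ifs at h2 with h0
        exact ⟨k - 1, by omega, by omega⟩
      · right
        have h3 : bump (rkN m (infBase A)) ≤ k := by omega
        refine ⟨by omega, le_trans ?_ h3⟩
        unfold bump
        split_ifs <;> omega
    · obtain ⟨B, β, hB, hBr, hβ, hinj, hmaps⟩ := ih hi ((rk_fin hi).trans h2)
      have hB' := hB.dm
      let B' : Set (Fin (k + 1) → N) :=
        {z | (fun i => z i.castSucc) ∈ B ∧ snocN (β fun i => z i.castSucc) (z (Fin.last k)) ∈ A}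
      have hinit : DM S (fun z : Fin (k + 1) → N => fun i : Fin k => z i.castSucc) :=
        DM.pi fun i => by fun_prop
      have hBd : DSet S B' := DM.pred (by fun_prop)
      refine ⟨B', fun z => snocN (β fun i => z i.castSucc) (z (Fin.last k)), hBd,
        le_antisymm (rk_fin_le hBd) ?_, by fun_prop, ?_, fun z hz => hz.2⟩
      · have hBd' := hBd.dm
        rw [← rk_snoc hBd]
        refine (congrArg (· + 1) hBr).ge.trans ?_
        refine le_rk_fst (A := {p : (Fin k → N) × N | snocN p.1 p.2 ∈ B'}) (C := B) (k := 1)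
          (DM.pred (by fun_prop)) (rk_pos (S := S) (A := B).1 (by omega)) fun x hx => ?_
        refine (two_le_rk_N (A := {t | snocN x t ∈ B'}) (DM.pred (by fun_prop))).2 (Set.Infinite.mono (fun t ht => ?_)
          (hmaps hx))
        change _ ∧ _
        simp only [snocN_castSucc, snocN_last]
        exact ⟨hx, ht⟩
      · intro z hz w hw hzw
        obtain ⟨h3, h4⟩ := snocN_inj.1 hzw
        have h5 := hinj hz.1 hw.1 h3
        rw [← snocN_init z, ← snocN_init w, h4, h5]
    · obtain ⟨B, β, hB, hBr, hβ, hinj, hmaps⟩ := ih hb ((rk_fin hb).trans h1)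
      have hi' := hi.dm
      have hB' := hB.dm
      let B' : Set (Fin k → N) := {y | y ∈ B ∧ ¬ β y ∈ infBase A}
      have hBd : DSet S B' := DM.pred (by fun_prop)
      have hlow : DM S (fun y => dInf {t | snocN (β y) t ∈ A}) :=
        DM.dInf (T := fun y t => snocN (β y) t ∈ A) (by fun_prop)
      refine ⟨B', fun y => snocN (β y) (dInf {t | snocN (β y) t ∈ A}), hBd,
        le_antisymm (rk_fin_le hBd) ?_, by fun_prop, ?_, ?_⟩
      · have h3 := rk_mono (S := S) (show B ⊆ B' ∪ {y | y ∈ B ∧ β y ∈ infBase A} from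
          fun y hy => by
            by_cases h : β y ∈ infBase A
            · exact Or.inr ⟨hy, h⟩
            · exact Or.inl ⟨hy, h⟩)
        have h4 := rk_le_of_injOn (A := {y | y ∈ B ∧ β y ∈ infBase A}) hβ
          (DM.pred (by fun_prop)) (hinj.mono fun y hy => hy.1) fun y hy => hy.2
        rw [rk_union] at h3
        rw [rk_fin hi] at h4
        omega
      · exact fun y hy z hz hyz => hinj hy.1 hz.1 (snocN_inj.1 hyz).1
      · intro y hy
        have hfin : {t | snocN (β y) t ∈ A}.Finite := not_infinite.1 hy.2
        obtain ⟨t, ht, hmin⟩ := Set.exists_min_image _ id hfin (hmaps hy.1)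
        have hg : IsLeast {t | snocN (β y) t ∈ A} t := ⟨ht, hmin⟩
        change snocN (β y) (dInf _) ∈ A
        rw [dInf_eq hg.isGLB]
        exact ht

end Frontier

end OMin

namespace OMin

section DGrp

variable {N : Type u} [LinearOrder N] [DenselyOrdered N] [NoMinOrder N] [NoMaxOrder N]
  [Nonempty N] [TopologicalSpace N] [OrderTopology N]

theorem exists_dm_inverse {S : Struc N} {Y : Type*} [DefTy S Y] [Nonempty Y] {m : ℕ}
    {val : Y → Fin m → N} (hv : DM S val)
    (hi : Function.Injective val) :
    ∃ inv : (Fin m → N) → Y, DM S inv ∧ ∀ x, inv (val x) = x := by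
  refine ⟨Function.extend val id fun _ => Classical.arbitrary Y, ?_, fun x => hi.extend_apply _ _ _⟩
  refine DM.bijOn_inv hv DSet.univ hi.injOn (Classical.arbitrary Y) (fun x _ => hi.extend_apply _ _ _) fun y hy => ?_
  exact Function.extend_apply' _ _ _ fun ⟨x, hx⟩ => hy ⟨x, mem_univ x, hx⟩

/-- A topological group with definable operations, embedded in a power of `N` in such a way
that its topology is the ambient one on a large definable set. -/
class DGrp (S : Struc N) (G : Type*) [Group G] [TopologicalSpace G] [DefTy S G] : Prop
    extends IsTopologicalGroup G where
  dm_mul : DM S (fun p : G × G => p.1 * p.2)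
  dm_inv : DM S (fun x : G => x⁻¹)
  exists_chart : ∃ (m : ℕ) (val : G → Fin m → N) (P : Set G), DM S val ∧
    Function.Injective val ∧ DSet S P ∧ rk S Pᶜ < rk S (univ : Set G) ∧
    ∀ x ∈ P, 𝓝 x = comap val (𝓝[val '' P] (val x))

variable {S : Struc N} {X : Type*} [DefTy S X] {G : Type*} [Group G] [TopologicalSpace G]
  [DefTy S G] [DGrp S G]

@[fun_prop]
theorem DM.mul {f g : X → G} (hf : DM S f) (hg : DM S g) : DM S (fun x => f x * g x) :=
  DGrp.dm_mul.comp' (hf.prodMk hg)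

@[fun_prop]
theorem DM.inv {f : X → G} (hf : DM S f) : DM S (fun x => (f x)⁻¹) :=
  DGrp.dm_inv.comp' hf

theorem rk_mul_left (g : G) {A : Set G} (hA : DSet S A) :
    rk S ((fun x => g * x) '' A) = rk S A :=
  rk_image_eq (by fun_prop) hA (mul_right_injective g).injOn

theorem exists_continuousAt_off_small {x : G → N} (hx : DM S x) :
    ∃ B, DSet S B ∧ rk S B < rk S (univ : Set G) ∧ ∀ u ∉ B, ContinuousAt x u := by
  obtain ⟨m, val, P, hv, hi, hP, hPc, hnhds⟩ := DGrp.exists_chart (S := S) (G := G)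
  obtain ⟨inv, hinv, hiv⟩ := exists_dm_inverse hv hi
  obtain rfl | hP0 := P.eq_empty_or_nonempty
  · exact (hPc.ne (by rw [compl_empty])).elim
  obtain ⟨B, hB, hBr, hc⟩ := DM.continuousOn_off_small (hP.image hv) (hP0.image val)
    (hx.comp' hinv)
  have hBv : DSet S (val ⁻¹' B) := hv.preimage hB
  refine ⟨Pᶜ ∪ val ⁻¹' B, hP.compl.union hBv, ?_, fun u hu => ?_⟩
  · rw [rk_union]
    refine max_lt hPc ?_
    refine (rk_le_of_injOn hv hBv hi.injOn fun z hz => hz).trans_lt (hBr.trans_le ?_)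
    exact (rk_image_le hv hP).trans (rk_mono (subset_univ _))
  · obtain ⟨huP, huB⟩ := not_or.1 hu
    rw [notMem_compl_iff] at huP
    have h1 : Tendsto (fun z => x (inv z)) (𝓝[val '' P] (val u)) (𝓝 (x (inv (val u)))) :=
      hc _ ⟨u, huP, rfl⟩ huB
    have h2 := h1.comp (tendsto_comap (f := val))
    rw [hiv, ← hnhds u huP] at h2
    exact h2.congr fun w => by simp [hiv]

theorem exists_mem_nhds_off_small {R : Set G} (hR : DSet S R) :
    ∃ B, DSet S B ∧ rk S B < rk S (univ : Set G) ∧ ∀ u ∈ R, u ∉ B → R ∈ 𝓝 u := by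
  obtain ⟨m, val, P, hv, hi, hP, hPc, hnhds⟩ := DGrp.exists_chart (S := S) (G := G)
  obtain rfl | hP0 := P.eq_empty_or_nonempty
  · exact (hPc.ne (by rw [compl_empty])).elim
  obtain ⟨hB, hBr⟩ := rk_not_mem_nhdsWithin_lt (hR.image hv) (hP.image hv) (hP0.image val)
  refine ⟨_, hP.compl.union (hv.preimage hB), ?_, fun u huR hu => ?_⟩
  · rw [rk_union]
    refine max_lt hPc ?_
    refine (rk_le_of_injOn hv (hv.preimage hB) hi.injOn fun z hz => hz).trans_lt
      (hBr.trans_le ?_)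
    exact (rk_image_le hv hP).trans (rk_mono (subset_univ _))
  · obtain ⟨huP, huB⟩ := not_or.1 hu
    rw [notMem_compl_iff] at huP
    have h1 : val '' R ∈ 𝓝[val '' P] (val u) := by
      by_contra h
      exact huB ⟨⟨u, huR, rfl⟩, ⟨u, huP, rfl⟩, h⟩
    rw [hnhds u huP]
    exact ⟨_, h1, (preimage_image_eq R hi).subset⟩

/-- A continuous definable injective parametrization of a full-dimensional subset of a
definable group. -/
theorem exists_group_param {n : ℕ} (hn : rk S (univ : Set G) = n + 1) :
    ∃ (l r : Fin n → N) (β : (Fin n → N) → G), (∀ i, l i < r i) ∧ DM S β ∧ InjOn β (box l r) ∧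
      ∀ y ∈ box l r, ContinuousAt β y := by
  obtain ⟨m, val, P, hv, hi, hP, hPc, hnhds⟩ := DGrp.exists_chart (S := S) (G := G)
  obtain ⟨inv, hinv, hiv⟩ := exists_dm_inverse hv hi
  have hPr : rk S P = n + 1 := by
    have h1 := rk_union (S := S) P Pᶜ
    rw [union_compl_self] at h1
    omega
  obtain ⟨B, β, hB, hBr, hβ, hinj, hmaps⟩ := exists_param (hP.image hv)
    ((rk_image_eq hv hP hi.injOn).trans hPr)
  obtain ⟨C, hC, hCr, hc⟩ := hβ.continuousOn_pi_off_small hB ((rk_pos (S := S)).1 (by omega))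
  obtain ⟨l, r, hlr, hsub⟩ := exists_box (hB.diff hC) (by
    have h1 := rk_union (S := S) (B \ C) C
    have h2 := rk_mono (S := S) (show B ⊆ B \ C ∪ C by simp)
    omega)
  have key : ∀ y ∈ B, ∃ u ∈ P, val u = β y ∧ inv (β y) = u := fun y hy => by
    obtain ⟨u, hu, huy⟩ := hmaps hy
    exact ⟨u, hu, huy, by rw [← huy, hiv]⟩
  refine ⟨l, r, fun y => inv (β y), hlr, hinv.comp' hβ, fun y hy z hz hyz => ?_, fun y hy => ?_⟩
  · obtain ⟨u, -, hu1, hu2⟩ := key y (hsub hy).1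
    obtain ⟨w, -, hw1, hw2⟩ := key z (hsub hz).1
    refine hinj (hsub hy).1 (hsub hz).1 ?_
    rw [← hu1, ← hw1, ← hu2, ← hw2]
    exact congrArg val hyz
  · obtain ⟨u, huP, hu1, hu2⟩ := key y (hsub hy).1
    have hBn : B ∈ 𝓝 y :=
      mem_of_superset ((isOpen_box l r).mem_nhds hy) fun z hz => (hsub hz).1
    have h1 : Tendsto β (𝓝 y) (𝓝 (β y)) := by
      have := hc y (hsub hy).1 (hsub hy).2
      rwa [ContinuousWithinAt, nhdsWithin_eq_nhds.2 hBn] at this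
    change Tendsto _ _ (𝓝 (inv (β y)))
    rw [hu2, hnhds u huP, tendsto_comap_iff, hu1]
    refine tendsto_nhdsWithin_iff.2 ⟨h1.congr' ?_, ?_⟩
    · filter_upwards [hBn] with z hz
      obtain ⟨w, -, hw1, hw2⟩ := key z hz
      simp [hw2, hw1]
    · filter_upwards [hBn] with z hz
      obtain ⟨w, hwP, hw1, hw2⟩ := key z hz
      exact ⟨w, hwP, by simp [hw2]⟩

end DGrp

end OMin

namespace OMin

section Sides

variable {N : Type u} [LinearOrder N]

/-- The order of `N` (for `true`) or the reverse order (for `false`). -/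
def sLT (σ : Bool) (a b : N) : Prop :=
  bif σ then a < b else b < a

theorem sLT.trans {σ : Bool} {a b c : N} (h1 : sLT σ a b) (h2 : sLT σ b c) : sLT σ a c := by
  cases σ
  · exact lt_trans (α := N) h2 h1
  · exact lt_trans (α := N) h1 h2

theorem sLT.asymm {σ : Bool} {a b : N} (h1 : sLT σ a b) (h2 : sLT σ b a) : False := by
  cases σ
  · exact lt_asymm (α := N) h1 h2
  · exact lt_asymm (α := N) h1 h2

theorem sLT_irrefl (σ : Bool) (a : N) : ¬ sLT σ a a := fun h => h.asymm h

theorem sLT_trichotomy (σ : Bool) (a b : N) : sLT σ a b ∨ a = b ∨ sLT σ b a := by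
  cases σ
  · exact (lt_trichotomy b a).imp id (Or.imp Eq.symm id)
  · exact lt_trichotomy a b

theorem sLT_not (σ : Bool) (a b : N) : sLT (!σ) a b ↔ sLT σ b a := by
  cases σ <;> rfl

theorem exists_sLT_between [DenselyOrdered N] {σ : Bool} {a b : N} (h : sLT σ a b) :
    ∃ c, sLT σ a c ∧ sLT σ c b := by
  cases σ
  · obtain ⟨c, h1, h2⟩ := exists_between (α := N) h
    exact ⟨c, h2, h1⟩
  · exact exists_between (α := N) h

theorem infinite_sLT_between [DenselyOrdered N] {σ : Bool} {a b : N} (h : sLT σ a b) :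
    {c | sLT σ a c ∧ sLT σ c b}.Infinite := by
  cases σ
  · exact (Ioo_infinite (α := N) h).mono fun c hc => ⟨hc.2, hc.1⟩
  · exact Ioo_infinite (α := N) h

variable [TopologicalSpace N]

/-- The filter of right (for `true`) or left (for `false`) neighbourhoods of a point. -/
def sN (σ : Bool) (a : N) : Filter N :=
  bif σ then 𝓝[>] a else 𝓝[<] a

theorem sN_le (σ : Bool) (a : N) : sN σ a ≤ 𝓝 a := by
  cases σ <;> exact nhdsWithin_le_nhds

theorem eventually_sLT (σ : Bool) (a : N) : ∀ᶠ s in sN σ a, sLT σ a s := by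
  cases σ
  · exact eventually_mem_nhdsWithin (α := N) (s := Iio a)
  · exact eventually_mem_nhdsWithin (α := N) (s := Ioi a)

variable [OrderTopology N]

theorem eventually_nhds_sLT {σ : Bool} {a b : N} (h : sLT σ a b) : ∀ᶠ s in 𝓝 a, sLT σ s b := by
  cases σ
  · exact Ioi_mem_nhds (α := N) h
  · exact Iio_mem_nhds (α := N) h

variable [DenselyOrdered N] [NoMinOrder N] [NoMaxOrder N] [Nonempty N]

theorem exists_sLT (σ : Bool) (a : N) : ∃ b, sLT σ a b := by
  cases σ
  · exact exists_lt (α := N) a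
  · exact exists_gt (α := N) a

instance sN_neBot (σ : Bool) (a : N) : (sN σ a).NeBot := by
  cases σ
  · exact inferInstanceAs (𝓝[<] a).NeBot
  · exact inferInstanceAs (𝓝[>] a).NeBot

theorem eventually_sN_iff {σ : Bool} {a : N} {P : N → Prop} :
    (∀ᶠ s in sN σ a, P s) ↔ ∃ b, sLT σ a b ∧ ∀ s, sLT σ a s → sLT σ s b → P s := by
  cases σ
  · refine (eventually_nhdsLT_iff (a := a)).trans ?_
    exact exists_congr fun b => and_congr_right fun _ =>
      ⟨fun h s h1 h2 => h s h2 h1, fun h s h1 h2 => h s h2 h1⟩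
  · exact eventually_nhdsGT_iff

/-- The endpoint of the largest interval starting at `a`, going no further than `δ`, on which
`A` holds. -/
noncomputable def sReach (σ : Bool) (a δ : N) (A : N → Prop) : N :=
  bif σ then dSup {τ | sLT σ a τ ∧ ¬ sLT σ δ τ ∧ ∀ s, sLT σ a s → sLT σ s τ → A s}
  else dInf {τ | sLT σ a τ ∧ ¬ sLT σ δ τ ∧ ∀ s, sLT σ a s → sLT σ s τ → A s}

variable {S : Struc N} {X : Type*} [DefTy S X]

@[fun_prop]
theorem DM.sLT {f g : X → N} (σ : Bool) (hf : DM S f) (hg : DM S g) :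
    DM S (fun x => sLT σ (f x) (g x)) := by
  cases σ
  · exact DM.congr (f := fun x => g x < f x) (by fun_prop) fun x => rfl
  · exact DM.congr (f := fun x => f x < g x) (by fun_prop) fun x => rfl

@[fun_prop]
theorem DM.sReach {T : X → N → Prop} {f g : X → N} (σ : Bool)
    (hT : DM S (fun p : X × N => T p.1 p.2)) (hf : DM S f) (hg : DM S g) :
    DM S (fun x => sReach σ (f x) (g x) (T x)) := by
  cases σ
  · exact DM.dInf (T := fun x τ => OMin.sLT false (f x) τ ∧ ¬ OMin.sLT false (g x) τ ∧
      ∀ s, OMin.sLT false (f x) s → OMin.sLT false s τ → T x s) (by fun_prop)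
  · exact DM.dSup (T := fun x τ => OMin.sLT true (f x) τ ∧ ¬ OMin.sLT true (g x) τ ∧
      ∀ s, OMin.sLT true (f x) s → OMin.sLT true s τ → T x s) (by fun_prop)

theorem DM.germ_side {P : N → Prop} (hP : DM S P) (σ : Bool) (a : N) :
    (∀ᶠ y in sN σ a, P y) ∨ ∀ᶠ y in sN σ a, ¬ P y := by
  cases σ
  · exact hP.germ_left a
  · exact hP.germ_right a

theorem sReach_spec {A : N → Prop} (hA : DM S A) {σ : Bool} {a δ : N} (hδ : sLT σ a δ)
    (h : ∀ᶠ s in sN σ a, A s) :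
    sLT σ a (sReach σ a δ A) ∧ ¬ sLT σ δ (sReach σ a δ A) ∧
      ∀ s, sLT σ a s → sLT σ s (sReach σ a δ A) → A s := by
  obtain ⟨b, hab, hb⟩ := eventually_sN_iff.1 h
  have hd : DSet S {τ | sLT σ a τ ∧ ¬ sLT σ δ τ ∧ ∀ s, sLT σ a s → sLT σ s τ → A s} :=
    DM.pred (by fun_prop)
  obtain ⟨m, hm, ham⟩ : ∃ m, m ∈ {τ | sLT σ a τ ∧ ¬ sLT σ δ τ ∧
      ∀ s, sLT σ a s → sLT σ s τ → A s} ∧ sLT σ a m := by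
    rcases sLT_trichotomy σ b δ with h1 | rfl | h1
    · exact ⟨b, ⟨hab, fun h2 => h1.asymm h2, hb⟩, hab⟩
    · exact ⟨b, ⟨hab, sLT_irrefl _ _, hb⟩, hab⟩
    · exact ⟨δ, ⟨hδ, sLT_irrefl _ _, fun s h2 h3 => hb s h2 (h3.trans h1)⟩, hδ⟩
  cases σ
  · have hl : IsGLB _ (sReach false a δ A) :=
      hd.isGLB_dInf ⟨m, hm⟩ ⟨δ, fun z hz => le_of_not_gt (α := N) hz.2.1⟩
    refine ⟨lt_of_le_of_lt (α := N) (hl.1 hm) ham,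
      not_lt_of_ge (α := N) (hl.2 fun z hz => le_of_not_gt (α := N) hz.2.1), fun s h1 h2 => ?_⟩
    obtain ⟨z, hz, hzs⟩ := (isGLB_lt_iff hl).1 h2
    exact hz.2.2 s h1 hzs
  · have hl : IsLUB _ (sReach true a δ A) :=
      hd.isLUB_dSup ⟨m, hm⟩ ⟨δ, fun z hz => le_of_not_gt (α := N) hz.2.1⟩
    refine ⟨lt_of_lt_of_le (α := N) ham (hl.1 hm),
      not_lt_of_ge (α := N) (hl.2 fun z hz => le_of_not_gt (α := N) hz.2.1), fun s h1 h2 => ?_⟩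
    obtain ⟨z, hz, hzs⟩ := (lt_isLUB_iff hl).1 h2
    exact hz.2.2 s h1 hzs

end Sides

end OMin

namespace OMin

section Choosable

variable {N : Type u} [LinearOrder N] [DenselyOrdered N] [NoMinOrder N] [NoMaxOrder N]
  [Nonempty N] {S : Struc N} {G : Type*} [Group G] [DefTy S G] {V : Set G}

/-- Functions on `G` that are constant on the left cosets of `V`. -/
def VInv {α : Sort*} (V : Set G) (f : G → α) : Prop :=
  ∀ u, ∀ v ∈ V, f (u * v) = f u

/-- There is a definable `V`-invariant choice of elements of the sets `{z | T u z}`, correct for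
almost all `u ∈ Y`. -/
def Choosable (S : Struc N) [DefTy S G] {M : Type*} [DefTy S M] (V : Set G) (T : G → M → Prop)
    (Y : Set G) : Prop :=
  ∃ c : G → M, DM S c ∧ VInv V c ∧ rk S {u | u ∈ Y ∧ ¬ T u (c u)} < rk S (univ : Set G)

variable {M : Type*} [DefTy S M] {T : G → M → Prop} {Y Z : Set G}

theorem Choosable.mono (h : Choosable S V T Z) (hYZ : Y ⊆ Z) : Choosable S V T Y := by
  obtain ⟨c, hc, hcV, hr⟩ := h
  exact ⟨c, hc, hcV, (rk_mono fun u (hu : u ∈ Y ∧ _) => (⟨hYZ hu.1, hu.2⟩ : u ∈ Z ∧ _)).trans_lt hr⟩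

theorem choosable_of_small [Nonempty M] (h : rk S Y < rk S (univ : Set G)) :
    Choosable S V T Y :=
  ⟨fun _ => Classical.arbitrary M, by fun_prop, fun _ _ _ => rfl,
    (rk_mono fun _ hu => hu.1).trans_lt h⟩

theorem choosable_of_forall {c : G → M} (hc : DM S c) (hcV : VInv V c) (h : ∀ u ∈ Y, T u (c u)) :
    Choosable S V T Y := by
  refine ⟨c, hc, hcV, ?_⟩
  rw [show {u | u ∈ Y ∧ ¬ T u (c u)} = ∅ from eq_empty_of_forall_notMem fun u hu =>
    hu.2 (h u hu.1), rk_eq_zero.2 rfl]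
  exact rk_pos.2 univ_nonempty

theorem Choosable.union (hT : DM S (fun p : G × M => T p.1 p.2)) (hTV : VInv V T)
    (h1 : Choosable S V T Y) (h2 : Choosable S V T Z) : Choosable S V T (Y ∪ Z) := by
  classical
  obtain ⟨c, hc, hcV, hr⟩ := h1
  obtain ⟨d, hd, hdV, hs⟩ := h2
  have hT1 : DM S (fun u => T u (c u)) := hT.comp' (f := fun u => (u, c u)) (by fun_prop)
  refine ⟨fun u => if T u (c u) then c u else d u, DM.ite hT1 hc hd, fun u v hv => ?_, ?_⟩
  · simp only [hTV u v hv, hcV u v hv, hdV u v hv]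
  · refine lt_of_le_of_lt (rk_mono ?_) ((rk_union _ _).trans_lt (max_lt hr hs))
    rintro u ⟨hu, hn⟩
    by_cases h : T u (c u)
    · exact absurd h (by simpa [h] using hn)
    · simp only [h, if_false] at hn
      exact hu.imp (fun h' => ⟨h', h⟩) fun h' => ⟨h', hn⟩

theorem choosable_iUnion [Nonempty M] (hT : DM S (fun p : G × M => T p.1 p.2)) (hTV : VInv V T)
    {ι : Type*} [Finite ι] {Y : ι → Set G} (h : ∀ i, Choosable S V T (Y i)) :
    Choosable S V T (⋃ i, Y i) := by
  have key : ∀ s : Set ι, s.Finite → Choosable S V T (⋃ i ∈ s, Y i) := by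
    intro s hs
    induction s, hs using Set.Finite.induction_on with
    | empty =>
      refine choosable_of_forall (c := fun _ => Classical.arbitrary M) (by fun_prop)
        (fun _ _ _ => rfl) (by simp)
    | insert _ _ ih =>
      rw [biUnion_insert]
      exact (h _).union hT hTV ih
  exact (key univ finite_univ).mono (by simp)

variable [TopologicalSpace N] [OrderTopology N] [TopologicalSpace G] [DGrp S G]

theorem rk_preimage_mul_left (g : G) {A : Set G} (hA : DSet S A) :
    rk S {u | g * u ∈ A} = rk S A := by
  rw [← rk_mul_left g⁻¹ hA]
  congr 1
  ext u
  constructor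
  · intro h
    exact ⟨_, h, by simp⟩
  · rintro ⟨a, ha, rfl⟩
    simpa using ha

/-- Choice along a curve through the identity. -/
theorem choosable_of_curve {T : G → N → Prop} (hT : DM S (fun p : G × N => T p.1 p.2))
    (hTV : VInv V T) {x : G → N} (hx : DM S x) (hxV : VInv V x) {g : N → G} (hg : DM S g)
    {τ₀ : N} (hg1 : g τ₀ = 1) (hgc : ContinuousAt g τ₀) (σ σ' : Bool) :
    Choosable S V T {u | Tendsto (fun τ => x (g τ * u)) (sN σ τ₀) (sN σ' (x u)) ∧
      ∀ᶠ z in sN σ' (x u), T u z} := by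
  set good : Set G := {u | Tendsto (fun τ => x (g τ * u)) (sN σ τ₀) (sN σ' (x u)) ∧
      ∀ᶠ z in sN σ' (x u), T u z} with hgood
  by_cases hlarge : rk S good < rk S (univ : Set G)
  · exact choosable_of_small hlarge
  push Not at hlarge
  have hE : DSet S {p : G × N | sLT σ τ₀ p.2 ∧ ∀ τ, sLT σ τ₀ τ → sLT σ τ p.2 →
      sLT σ' (x p.1) (x (g τ * p.1))} := DM.pred (by fun_prop)
  have hgood0 : good.Nonempty := (rk_pos (S := S)).1
    (((rk_pos (S := S)).2 (univ_nonempty (α := G))).trans hlarge)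
  obtain ⟨ε, hε⟩ := exists_uniform hE hgood0 (fun u hu => by
    obtain ⟨b, hb, hub⟩ := eventually_sN_iff.1 (hu.1.eventually (eventually_sLT σ' (x u)))
    rw [rk_univ_N, two_le_rk_N (hE.dm.comp' (f := fun y => (u, y)) (by fun_prop)).pred]
    refine (infinite_sLT_between hb).mono fun ε h => ⟨h.1, fun τ h1 h2 => ?_⟩
    exact hub τ h1 (h2.trans h.2)) inferInstance
  set R : Set G := {u | sLT σ τ₀ ε ∧ ∀ τ, sLT σ τ₀ τ → sLT σ τ ε →
      sLT σ' (x u) (x (g τ * u))} with hR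
  have hRd : DSet S R := DM.pred (by fun_prop)
  obtain ⟨B₁, -, hB₁, hcont⟩ := exists_continuousAt_off_small hx
  obtain ⟨B₂, -, hB₂, hnhds⟩ := exists_mem_nhds_off_small hRd
  obtain ⟨u₀, hu₀, hu₀B⟩ : ∃ u ∈ R, u ∉ B₁ ∪ B₂ := by
    by_contra! h
    have h1 := rk_mono (S := S) h
    rw [rk_union] at h1
    exact absurd ((hlarge.trans hε).trans h1) (not_le.2 (max_lt hB₁ hB₂))
  rw [mem_union, not_or] at hu₀B
  have hc₀ := hcont u₀ hu₀B.1
  have hRn := hnhds u₀ hu₀ hu₀B.2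
  have hg0 : Tendsto g (sN σ τ₀) (𝓝 1) := by
    have := hgc.tendsto.mono_left (sN_le σ τ₀)
    rwa [hg1] at this
  have ht1 : Tendsto (fun τ => g τ * u₀) (sN σ τ₀) (𝓝 u₀) := by
    simpa using hg0.mul_const u₀
  have ht2 : Tendsto (fun τ => g τ * (g τ * u₀)) (sN σ τ₀) (𝓝 u₀) := by
    simpa using hg0.mul ht1
  set a : N → N := fun τ => x (g τ * u₀) with ha
  set b : N → N := fun τ => x (g τ * (g τ * u₀)) with hb
  have had : DM S a := by fun_prop
  have hbd : DM S b := by fun_prop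
  have hat : Tendsto b (sN σ τ₀) (𝓝 (x u₀)) := hc₀.tendsto.comp ht2
  have hεσ := hu₀.1
  have hbtw : ∀ᶠ τ in sN σ τ₀, sLT σ τ₀ τ ∧ sLT σ τ ε :=
    eventually_sN_iff.2 ⟨ε, hεσ, fun s h1 h2 => ⟨h1, h2⟩⟩
  have hxa : ∀ᶠ τ in sN σ τ₀, sLT σ' (x u₀) (a τ) := by
    filter_upwards [hbtw] with τ hτ using hu₀.2 τ hτ.1 hτ.2
  have hab : ∀ᶠ τ in sN σ τ₀, sLT σ' (a τ) (b τ) := by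
    filter_upwards [hbtw, ht1 hRn] with τ hτ hτR using hτR.2 τ hτ.1 hτ.2
  have hone : ∀ᶠ δ in sN σ τ₀, ∀ᶠ τ in sN σ τ₀, sLT σ' (b τ) (a δ) := by
    filter_upwards [hxa] with δ hδ using hat (eventually_nhds_sLT hδ)
  have htwo : ∀ᶠ δ in sN σ τ₀, ∃ τ, sLT σ τ₀ τ ∧ sLT σ τ δ ∧ ¬ sLT σ' (b τ) (a δ) := by
    refine (DM.germ_side (S := S) (by fun_prop) σ τ₀).resolve_right fun h => ?_
    obtain ⟨e, he, hall⟩ := eventually_sN_iff.1 (h.and hab)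
    obtain ⟨δ, ⟨hδ1, hδ2⟩, hδc⟩ :=
      ((infinite_sLT_between he).diff hbd.finite_discontinuous).nonempty
    have hδc' : ContinuousAt b δ := by
      by_contra h
      exact hδc h
    obtain ⟨hn, hlt⟩ := hall δ hδ1 hδ2
    push Not at hn
    have hbt : Tendsto b (sN (!σ) δ) (𝓝 (b δ)) := hδc'.tendsto.mono_left (sN_le _ _)
    have h1 : ∀ᶠ τ in sN (!σ) δ, sLT (!σ') (b τ) (a δ) :=
      hbt (eventually_nhds_sLT ((sLT_not _ _ _).2 hlt))
    have h2 : ∀ᶠ τ in sN (!σ) δ, sLT σ τ₀ τ ∧ sLT σ τ δ :=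
      eventually_sN_iff.2 ⟨τ₀, (sLT_not _ _ _).2 hδ1, fun s h3 h4 =>
        ⟨(sLT_not _ _ _).1 h4, (sLT_not _ _ _).1 h3⟩⟩
    obtain ⟨τ, h3, h4, h5⟩ := (h1.and h2).exists
    exact (hn τ h4 h5).asymm ((sLT_not _ _ _).1 h3)
  set k : N → N := fun δ => sReach σ τ₀ δ fun τ => sLT σ' (b τ) (a δ) with hk
  have hkd : DM S k := by fun_prop
  have hkb : ∀ᶠ δ in sN σ τ₀, sLT σ τ₀ (k δ) ∧ sLT σ (k δ) δ := by
    filter_upwards [hone, htwo, eventually_sLT σ τ₀] with δ h1 ⟨τ, h2, h3, h4⟩ h5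
    obtain ⟨h6, -, h7⟩ := sReach_spec (by fun_prop) h5 h1
    refine ⟨h6, ?_⟩
    rcases sLT_trichotomy σ τ (k δ) with h8 | h8 | h8
    · exact (h4 (h7 τ h2 h8)).elim
    · rwa [← h8]
    · exact h8.trans h3
  obtain ⟨d, hd, hkd'⟩ := eventually_sN_iff.1 hkb
  obtain ⟨δ₁, hδ₁, hδ₁d⟩ := exists_sLT_between hd
  have hA : DM S (fun p : G × N => T p.1 (x (g p.2 * p.1))) :=
    hT.comp' (f := fun p : G × N => (p.1, x (g p.2 * p.1))) (by fun_prop)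
  set δ : G → N := fun u => sReach σ τ₀ δ₁ fun τ => T u (x (g τ * u)) with hδ
  have hδd : DM S δ := DM.sReach (T := fun u τ => T u (x (g τ * u))) σ hA (by fun_prop) (by fun_prop)
  have hδV : VInv V δ := fun u v hv => by
    simp only [hδ, ← mul_assoc, hTV u v hv, hxV _ v hv]
  refine choosable_of_forall (c := fun u => x (g (k (δ u)) * u)) (by fun_prop)
    (fun u v hv => by simp only [hδV u v hv, ← mul_assoc, hxV _ v hv]) fun u hu => ?_
  obtain ⟨h1, h2, h3⟩ := sReach_spec (δ := δ₁) (A := fun τ => T u (x (g τ * u)))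
    (DM.section (T := fun u τ => T u (x (g τ * u))) hA u) hδ₁
    (hu.1.eventually hu.2)
  have h4 : sLT σ (δ u) d := by
    rcases sLT_trichotomy σ (δ u) δ₁ with h | h | h
    · exact h.trans hδ₁d
    · rwa [h]
    · exact (h2 h).elim
  obtain ⟨h5, h6⟩ := hkd' (δ u) h1 h4
  exact h3 _ h5 h6

end Choosable

end OMin

namespace OMin

section Side

variable {N : Type u} [LinearOrder N] [DenselyOrdered N] [NoMinOrder N] [NoMaxOrder N]
  [Nonempty N] [TopologicalSpace N] [OrderTopology N]

theorem LI.tendsto_side {f : N → N} {x : N} (h : LI f x) (σ : Bool) :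
    Tendsto f (sN σ x) (sN σ (f x)) := by
  cases σ
  · exact h.2
  · exact h.1

theorem LD.tendsto_side {f : N → N} {x : N} (h : LD f x) (σ : Bool) :
    Tendsto f (sN (!σ) x) (sN σ (f x)) := by
  cases σ
  · exact h.1
  · exact h.2

variable {S : Struc N}

theorem update_mem_box {n : ℕ} {l r y : Fin n → N} (hy : y ∈ box l r) {i : Fin n} {t : N}
    (h1 : l i < t) (h2 : t < r i) : Function.update y i t ∈ box l r := by
  intro j
  by_cases h : j = i
  · subst h
    simpa using ⟨h1, h2⟩
  · simpa [h] using hy j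

theorem rk_le_of_finite_lines {n : ℕ} {A : Set (Fin n → N)} (hA : DSet S A) (i : Fin n)
    (h : ∀ y, {t | Function.update y i t ∈ A}.Finite) : rk S A ≤ n := by
  by_contra! hlt
  obtain ⟨l, r, hlr, hsub⟩ := exists_box hA hlt
  obtain ⟨y, hy⟩ := box_nonempty hlr
  refine (Ioo_infinite (hlr i)).mono (fun t ht => ?_) (h y)
  exact hsub (update_mem_box hy ht.1 ht.2)

theorem DM.const_on_box {n : ℕ} {h : (Fin n → N) → N} (hh : DM S h) {l r : Fin n → N}
    (hc : ∀ y ∈ box l r, ∀ i, LC (fun t => h (Function.update y i t)) (y i)) {y z : Fin n → N}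
    (hy : y ∈ box l r) (hz : z ∈ box l r) : h y = h z := by
  classical
  have hline : ∀ y ∈ box l r, ∀ (i : Fin n) (t : N), l i < t → t < r i →
      h (Function.update y i t) = h y := by
    intro y hy i t h1 h2
    have hd : DM S (fun t => h (Function.update y i t)) := by fun_prop
    have := hd.const_of_locally_const (a := l i) (b := r i) (fun c hc1 hc2 => by
      have := hc _ (update_mem_box hy hc1 hc2) i
      simpa [LC] using this) ⟨h1, h2⟩ (hy i)
    simpa using this
  have key : ∀ s : Finset (Fin n), h (s.piecewise z y) = h y ∧ s.piecewise z y ∈ box l r := by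
    intro s
    induction s using Finset.induction_on with
    | empty => simpa using hy
    | insert a s ha ih =>
      rw [Finset.piecewise_insert]
      exact ⟨(hline _ ih.2 a _ (hz a).1 (hz a).2).trans ih.1,
        update_mem_box ih.2 (hz a).1 (hz a).2⟩
  simpa using (key Finset.univ).1.symm

end Side

section Core

variable {N : Type u} [LinearOrder N] [DenselyOrdered N] [NoMinOrder N] [NoMaxOrder N]
  [Nonempty N] {S : Struc N} {G : Type*} [DefTy S G]

/-- The points of `G` near which `x` is generically not constant. -/
def nonconst (S : Struc N) [DefTy S G] (x : G → N) : Set G :=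
  {u | rk S {w | x w = x u} < rk S (univ : Set G)}

variable [TopologicalSpace N] [OrderTopology N]

@[fun_prop]
theorem DM.mem_nonconst {X : Type*} [DefTy S X] {x : G → N} (hx : DM S x) {f : X → G}
    (hf : DM S f) : DM S (fun p => f p ∈ nonconst S x) :=
  DM.rk_lt (T := fun p w => x w = x (f p)) (by fun_prop) _

variable [Group G] {V : Set G} [TopologicalSpace G] [DGrp S G]

theorem choosable_side {T : G → N → Prop} (hT : DM S (fun p : G × N => T p.1 p.2))
    (hTV : VInv V T) {x : G → N} (hx : DM S x) (hxV : VInv V x) (σ : Bool) :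
    Choosable S V T {u | u ∈ nonconst S x ∧ ∀ᶠ z in sN σ (x u), T u z} := by
  obtain ⟨n, hn⟩ := Nat.exists_eq_add_of_le' ((rk_pos (S := S)).2 (univ_nonempty (α := G)))
  obtain ⟨l, r, β, hlr, hβ, hinj, hcont⟩ := exists_group_param hn
  set bad : Set ((Fin n → N) × G) := {p | p.1 ∈ box l r ∧ β p.1 * p.2 ∈ nonconst S x ∧
    ∀ i, ¬ (LI (fun t => x (β (Function.update p.1 i t) * p.2)) (p.1 i) ∨
      LD (fun t => x (β (Function.update p.1 i t) * p.2)) (p.1 i))} with hbad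
  have hbadd : DSet S bad := by
    refine DM.pred (DM.and (by fun_prop) (DM.and (by fun_prop) (DM.finForall fun i => ?_)))
    have h1 : DM S (fun q : ((Fin n → N) × G) × N =>
      x (β (Function.update q.1.1 i q.2) * q.1.2)) := by fun_prop
    fun_prop
  have hslice : ∀ w, rk S {y | (y, w) ∈ bad} < n + 1 := by
    intro w
    by_contra! hge
    set h : (Fin n → N) → N := fun y => x (β y * w) with hh
    have hd : DM S h := by fun_prop
    set D : Fin n → Set (Fin n → N) := fun i =>
      {y | ¬ (LC (fun t => h (Function.update y i t)) (y i) ∨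
        LI (fun t => h (Function.update y i t)) (y i) ∨
        LD (fun t => h (Function.update y i t)) (y i))} with hD
    have hDd : ∀ i, DSet S (D i) := fun i => DM.pred (by fun_prop)
    have hDr : ∀ i, rk S (D i) ≤ n := fun i => rk_le_of_finite_lines (hDd i) i fun y => by
      have h1 : DM S (fun t => h (Function.update y i t)) := by fun_prop
      refine h1.finite_not_monotone.subset fun t ht => ?_
      simpa [hD] using ht
    set C : Set (Fin n → N) := {y | y ∈ box l r ∧ β y * w ∈ nonconst S x ∧
      ∀ i, LC (fun t => h (Function.update y i t)) (y i)} with hC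
    have hCd : DSet S C := by
      refine DM.pred (DM.and (by fun_prop) (DM.and (by fun_prop) (DM.finForall fun i => ?_)))
      fun_prop
    have hcov : {y | (y, w) ∈ bad} ⊆ C ∪ ⋃ i, D i := by
      rintro y ⟨h1, h2, h3⟩
      by_cases h4 : ∀ i, LC (fun t => h (Function.update y i t)) (y i)
      · exact Or.inl ⟨h1, h2, h4⟩
      · push Not at h4
        obtain ⟨i, hi⟩ := h4
        exact Or.inr (mem_iUnion.2 ⟨i, fun h5 => h5.elim hi (h3 i)⟩)
    have h1 := rk_mono (S := S) hcov
    rw [rk_union] at h1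
    have h2 := rk_iUnion_le (S := S) hDr
    have hCr : n + 1 ≤ rk S C := by omega
    obtain ⟨l', r', hlr', hsub⟩ := exists_box hCd hCr
    obtain ⟨y₀, hy₀⟩ := box_nonempty hlr'
    have h3 : rk S {w' | x w' = x (β y₀ * w)} < rk S (univ : Set G) := (hsub hy₀).2.1
    have h4 := rk_le_of_injOn (S := S) (f := fun y => β y * w) (by fun_prop) (DSet.box l' r')
      (fun y hy z hz hyz => hinj (hsub hy).1 (hsub hz).1 (mul_right_cancel hyz))
      (B := {w' | x w' = x (β y₀ * w)})
      (fun y hy => hd.const_on_box (fun y hy => (hsub hy).2.2) hy hy₀)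
    rw [rk_box hlr'] at h4
    omega
  obtain ⟨y₀, hy₀, hsmall⟩ : ∃ y ∈ box l r, rk S {w | (y, w) ∈ bad} < rk S (univ : Set G) := by
    by_contra! h
    obtain ⟨w, hw⟩ := exists_uniform hbadd (box_nonempty hlr) h inferInstance
    rw [rk_box hlr] at hw
    exact absurd hw (not_le.2 (hslice w))
  have hy₀c : ∀ i, ContinuousAt (fun t => β (Function.update y₀ i t) * (β y₀)⁻¹) (y₀ i) := by
    intro i
    refine ContinuousAt.mul ?_ continuousAt_const
    refine ContinuousAt.comp (g := β) ?_ (continuous_const.update i continuous_id).continuousAt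
    simpa using hcont y₀ hy₀
  have hcurve := fun p : Fin n × Bool => choosable_of_curve hT hTV hx hxV
    (g := fun t => β (Function.update y₀ p.1 t) * (β y₀)⁻¹) (by fun_prop) (τ₀ := y₀ p.1)
    (by simp) (hy₀c p.1) p.2 σ
  have hslY : DSet S {w | (y₀, w) ∈ bad} :=
    (hbadd.dm.comp' (f := fun w => (y₀, w)) (by fun_prop)).pred
  refine ((choosable_iUnion hT hTV hcurve).union hT hTV
    (choosable_of_small (Y := {u | (β y₀)⁻¹ * u ∈ {w | (y₀, w) ∈ bad}}) ?_)).mono ?_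
  · rwa [rk_preimage_mul_left _ hslY]
  rintro u ⟨hu1, hu2⟩
  by_cases hb : (y₀, (β y₀)⁻¹ * u) ∈ bad
  · exact Or.inr hb
  refine Or.inl ?_
  have h1 : ∃ i, LI (fun t => x (β (Function.update y₀ i t) * ((β y₀)⁻¹ * u))) (y₀ i) ∨
      LD (fun t => x (β (Function.update y₀ i t) * ((β y₀)⁻¹ * u))) (y₀ i) := by
    by_contra! h
    exact hb ⟨hy₀, by simpa using hu1, fun i h' => h'.elim (h i).1 (h i).2⟩
  obtain ⟨i, hi | hi⟩ := h1
  · refine mem_iUnion.2 ⟨(i, σ), ?_, hu2⟩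
    simpa [mul_assoc] using hi.tendsto_side σ
  · refine mem_iUnion.2 ⟨(i, !σ), ?_, hu2⟩
    simpa [mul_assoc] using hi.tendsto_side σ

theorem finite_image_not_nonconst {x : G → N} (hx : DM S x) : (x '' (nonconst S x)ᶜ).Finite := by
  by_contra hinf
  have hd : DSet S (nonconst S x)ᶜ := DM.pred (P := fun u => ¬ u ∈ nonconst S x) (by fun_prop)
  have h1 := (two_le_rk_N (hd.image hx)).2 hinf
  obtain ⟨k, hk⟩ := Nat.exists_eq_add_of_le' ((rk_pos (S := S)).2 (univ_nonempty (α := G)))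
  have h2 := le_rk_of_fibers (S := S) hx DSet.univ (k := k) (C := x '' (nonconst S x)ᶜ)
    ((rk_pos (S := S)).1 (by omega)) (by
      rintro _ ⟨u, hu, rfl⟩
      rw [← hk]
      simpa [nonconst] using hu)
  omega

end Core

end OMin

namespace OMin

section First

variable {N : Type u} [LinearOrder N] [DenselyOrdered N] [NoMinOrder N] [NoMaxOrder N]
  [Nonempty N] {S : Struc N} {X : Type*} [DefTy S X]

/-- The infimum (for the order or the reverse order) of the points beyond `a` satisfying `P`. -/
noncomputable def sFirst (σ : Bool) (a : N) (P : N → Prop) : N :=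
  bif σ then dInf {y | sLT σ a y ∧ P y} else dSup {y | sLT σ a y ∧ P y}

theorem sFirst_spec {P : N → Prop} (hP : DM S P) {σ : Bool} {a : N} (h : ∃ y, sLT σ a y ∧ P y) :
    ¬ sLT σ (sFirst σ a P) a ∧ (∀ z, sLT σ a z → sLT σ z (sFirst σ a P) → ¬ P z) ∧
      ∀ b, sLT σ (sFirst σ a P) b → ∃ z, ¬ sLT σ z (sFirst σ a P) ∧ sLT σ z b ∧ sLT σ a z ∧ P z := by
  cases σ
  · have hd : DSet S {y | y < a ∧ P y} := DM.pred (by fun_prop)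
    have hl : IsLUB _ (sFirst false a P) := hd.isLUB_dSup h ⟨a, fun z hz => hz.1.le⟩
    refine ⟨not_lt_of_ge (α := N) (hl.2 fun z hz => hz.1.le),
      fun z h1 h2 h3 => lt_irrefl (a := z) (lt_of_le_of_lt (hl.1 ⟨h1, h3⟩) h2), fun b hb => ?_⟩
    obtain ⟨z, hz, hzb⟩ := (lt_isLUB_iff hl).1 hb
    exact ⟨z, not_lt_of_ge (α := N) (hl.1 hz), hzb, hz⟩
  · have hd : DSet S {y | a < y ∧ P y} := DM.pred (by fun_prop)
    have hl : IsGLB _ (sFirst true a P) := hd.isGLB_dInf h ⟨a, fun z hz => hz.1.le⟩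
    refine ⟨not_lt_of_ge (α := N) (hl.2 fun z hz => hz.1.le),
      fun z h1 h2 h3 => lt_irrefl (a := z) (lt_of_lt_of_le h2 (hl.1 ⟨h1, h3⟩)), fun b hb => ?_⟩
    obtain ⟨z, hz, hzb⟩ := (isGLB_lt_iff hl).1 hb
    exact ⟨z, not_lt_of_ge (α := N) (hl.1 hz), hzb, hz⟩

variable [TopologicalSpace N] [OrderTopology N]

@[fun_prop]
theorem DM.sFirst {T : X → N → Prop} (σ : Bool) (hT : DM S (fun p : X × N => T p.1 p.2))
    {f : X → N} (hf : DM S f) : DM S (fun x => sFirst σ (f x) (T x)) := by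
  cases σ
  · exact DM.dSup (T := fun x y => OMin.sLT false (f x) y ∧ T x y) (by fun_prop)
  · exact DM.dInf (T := fun x y => OMin.sLT true (f x) y ∧ T x y) (by fun_prop)

theorem eventually_sFirst {P : N → Prop} (hP : DM S P) (ho : ∀ y, P y → ∀ᶠ z in 𝓝 y, P z)
    {σ : Bool} {a : N} (h : ∃ y, sLT σ a y ∧ P y) : ∀ᶠ z in sN σ (sFirst σ a P), P z := by
  obtain ⟨-, -, h1⟩ := sFirst_spec hP h
  refine (hP.germ_side σ _).resolve_right fun h2 => ?_
  obtain ⟨b, hb, hbP⟩ := eventually_sN_iff.1 h2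
  obtain ⟨z, hz1, hz2, -, hz3⟩ := h1 b hb
  rcases sLT_trichotomy σ z (sFirst σ a P) with h3 | h3 | h3
  · exact hz1 h3
  · obtain ⟨w, hw1, hw2⟩ := (h2.and ((ho z hz3).filter_mono (h3 ▸ sN_le σ _))).exists
    exact hw1 hw2
  · exact hbP z h3 hz2 hz3

theorem eventually_not_sFirst {P : N → Prop} (hP : DM S P) {σ : Bool} {a : N}
    (h : ∃ y, sLT σ a y ∧ P y) (h0 : ∀ᶠ z in sN σ a, ¬ P z) :
    sLT σ a (sFirst σ a P) ∧ ∀ᶠ z in sN (!σ) (sFirst σ a P), ¬ P z := by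
  obtain ⟨h1, h2, h3⟩ := sFirst_spec hP h
  have h4 : sLT σ a (sFirst σ a P) := by
    rcases sLT_trichotomy σ a (sFirst σ a P) with h4 | h4 | h4
    · exact h4
    · obtain ⟨b, hb, hbP⟩ := eventually_sN_iff.1 h0
      obtain ⟨z, -, hz1, hz2, hz3⟩ := h3 b (h4 ▸ hb)
      exact (hbP z hz2 hz1 hz3).elim
    · exact (h1 h4).elim
  refine ⟨h4, eventually_sN_iff.2 ⟨a, (sLT_not _ _ _).2 h4, fun s h5 h6 =>
    h2 s ((sLT_not _ _ _).1 h6) ((sLT_not _ _ _).1 h5)⟩⟩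

end First

section Choice

variable {N : Type u} [LinearOrder N] [DenselyOrdered N] [NoMinOrder N] [NoMaxOrder N]
  [Nonempty N] {S : Struc N} {G : Type*} [DefTy S G] [Group G] {V : Set G}
  [TopologicalSpace N] [OrderTopology N] [TopologicalSpace G] [DGrp S G]

theorem choosable_fibers {T : G → N → Prop} (hT : DM S (fun p : G × N => T p.1 p.2))
    (hTV : VInv V T) {x : G → N} (hx : DM S x) {Y : Set G}
    (h1 : Choosable S V T {u | u ∈ Y ∧ u ∈ nonconst S x})
    (h2 : ∀ a, Choosable S V T {u | u ∈ Y ∧ x u = a}) : Choosable S V T Y := by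
  have := (finite_image_not_nonconst (S := S) hx).to_subtype
  refine (h1.union hT hTV (choosable_iUnion hT hTV
    fun a : x '' (nonconst S x)ᶜ => h2 a)).mono fun u hu => ?_
  by_cases h : u ∈ nonconst S x
  · exact Or.inl ⟨hu, h⟩
  · exact Or.inr (mem_iUnion.2 ⟨⟨x u, u, h, rfl⟩, hu, rfl⟩)

theorem choosable_right_of {T : G → N → Prop} (hT : DM S (fun p : G × N => T p.1 p.2))
    (hTV : VInv V T) (σ : Bool) (a : N) : Choosable S V T {u | ∀ᶠ z in sN σ a, T u z} := by
  have hT' : DM S (fun p : G × N => ¬ T p.1 p.2) := by fun_prop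
  have hd : DM S (fun u => sFirst σ a fun y => ¬ T u y) :=
    DM.sFirst (T := fun u y => ¬ T u y) σ hT' (by fun_prop)
  have hV : VInv V (fun u => sFirst σ a fun y => ¬ T u y) := fun u v hv => by
    simp only [hTV u v hv]
  have hTu : ∀ u, DM S (fun y => ¬ T u y) := fun u => DM.section (T := fun u y => ¬ T u y) hT' u
  obtain ⟨b, hb⟩ := exists_sLT σ a
  refine ((choosable_of_forall (Y := {u | ∀ y, sLT σ a y → T u y}) (c := fun _ => b)
    (by fun_prop) (fun _ _ _ => rfl) fun u hu => hu b hb).union hT hTV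
    (choosable_fibers (Y := {u | (∃ y, sLT σ a y ∧ ¬ T u y) ∧ ∀ᶠ z in sN σ a, T u z}) hT hTV hd
      ((choosable_side hT hTV hd hV (!σ)).mono ?_) fun e => ?_)).mono ?_
  · rintro u ⟨⟨h1, h2⟩, h3⟩
    refine ⟨h3, ?_⟩
    simpa using (eventually_not_sFirst (hTu u) h1 (by simpa using h2)).2
  · by_cases he : sLT σ a e
    · obtain ⟨m, hm, hme⟩ := exists_sLT_between he
      refine choosable_of_forall (c := fun _ => m) (by fun_prop) (fun _ _ _ => rfl) ?_
      rintro u ⟨⟨h1, h2⟩, rfl⟩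
      exact not_not.1 ((sFirst_spec (hTu u) h1).2.1 m hm hme)
    · refine choosable_of_forall (c := fun _ => a) (by fun_prop) (fun _ _ _ => rfl) ?_
      rintro u ⟨⟨h1, h2⟩, rfl⟩
      exact (he (eventually_not_sFirst (hTu u) h1 (by simpa using h2)).1).elim
  · intro u hu
    by_cases h : ∀ y, sLT σ a y → T u y
    · exact Or.inl h
    · push Not at h
      exact Or.inr ⟨h, hu⟩

/-- Invariant definable choice in one variable, off a small set. -/
theorem choosable_univ {T : G → N → Prop} (hT : DM S (fun p : G × N => T p.1 p.2))
    (hTV : VInv V T) (hne : ∀ u, ∃ y, T u y) : Choosable S V T univ := by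
  have hTu : ∀ u, DM S (T u) := fun u => DM.section hT u
  set c₀ : N := Classical.arbitrary N
  have hd : ∀ σ, DM S (fun u => sFirst σ c₀ (T u)) := fun σ =>
    DM.sFirst σ hT (by fun_prop)
  have hV : ∀ σ, VInv V (fun u => sFirst σ c₀ (T u)) := fun σ u v hv => by
    simp only [hTV u v hv]
  have hB : DM S (fun p : G × N => T p.1 p.2 ∧ ¬ ∀ᶠ z in 𝓝 p.2, T p.1 z) := by
    have := hT.comp' (f := fun p : (G × N) × N => (p.1.1, p.2)) (by fun_prop)
    exact hT.and (DM.not (DM.eventually_nhds (T := fun p : G × N => T p.1) this (by fun_prop)))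
  have h1 : Choosable S V T {u | ∃ y, T u y ∧ ¬ ∀ᶠ z in 𝓝 y, T u z} := by
    refine choosable_of_forall (c := fun u => dInf {y | T u y ∧ ¬ ∀ᶠ z in 𝓝 y, T u z})
      (DM.dInf (T := fun u y => T u y ∧ ¬ ∀ᶠ z in 𝓝 y, T u z) hB)
      (fun u v hv => by simp only [hTV u v hv]) fun u hu => ?_
    have hfin : {y | T u y ∧ ¬ ∀ᶠ z in 𝓝 y, T u z}.Finite := by
      by_contra hinf
      have hd : DSet S {y | T u y ∧ ¬ ∀ᶠ z in 𝓝 y, T u z} :=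
        (DM.section (T := fun u y => T u y ∧ ¬ ∀ᶠ z in 𝓝 y, T u z) hB u).pred
      obtain ⟨p, q, hpq, hsub⟩ := hd.exists_Ioo_subset hinf
      obtain ⟨y, hy⟩ := exists_between hpq
      refine (hsub hy).2 ?_
      filter_upwards [Ioo_mem_nhds hy.1 hy.2] with z hz using (hsub hz).1
    obtain ⟨y, hy, hmin⟩ := exists_min_image _ id hfin hu
    have : IsLeast {y | T u y ∧ ¬ ∀ᶠ z in 𝓝 y, T u z} y := ⟨hy, hmin⟩
    rw [dInf_eq this.isGLB]
    exact hy.1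
  have h2 : Choosable S V T {u | T u c₀} :=
    choosable_of_forall (c := fun _ => c₀) (by fun_prop) (fun _ _ _ => rfl) fun u hu => hu
  have h3 : ∀ σ, Choosable S V T {u | (∀ y, T u y → ∀ᶠ z in 𝓝 y, T u z) ∧
      ∃ y, sLT σ c₀ y ∧ T u y} := fun σ => by
    refine choosable_fibers hT hTV (hd σ) ((choosable_side hT hTV (hd σ) (hV σ) σ).mono ?_)
      fun a => (choosable_right_of hT hTV σ a).mono ?_
    · rintro u ⟨⟨h1, h2⟩, h3⟩
      exact ⟨h3, eventually_sFirst (hTu u) h1 h2⟩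
    · rintro u ⟨⟨h1, h2⟩, rfl⟩
      exact eventually_sFirst (hTu u) h1 h2
  refine ((h1.union hT hTV h2).union hT hTV (choosable_iUnion hT hTV h3)).mono fun u _ => ?_
  by_cases ho : ∀ y, T u y → ∀ᶠ z in 𝓝 y, T u z
  · obtain ⟨y, hy⟩ := hne u
    rcases sLT_trichotomy true c₀ y with h | h | h
    · exact Or.inr (mem_iUnion.2 ⟨true, ho, y, h, hy⟩)
    · exact Or.inl (Or.inr (h ▸ hy))
    · exact Or.inr (mem_iUnion.2 ⟨false, ho, y, h, hy⟩)
  · push Not at ho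
    exact Or.inl (Or.inl (by simpa using ho))

/-- Invariant definable choice, off a small set. -/
theorem choosable_univ_pi {j : ℕ} {T : G → (Fin j → N) → Prop}
    (hT : DM S (fun p : G × (Fin j → N) => T p.1 p.2)) (hTV : VInv V T)
    (hne : ∀ u, ∃ y, T u y) : Choosable S V T univ := by
  induction j with
  | zero =>
    refine choosable_of_forall (c := fun _ => Fin.elim0) (by fun_prop) (fun _ _ _ => rfl)
      fun u _ => ?_
    obtain ⟨y, hy⟩ := hne u
    rwa [Subsingleton.elim Fin.elim0 y]
  | succ j ih =>
    have hT1 : DM S (fun p : (G × N) × (Fin j → N) => T p.1.1 (snocN p.2 p.1.2)) :=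
      hT.comp' (f := fun p : (G × N) × (Fin j → N) => (p.1.1, snocN p.2 p.1.2)) (by fun_prop)
    obtain ⟨c, hc, hcV, hcr⟩ := choosable_univ (V := V)
      (T := fun u y => ∃ z : Fin j → N, T u (snocN z y)) (DM.exists hT1)
      (fun u v hv => by simp only [hTV u v hv]) fun u => by
        obtain ⟨y, hy⟩ := hne u
        exact ⟨y (Fin.last j), fun i => y i.castSucc, by rwa [snocN_init]⟩
    have hT2 : DM S (fun p : G × (Fin j → N) => T p.1 (snocN p.2 (c p.1))) :=
      hT.comp' (f := fun p : G × (Fin j → N) => (p.1, snocN p.2 (c p.1))) (by fun_prop)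
    have hT3 : DM S (fun p : G × (Fin j → N) => T p.1 (snocN p.2 (c p.1)) ∨
        ¬ ∃ z, T p.1 (snocN z (c p.1))) := by
      have := hT.comp' (f := fun p : (G × (Fin j → N)) × (Fin j → N) =>
        (p.1.1, snocN p.2 (c p.1.1))) (by fun_prop)
      fun_prop
    obtain ⟨d, hd, hdV, hdr⟩ := ih (T := fun u z => T u (snocN z (c u)) ∨
      ¬ ∃ z, T u (snocN z (c u))) hT3 (fun u v hv => by simp only [hTV u v hv, hcV u v hv])
      fun u => by
        by_cases h : ∃ z, T u (snocN z (c u))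
        · exact h.imp fun z hz => Or.inl hz
        · exact ⟨Classical.arbitrary _, Or.inr h⟩
    refine ⟨fun u => snocN (d u) (c u), by fun_prop, fun u v hv => by
      simp only [hcV u v hv, hdV u v hv], ?_⟩
    refine lt_of_le_of_lt (rk_mono ?_) ((rk_union _ _).trans_lt (max_lt hcr hdr))
    rintro u ⟨-, hu⟩
    by_cases h : ∃ z, T u (snocN z (c u))
    · exact Or.inr ⟨trivial, fun h' => h'.elim hu fun h'' => h'' h⟩
    · exact Or.inl ⟨trivial, h⟩

theorem exists_rk_inter_lt {A Y : Set G} (hA : DSet S A) (hY : DSet S Y) (hY0 : Y.Nonempty)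
    (hAr : rk S A < rk S (univ : Set G)) : ∃ h, rk S {y | y ∈ Y ∧ h * y ∈ A} < rk S Y := by
  by_contra! H
  have hA' := hA.dm
  have hY' := hY.dm
  have hE : DSet S {p : G × G | p.2 ∈ Y ∧ p.1 * p.2 ∈ A} := DM.pred (by fun_prop)
  obtain ⟨k, hk⟩ := Nat.exists_eq_add_of_le' ((rk_pos (S := S)).2 hY0)
  obtain ⟨j, hj⟩ := Nat.exists_eq_add_of_le' ((rk_pos (S := S)).2 (univ_nonempty (α := G)))
  have h1 := le_rk_fst (k := k) (C := (univ : Set G)) hE univ_nonempty fun h _ => by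
    rw [← hk]
    exact H h
  have h2 := rk_le_snd (k := rk S A - 1) hE fun y => by
    refine (rk_le_of_injOn (S := S) (f := fun h => h * y) (B := A) (by fun_prop)
      (hE.dm.comp' (f := fun h => (h, y)) (by fun_prop)).pred (mul_left_injective y).injOn fun h hh => hh.2).trans (by omega)
  have h3 : rk S {y | ∃ h, (h, y) ∈ {p : G × G | p.2 ∈ Y ∧ p.1 * p.2 ∈ A}} ≤ rk S Y :=
    rk_mono fun y ⟨h, hy⟩ => hy.1
  have h4 : 1 ≤ rk S A := by
    by_contra h
    have h5 := H 1
    have h6 := rk_mono (S := S) (A := {y | y ∈ Y ∧ 1 * y ∈ A}) (B := A) fun y hy => by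
      simpa using hy.2
    omega
  omega

/-- Finitely many translates of a large definable set cover the group. -/
theorem exists_finite_cover {A : Set G} (hA : DSet S A) (hAr : rk S A < rk S (univ : Set G)) :
    ∃ F : Set G, F.Finite ∧ ∀ u, ∃ h ∈ F, h * u ∉ A := by
  have key : ∀ (k : ℕ) (Y : Set G), DSet S Y → rk S Y ≤ k →
      ∃ F : Set G, F.Finite ∧ ∀ u ∈ Y, ∃ h ∈ F, h * u ∉ A := by
    intro k
    induction k with
    | zero =>
      intro Y _ hk
      refine ⟨∅, finite_empty, fun u hu => ?_⟩
      rw [rk_eq_zero.1 (Nat.le_zero.1 hk)] at hu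
      exact hu.elim
    | succ k ih =>
      intro Y hY hk
      obtain rfl | hY0 := Y.eq_empty_or_nonempty
      · exact ⟨∅, finite_empty, fun u hu => hu.elim⟩
      have hA' := hA.dm
      have hY' := hY.dm
      obtain ⟨h, hh⟩ := exists_rk_inter_lt hA hY hY0 hAr
      obtain ⟨F, hF, hFY⟩ := ih _ (DM.pred (P := fun y => y ∈ Y ∧ h * y ∈ A) (by fun_prop))
        (by change rk S {y | y ∈ Y ∧ h * y ∈ A} ≤ k; omega)
      refine ⟨insert h F, hF.insert h, fun u hu => ?_⟩
      by_cases hu' : h * u ∈ A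
      · obtain ⟨g, hg, hgu⟩ := hFY u ⟨hu, hu'⟩
        exact ⟨g, mem_insert_of_mem _ hg, hgu⟩
      · exact ⟨h, mem_insert _ _, hu'⟩
  obtain ⟨F, hF, h⟩ := key _ univ DSet.univ le_rfl
  exact ⟨F, hF, fun u => h u trivial⟩

/-- The left cosets of a definable subgroup have a definable transversal. -/
theorem exists_transversal {V : Subgroup G} (hVd : DSet S (V : Set G)) :
    ∃ s : G → G, DM S s ∧ (∀ u, ∀ v ∈ V, s (u * v) = s u) ∧ ∀ u, u⁻¹ * s u ∈ V := by
  classical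
  obtain ⟨m, val, P, hv, hi, -⟩ := DGrp.exists_chart (S := S) (G := G)
  obtain ⟨inv, hinv, hiv⟩ := exists_dm_inverse hv hi
  have hV' : DM S (fun u => u ∈ V) := hVd.dm
  obtain ⟨c, hc, hcV, hcr⟩ := choosable_univ_pi (S := S) (V := (V : Set G))
    (T := fun u z => val (inv z) = z ∧ u⁻¹ * inv z ∈ V)
    (DM.and (by fun_prop) (hV'.comp' (f := fun p : G × (Fin m → N) => p.1⁻¹ * inv p.2)
      (by fun_prop)))
    (fun u v hv => by
      funext z
      dsimp only
      rw [mul_inv_rev, mul_assoc, V.mul_mem_cancel_left (V.inv_mem hv)])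
    fun u => ⟨val u, by rw [hiv], by simp [hiv]⟩
  set s₀ : G → G := fun u => inv (c u) with hs₀
  have hs₀d : DM S s₀ := by fun_prop
  have hs₀V : ∀ u, ∀ v ∈ V, s₀ (u * v) = s₀ u := fun u v hv => congrArg inv (hcV u v hv)
  set Z : Set G := {u | u⁻¹ * s₀ u ∈ V} with hZ
  have hZd : DSet S Z := (hV'.comp' (f := fun u => u⁻¹ * s₀ u) (by fun_prop)).pred
  have hZr : rk S Zᶜ < rk S (univ : Set G) :=
    (rk_mono fun u (hu : u ∉ Z) => (⟨trivial, fun h => hu h.2⟩ : u ∈ univ ∧ _)).trans_lt hcr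
  have hZV : ∀ u, ∀ v ∈ V, (u * v ∈ Z ↔ u ∈ Z) := fun u v hv => by
    change (u * v)⁻¹ * s₀ (u * v) ∈ V ↔ u⁻¹ * s₀ u ∈ V
    rw [hs₀V u v hv, mul_inv_rev, mul_assoc, V.mul_mem_cancel_left (V.inv_mem hv)]
  obtain ⟨F, hF, hFc⟩ := exists_finite_cover hZd.compl hZr
  have hZ' := hZd.dm
  have key : ∃ s : G → G, DM S s ∧ (∀ u, ∀ v ∈ V, s (u * v) = s u) ∧
      ∀ u, (∃ h ∈ F, h * u ∈ Z) → u⁻¹ * s u ∈ V := by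
    clear hFc
    induction F, hF using Set.Finite.induction_on with
    | empty => exact ⟨fun _ => 1, by fun_prop, fun _ _ _ => rfl, by simp⟩
    | @insert h F _ _ ih =>
      obtain ⟨s, hs, hsV, hsF⟩ := ih
      refine ⟨fun u => if h * u ∈ Z then h⁻¹ * s₀ (h * u) else s u,
        DM.ite (by fun_prop) (by fun_prop) hs, fun u v hv => ?_, fun u hu => ?_⟩
      · simp only [← mul_assoc, hZV _ v hv, hs₀V _ v hv, hsV u v hv]
      · by_cases hZu : h * u ∈ Z
        · have h1 : (h * u)⁻¹ * s₀ (h * u) ∈ V := hZu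
          simpa [hZu, mul_assoc] using h1
        · simp only [hZu, if_false]
          obtain ⟨g, hg, hgu⟩ := hu
          rcases hg with rfl | hg
          · exact (hZu hgu).elim
          · exact hsF u ⟨g, hg, hgu⟩
  obtain ⟨s, hs, hsV, hsF⟩ := key
  refine ⟨s, hs, hsV, fun u => hsF u ?_⟩
  obtain ⟨h, hh, hu⟩ := hFc u
  exact ⟨h, hh, not_not.1 hu⟩

end Choice

end OMin

namespace OMin

section GroupTopology

variable {N : Type u} [LinearOrder N] [DenselyOrdered N] [NoMinOrder N] [NoMaxOrder N]
  [Nonempty N] [TopologicalSpace N] [OrderTopology N] {S : Struc N}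
  {G X : Type*} [DefTy S G] [DefTy S X]

theorem DM.tendsto_comap {m : ℕ} {val : G → Fin m → N} (hv : DM S val) {T : X → G → G}
    (hT : DM S (fun p : X × G => T p.1 p.2)) {x y : X → G} (hx : DM S x) (hy : DM S y) :
    DM S (fun a => Tendsto (T a) (comap val (𝓝 (val (x a)))) (comap val (𝓝 (val (y a))))) := by
  refine DM.iff_congr (P := fun a => ∀ l r, val (y a) ∈ box l r →
    ∃ l' r', val (x a) ∈ box l' r' ∧ ∀ z, val z ∈ box l' r' → val (T a z) ∈ box l r)
    (by fun_prop) fun a => ?_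
  rw [tendsto_comap_iff]
  constructor
  · intro h l r hlr
    obtain ⟨s, hs, hsub⟩ := h ((isOpen_box l r).mem_nhds hlr)
    obtain ⟨l', r', h1, h2⟩ := mem_nhds_iff_box.1 hs
    exact ⟨l', r', h1, fun z hz => hsub (h2 hz)⟩
  · intro h s hs
    obtain ⟨l, r, h1, h2⟩ := mem_nhds_iff_box.1 hs
    obtain ⟨l', r', h3, h4⟩ := h l r h1
    exact ⟨box l' r', (isOpen_box l' r').mem_nhds h3, fun z hz => h2 (h4 z hz)⟩

theorem exists_notMem_of_rk_lt {A B : Set X} (hA : rk S A < rk S (univ : Set X))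
    (hB : rk S B < rk S (univ : Set X)) : ∃ x, x ∉ A ∧ x ∉ B := by
  by_contra! h
  have h1 := rk_mono (S := S) (show univ ⊆ A ∪ B from fun x _ => or_iff_not_imp_left.2 (h x))
  rw [rk_union] at h1
  exact absurd h1 (not_le.2 (max_lt hA hB))

theorem rk_union_lt {A B : Set X} {k : ℕ} (hA : rk S A < k) (hB : rk S B < k) :
    rk S (A ∪ B) < k := by
  rw [rk_union]
  exact max_lt hA hB

theorem rk_preimage_lt {f g : X → X} (hf : DM S f) (hgf : ∀ x, g (f x) = x) {A : Set X}
    (hA : DSet S A) (h : rk S A < rk S (univ : Set X)) :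
    rk S (f ⁻¹' A) < rk S (univ : Set X) :=
  (rk_le_of_injOn hf (hf.preimage hA) (Function.LeftInverse.injective hgf).injOn
    fun _ hx => hx).trans_lt h

/-- A definable subset of a product whose fibres are all small is small. -/
theorem rk_prod_lt_of_fibers [Nonempty X] {A : Set (X × X)} (hA : DSet S A) {f : X × X → X}
    (hf : DM S f) (h : ∀ x, rk S {p | p ∈ A ∧ f p = x} < rk S (univ : Set X)) :
    rk S A < rk S (univ : Set (X × X)) := by
  have h0 : 1 ≤ rk S (univ : Set X) := rk_pos.2 univ_nonempty
  have h1 := rk_prod (S := S) (X := X) (Y := X) DSet.univ DSet.univ univ_nonempty univ_nonempty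
  have h2 : rk S {p : X × X | p.1 ∈ univ ∧ p.2 ∈ univ} = rk S (univ : Set (X × X)) := by
    congr 1
    ext p
    exact ⟨fun _ => mem_univ _, fun _ => ⟨mem_univ _, mem_univ _⟩⟩
  rw [h2] at h1
  obtain hk | ⟨k, hk⟩ : rk S (univ : Set X) = 1 ∨ ∃ k, rk S (univ : Set X) = k + 2 := by
    obtain ⟨k, hk⟩ := Nat.exists_eq_add_of_le' h0
    cases k with
    | zero => exact Or.inl hk
    | succ k => exact Or.inr ⟨k, hk⟩
  · have hA0 : A = ∅ := by
      by_contra hne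
      obtain ⟨p, hp⟩ := nonempty_iff_ne_empty.2 hne
      have h3 := h (f p)
      rw [hk, Nat.lt_one_iff, rk_eq_zero] at h3
      exact (h3.subset (show p ∈ {q | q ∈ A ∧ f q = f p} from ⟨hp, rfl⟩)).elim
    rw [rk_eq_zero.2 hA0]
    omega
  · have h3 := rk_le_of_fibers hf hA (k := k) fun y => by have := h y; omega
    have h4 := rk_mono (S := S) (subset_univ (f '' A))
    omega

/-- A small definable subset of a product has a small fibre. -/
theorem exists_fiber_rk_lt [Nonempty X] {A : Set (X × X)} (hA : DSet S A) {f : X × X → X}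
    (hf : DM S f) (h : rk S A < rk S (univ : Set (X × X))) :
    ∃ x, rk S {p | p ∈ A ∧ f p = x} < rk S (univ : Set X) := by
  by_contra! hc
  have h0 : 1 ≤ rk S (univ : Set X) := rk_pos.2 univ_nonempty
  have h1 := rk_prod (S := S) (X := X) (Y := X) DSet.univ DSet.univ univ_nonempty univ_nonempty
  have h2 := rk_mono (S := S) (subset_univ {p : X × X | p.1 ∈ univ ∧ p.2 ∈ univ})
  have h2' : rk S (univ : Set (X × X)) ≤ rk S {p : X × X | p.1 ∈ univ ∧ p.2 ∈ univ} :=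
    rk_mono fun p _ => ⟨mem_univ _, mem_univ _⟩
  obtain ⟨k, hk⟩ := Nat.exists_eq_add_of_le' h0
  have h3 := le_rk_of_fibers hf hA univ_nonempty (k := k) fun y _ => hk ▸ hc y
  omega

variable {m : ℕ} {val : G → Fin m → N}

/-- A definable map is continuous at generic points for the ambient topologies. -/
theorem exists_tendsto_off_small [Nonempty X] {n : ℕ} {vX : X → Fin n → N} (hvX : DM S vX)
    (hi : Function.Injective vX) (hv : DM S val) {f : X → G} (hf : DM S f) :
    ∃ B, DSet S B ∧ rk S B < rk S (univ : Set X) ∧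
      ∀ x ∉ B, Tendsto f (comap vX (𝓝 (vX x))) (comap val (𝓝 (val (f x)))) := by
  obtain ⟨inv, hinv, hiv⟩ := exists_dm_inverse hvX hi
  obtain ⟨B, hB, hBr, hc⟩ := DM.continuousOn_pi_off_small (DSet.univ.image hvX)
    (univ_nonempty.image vX) (hv.comp' (hf.comp' hinv))
  have hBv := hvX.preimage hB
  refine ⟨vX ⁻¹' B, hBv, ?_, fun x hx => ?_⟩
  · exact (rk_le_of_injOn hvX hBv hi.injOn fun z hz => hz).trans_lt
      (hBr.trans_le (rk_image_le hvX DSet.univ))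
  · have h1 : Tendsto (fun z => val (f (inv z))) (𝓝[vX '' univ] (vX x))
        (𝓝 (val (f (inv (vX x))))) := hc _ ⟨x, mem_univ x, rfl⟩ hx
    have h2 : Tendsto vX (comap vX (𝓝 (vX x))) (𝓝[vX '' univ] (vX x)) :=
      tendsto_inf.2 ⟨tendsto_comap, tendsto_principal.2 (univ_mem' fun y => ⟨y, mem_univ y, rfl⟩)⟩
    have h3 := h1.comp h2
    rw [hiv] at h3
    exact tendsto_comap_iff.2 (h3.congr fun w => by simp [hiv])

theorem DM.append {k n : ℕ} {f : X → Fin k → N} {g : X → Fin n → N} (hf : DM S f)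
    (hg : DM S g) : DM S (fun x => Fin.append (f x) (g x)) := by
  refine DM.pi fun i => ?_
  refine Fin.addCases (fun i => ?_) (fun i => ?_) i
  · simpa using hf.apply i
  · simpa using hg.apply i

theorem exists_tendsto₂_off_small [Nonempty G] (hv : DM S val) (hvi : Function.Injective val)
    {f : G × G → G} (hf : DM S f) :
    ∃ B, DSet S B ∧ rk S B < rk S (univ : Set (G × G)) ∧ ∀ p ∉ B,
      Tendsto f (comap val (𝓝 (val p.1)) ×ˢ comap val (𝓝 (val p.2)))
        (comap val (𝓝 (val (f p)))) := by
  have hv2 : DM S (fun p : G × G => Fin.append (val p.1) (val p.2)) :=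
    DM.append (by fun_prop) (by fun_prop)
  obtain ⟨B, hB, hBr, hc⟩ := exists_tendsto_off_small hv2 (fun p q h => by
    have h1 := (Fin.appendEquiv (α := N) m m).injective
      (show Fin.appendEquiv m m (val p.1, val p.2) = Fin.appendEquiv m m (val q.1, val q.2) from h)
    rw [Prod.mk.injEq] at h1
    exact Prod.ext (hvi h1.1) (hvi h1.2)) hv hf
  refine ⟨B, hB, hBr, fun p hp => (hc p hp).mono_left ?_⟩
  rw [← tendsto_iff_comap]
  have h1 : Continuous fun p : (Fin m → N) × (Fin m → N) => Fin.append p.1 p.2 :=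
    (Fin.appendHomeomorph (X := N) m m).continuous
  have h2 : Tendsto (Prod.map val val) (comap val (𝓝 (val p.1)) ×ˢ comap val (𝓝 (val p.2)))
      (𝓝 (val p.1, val p.2)) := by
    rw [nhds_prod_eq]
    exact tendsto_comap.prodMap tendsto_comap
  exact (h1.tendsto _).comp h2

theorem exists_isTopologicalGroup_of_filter {G : Type*} [Group G] {F : Filter G}
    (hF : pure 1 ≤ F) (hmul : Tendsto (Function.uncurry ((· * ·) : G → G → G)) (F ×ˢ F) F)
    (hinv : Tendsto (fun x : G => x⁻¹) F F) (hconj : ∀ g : G, Tendsto (g * · * g⁻¹) F F) :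
    ∃ t : TopologicalSpace G, IsTopologicalGroup G ∧ ∀ x : G, 𝓝 x = map (x * ·) F := by
  letI t : TopologicalSpace G := TopologicalSpace.mkOfNhds fun x => map (x * ·) F
  have h : ∀ x : G, 𝓝 x = map (x * ·) F := by
    refine fun x => TopologicalSpace.nhds_mkOfNhds _ _ (fun a s hs => ?_) fun a s hs => ?_
    · have h1 := hF (mem_map.1 hs)
      rwa [mem_pure, mem_preimage, mul_one] at h1
    · have h1 : ∀ᶠ p in F ×ˢ F, a * (p.1 * p.2) ∈ s := hmul.eventually hs
      rw [eventually_map]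
      filter_upwards [h1.curry] with z hz
      rw [mem_map]
      filter_upwards [hz] with w hw
      rwa [mem_preimage, mul_assoc]
  have h1 : 𝓝 (1 : G) = F := by rw [h]; simp
  refine ⟨t, IsTopologicalGroup.of_nhds_one ?_ ?_ ?_ ?_, h⟩ <;> simpa only [h1]

theorem exists_dGrp [Group G] (hv : DM S val) (hvi : Function.Injective val)
    (hmul : DM S (fun p : G × G => p.1 * p.2)) (hinv : DM S (fun x : G => x⁻¹)) :
    ∃ _ : TopologicalSpace G, DGrp S G := by
  have hmulr : ∀ g : G, DM S (fun x => x * g) := fun g =>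
    hmul.comp' (f := fun x => (x, g)) (by fun_prop)
  have hmull : ∀ g : G, DM S (fun x => g * x) := fun g =>
    hmul.comp' (f := fun x => (g, x)) (by fun_prop)
  set ν : G → Filter G := fun x => comap val (𝓝 (val x)) with hν
  set T : G → G → Prop := fun x y => Tendsto (fun z => y * x⁻¹ * z) (ν x) (ν y) with hTdef
  have hT : DM S (fun p : G × G => T p.1 p.2) := by
    refine DM.tendsto_comap hv (X := G × G) (T := fun p z => p.2 * p.1⁻¹ * z) ?_ (by fun_prop)
      (by fun_prop)
    have h1 : DM S (fun q : (G × G) × G => q.1.2 * q.1.1⁻¹) :=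
      hmul.comp' (f := fun q : (G × G) × G => (q.1.2, q.1.1⁻¹)) (by fun_prop)
    exact hmul.comp' (f := fun q : (G × G) × G => (q.1.2 * q.1.1⁻¹, q.2)) (by fun_prop)
  have hR : DM S (fun p : G × G => T p.1 p.2 ∧ T p.2 p.1) :=
    hT.and (hT.comp' (f := fun p : G × G => (p.2, p.1)) (by fun_prop))
  have hD : DSet S {p : G × G | ¬ (T p.2 (p.1 * p.2) ∧ T (p.1 * p.2) p.2)} :=
    (hR.comp' (f := fun p : G × G => (p.2, p.1 * p.2)) (by fun_prop)).not.pred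
  have hDr := rk_prod_lt_of_fibers hD (f := Prod.fst) (by fun_prop) fun g => by
    obtain ⟨B₁, hB₁, hB₁r, h₁⟩ := exists_tendsto_off_small hv hvi hv (hmull g)
    obtain ⟨B₂, hB₂, hB₂r, h₂⟩ := exists_tendsto_off_small hv hvi hv (hmull g⁻¹)
    have hB₂' := rk_preimage_lt (hmull g) (g := fun x => g⁻¹ * x) (by simp) hB₂ hB₂r
    refine lt_of_le_of_lt ?_ (rk_union_lt hB₁r hB₂')
    have hDg : DSet S {p : G × G | p ∈ {p : G × G | ¬ (T p.2 (p.1 * p.2) ∧ T (p.1 * p.2) p.2)} ∧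
        p.1 = g} := by
      have hD' := hD.dm
      exact DM.pred (by fun_prop)
    refine rk_le_of_injOn (f := Prod.snd) (by fun_prop) hDg
      (fun p hp q hq h => Prod.ext (hp.2.trans hq.2.symm) h) fun p hp => ?_
    obtain ⟨g', x⟩ := p
    obtain ⟨hp, rfl⟩ := hp
    by_contra hx
    obtain ⟨hx₁, hx₂⟩ := not_or.1 hx
    refine hp ⟨?_, ?_⟩
    · exact (h₁ x hx₁).congr fun z => by simp
    · have h3 : Tendsto (fun z => g'⁻¹ * z) (ν (g' * x)) (ν (g'⁻¹ * (g' * x))) := h₂ _ hx₂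
      rw [inv_mul_cancel_left] at h3
      exact h3.congr fun z => by simp
  obtain ⟨x₀, hx₀⟩ := exists_fiber_rk_lt hD (f := Prod.snd) (by fun_prop) hDr
  set C : Set G := {y | T x₀ y ∧ T y x₀} with hCdef
  have hC : DSet S C := (hR.comp' (f := fun y => (x₀, y)) (by fun_prop)).pred
  have hCr : rk S Cᶜ < rk S (univ : Set G) := by
    refine lt_of_le_of_lt ?_ hx₀
    have h1 := hmulr x₀⁻¹
    refine rk_le_of_injOn (f := fun y => (y * x₀⁻¹, x₀)) (by fun_prop) hC.compl
      (fun y _ z _ h => mul_right_cancel (Prod.ext_iff.1 h).1) fun y hy => ⟨?_, rfl⟩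
    simpa [hCdef] using hy
  set F : Filter G := map (x₀⁻¹ * ·) (ν x₀) with hF
  have hνC : ∀ y ∈ C, ν y = map (y * ·) F := fun y hy => by
    refine le_antisymm ?_ ?_
    · have h1 : Tendsto (fun z => x₀⁻¹ * (x₀ * y⁻¹ * z)) (ν y) F := tendsto_map.comp hy.2
      have h2 := (tendsto_map (f := (y * ·)) (x := F)).comp h1
      refine (tendsto_id'.1 (h2.congr fun z => ?_))
      simp [mul_assoc]
    · rw [hF, map_map]
      exact hy.1.congr fun z => mul_assoc _ _ _
  have hcancel : ∀ {Y : Type _} {L : Filter Y} {f : Y → G} {a : G},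
      Tendsto f L (map (a * ·) F) → Tendsto (fun y => a⁻¹ * f y) L F := fun {Y L f a} h => by
    have h1 : Tendsto (a⁻¹ * ·) (map (a * ·) F) F := by
      rw [tendsto_map'_iff]
      exact tendsto_id.congr fun z => by simp
    exact h1.comp h
  have hconj : ∀ g : G, Tendsto (g * · * g⁻¹) F F := fun g => by
    obtain ⟨B, hB, hBr, hc⟩ := exists_tendsto_off_small hv hvi hv (hmulr g⁻¹)
    obtain ⟨x, hx₁, hx₂⟩ := exists_notMem_of_rk_lt
      (rk_union_lt hCr (rk_preimage_lt (hmulr g⁻¹) (g := fun x => x * g) (by simp) hC.compl hCr)) hBr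
    obtain ⟨hx₃, hx₄⟩ := not_or.1 hx₁
    have h1 : Tendsto (fun z => z * g⁻¹) (ν x) (ν (x * g⁻¹)) := hc x hx₂
    rw [hνC x (not_not.1 hx₃), hνC _ (not_not.1 hx₄)] at h1
    refine (hcancel (h1.comp tendsto_map)).congr fun z => ?_
    simp [mul_assoc]
  have hinvF : Tendsto (fun x : G => x⁻¹) F F := by
    obtain ⟨B, hB, hBr, hc⟩ := exists_tendsto_off_small hv hvi hv hinv
    obtain ⟨x, hx₁, hx₂⟩ := exists_notMem_of_rk_lt
      (rk_union_lt hCr (rk_preimage_lt hinv (g := fun x => x⁻¹) (by simp) hC.compl hCr)) hBr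
    obtain ⟨hx₃, hx₄⟩ := not_or.1 hx₁
    have h1 : Tendsto (fun z => z⁻¹) (ν x) (ν x⁻¹) := hc x hx₂
    rw [hνC x (not_not.1 hx₃), hνC _ (not_not.1 hx₄)] at h1
    refine ((hconj x⁻¹).comp (hcancel (h1.comp tendsto_map))).congr fun z => ?_
    simp [mul_assoc]
  have hmulF : Tendsto (Function.uncurry ((· * ·) : G → G → G)) (F ×ˢ F) F := by
    obtain ⟨B, hB, hBr, hc⟩ := exists_tendsto₂_off_small hv hvi hmul
    have hsmall : ∀ {f : G × G → G}, DM S f → ∀ {e : G × G → G}, DM S e →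
        (∀ p q : G × G, f p = f q → e p = e q → p = q) →
        rk S {p | f p ∉ C} < rk S (univ : Set (G × G)) := fun {f} hf {e} he hfe => by
      refine rk_prod_lt_of_fibers (hf.preimage hC.compl) he fun x => ?_
      refine lt_of_le_of_lt ?_ hCr
      have hC' := hC.dm
      have h1 : DSet S {p : G × G | p ∈ f ⁻¹' Cᶜ ∧ e p = x} := DM.pred (by
        refine DM.and (hC'.comp' hf).not (by fun_prop))
      exact rk_le_of_injOn hf h1 (fun p hp q hq h => hfe p q h (hp.2.trans hq.2.symm))
        fun p hp => hp.1
    have h1 := hsmall (f := Prod.fst) (by fun_prop) (e := Prod.snd) (by fun_prop)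
      fun p q h h' => Prod.ext h h'
    have h2 := hsmall (f := Prod.snd) (by fun_prop) (e := Prod.fst) (by fun_prop)
      fun p q h h' => Prod.ext h' h
    have h3 := hsmall hmul (e := Prod.fst) (by fun_prop) fun p q h h' =>
      Prod.ext h' (mul_left_cancel (a := p.1) (h.trans (by rw [h'])))
    obtain ⟨⟨x, y⟩, hp₁, hp₂⟩ := exists_notMem_of_rk_lt (rk_union_lt h1 h2) (rk_union_lt h3 hBr)
    obtain ⟨hx, hy⟩ := not_or.1 hp₁
    obtain ⟨hxy, hB'⟩ := not_or.1 hp₂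
    have h4 : Tendsto (fun p : G × G => p.1 * p.2) (ν x ×ˢ ν y) (ν (x * y)) := hc _ hB'
    rw [hνC x (not_not.1 hx), hνC y (not_not.1 hy), hνC _ (not_not.1 hxy)] at h4
    have h5 := hcancel (h4.comp ((tendsto_map (f := (x * ·))).prodMap (tendsto_map (f := (y * ·)))))
    refine (h5.comp ((hconj y).prodMap tendsto_id)).congr fun p => ?_
    simp [mul_assoc, Function.uncurry]
  have hpure : pure 1 ≤ F := by
    have h1 : pure x₀ ≤ ν x₀ := by
      rw [hν, ← map_le_iff_le_comap, Filter.map_pure]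
      exact pure_le_nhds _
    have h2 := map_mono (m := (x₀⁻¹ * ·)) h1
    rwa [Filter.map_pure, inv_mul_cancel] at h2
  obtain ⟨t, ht, hnhds⟩ := exists_isTopologicalGroup_of_filter hpure hmulF hinvF hconj
  refine ⟨t, { ht with
    dm_mul := hmul
    dm_inv := hinv
    exists_chart := ?_ }⟩
  obtain ⟨hB, hBr⟩ := rk_not_mem_nhdsWithin_lt (hC.image hv) (DSet.univ.image hv)
    ((univ_nonempty (α := G)).image val)
  set B := {z | z ∈ val '' C ∧ z ∈ val '' univ ∧ val '' C ∉ 𝓝[val '' univ] z} with hBdef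
  have hνmem : ∀ x ∈ (Cᶜ ∪ val ⁻¹' B)ᶜ, C ∈ ν x ∧ x ∈ C := fun x hx => by
    obtain ⟨hx₁, hx₂⟩ := not_or.1 hx
    rw [notMem_compl_iff] at hx₁
    have h1 : val '' C ∈ 𝓝[val '' univ] (val x) := by
      by_contra h
      exact hx₂ ⟨⟨x, hx₁, rfl⟩, ⟨x, mem_univ x, rfl⟩, h⟩
    have h2 := preimage_mem_comap (m := val) h1
    rw [preimage_image_eq _ hvi, image_univ, comap_nhdsWithin_range] at h2
    exact ⟨h2, hx₁⟩
  refine ⟨m, val, (Cᶜ ∪ val ⁻¹' B)ᶜ, hv, hvi, (hC.compl.union (hv.preimage hB)).compl, ?_,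
    fun x hx => ?_⟩
  · rw [compl_compl]
    refine rk_union_lt hCr ((rk_le_of_injOn hv (hv.preimage hB) hvi.injOn fun z hz => hz).trans_lt
      (hBr.trans_le (rk_image_le hv DSet.univ)))
  · rw [hnhds, ← hνC x (hνmem x hx).2, nhdsWithin, comap_inf, comap_principal,
      preimage_image_eq _ hvi]
    refine (inf_eq_left.2 (le_principal_iff.2 ?_)).symm
    obtain ⟨s, hs, hsC⟩ := (hνmem x hx).1
    obtain ⟨O, hOs, hO, hxO⟩ := mem_nhds_iff.1 hs
    refine ⟨O, hO.mem_nhds hxO, fun y hy h => ?_⟩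
    have hyC : C ∈ ν y := ⟨O, hO.mem_nhds hy, fun w hw => hsC (hOs hw)⟩
    obtain h | h := h
    · exact h (hsC (hOs hy))
    · refine h.2.2 ?_
      have h1 : 𝓝[val '' univ] (val y) = map val (ν y) := by
        rw [image_univ, hν, map_comap, nhdsWithin]
      rw [h1]
      exact image_mem_map hyC

end GroupTopology

end OMin

namespace OMin

section Quotients

variable {N : Type u} [LinearOrder N] [DenselyOrdered N] [NoMinOrder N] [NoMaxOrder N]
  [Nonempty N] {S : Struc N} {X : Type*} [DefTy S X]

theorem DM.comp_index {m n : ℕ} {f : X → Fin m → N} (hf : DM S f) (p : Fin n → Fin m) :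
    DM S (fun x => f x ∘ p) :=
  DM.pi fun i => hf.apply (p i)

variable [TopologicalSpace N] [OrderTopology N]

theorem defFunOn_iff {m n : ℕ} {A : Set (Fin m → N)} {f : (Fin m → N) → Fin n → N} :
    S.DefFunOn A f ↔ DSet S {p : (Fin m → N) × (Fin n → N) | p.1 ∈ A ∧ f p.1 = p.2} := by
  rw [Struc.DefFunOn, ← DSet.fin_iff]
  constructor
  · intro h
    have h1 : DM S (fun p : (Fin m → N) × (Fin n → N) => Fin.append p.1 p.2) :=
      DM.append (by fun_prop) (by fun_prop)
    refine (h1.preimage h).congr fun p => ?_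
    change _ ↔ Fin.append p.1 p.2 ∘ Fin.castAdd n ∈ A ∧
      f (Fin.append p.1 p.2 ∘ Fin.castAdd n) = Fin.append p.1 p.2 ∘ Fin.natAdd m
    rw [show Fin.append p.1 p.2 ∘ Fin.castAdd n = p.1 from funext fun i => by simp,
      show Fin.append p.1 p.2 ∘ Fin.natAdd m = p.2 from funext fun i => by simp]
    rfl
  · intro h
    have h1 : DM S (fun z : Fin (m + n) → N => (z ∘ Fin.castAdd n, z ∘ Fin.natAdd m)) :=
      (DM.comp_index (by fun_prop) _).prodMk (DM.comp_index (by fun_prop) _)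
    exact h1.preimage h

theorem defFun2_iff {m n k : ℕ} {A : Set (Fin m → N)} {B : Set (Fin n → N)}
    {f : (Fin m → N) → (Fin n → N) → Fin k → N} :
    S.DefFun2 A B f ↔ DSet S {p : ((Fin m → N) × (Fin n → N)) × (Fin k → N) |
      p.1.1 ∈ A ∧ p.1.2 ∈ B ∧ f p.1.1 p.1.2 = p.2} := by
  rw [Struc.DefFun2, ← DSet.fin_iff]
  constructor
  · intro h
    have h1 : DM S (fun p : ((Fin m → N) × (Fin n → N)) × (Fin k → N) =>
        Fin.append (Fin.append p.1.1 p.1.2) p.2) :=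
      DM.append (DM.append (by fun_prop) (by fun_prop)) (by fun_prop)
    refine (h1.preimage h).congr fun p => ?_
    set z := Fin.append (Fin.append p.1.1 p.1.2) p.2 with hz
    change _ ↔ z ∘ Fin.castAdd k ∘ Fin.castAdd n ∈ A ∧ z ∘ Fin.castAdd k ∘ Fin.natAdd m ∈ B ∧
      f (z ∘ Fin.castAdd k ∘ Fin.castAdd n) (z ∘ Fin.castAdd k ∘ Fin.natAdd m) =
        z ∘ Fin.natAdd (m + n)
    rw [show z ∘ Fin.castAdd k ∘ Fin.castAdd n = p.1.1 from funext fun i => by simp [hz],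
      show z ∘ Fin.castAdd k ∘ Fin.natAdd m = p.1.2 from funext fun i => by simp [hz],
      show z ∘ Fin.natAdd (m + n) = p.2 from funext fun i => by simp [hz]]
    rfl
  · intro h
    have h1 : DM S (fun z : Fin (m + n + k) → N => ((z ∘ Fin.castAdd k ∘ Fin.castAdd n,
        z ∘ Fin.castAdd k ∘ Fin.natAdd m), z ∘ Fin.natAdd (m + n))) :=
      ((DM.comp_index (by fun_prop) _).prodMk (DM.comp_index (by fun_prop) _)).prodMk
        (DM.comp_index (by fun_prop) _)
    exact h1.preimage h

variable {m : ℕ} (U : DefGroup S m)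

/-- The inclusion of a definable group in its ambient power of `N`. -/
def eltVal : U.Elt → Fin m → N := Subtype.val

instance defTyElt : DefTy S U.Elt where
  Ix := Fin m
  emb := eltVal U
  inj := Subtype.val_injective
  range_def := by
    rw [DI_fin]
    convert U.carrier_def
    exact Subtype.range_coe

theorem DM.eltVal : DM S (eltVal U) :=
  CoordMap.dm ⟨id, fun _ => rfl⟩

theorem dm_mul_elt : DM S (fun p : U.Elt × U.Elt => p.1 * p.2) := by
  have hv := DM.eltVal U
  have h1 : DM S (fun p : (U.Elt × U.Elt) × U.Elt =>
      ((OMin.eltVal U p.1.1, OMin.eltVal U p.1.2), OMin.eltVal U p.2)) :=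
    ((hv.comp' (by fun_prop)).prodMk (hv.comp' (by fun_prop))).prodMk (hv.comp' (by fun_prop))
  refine DSet.congr (h1.preimage (defFun2_iff.1 U.mul_graph_def)) fun p => ?_
  exact Subtype.ext_iff.trans ⟨fun h => ⟨p.1.1.2, p.1.2.2, h.symm⟩, fun h => h.2.2.symm⟩

theorem dm_inv_elt : DM S (fun x : U.Elt => x⁻¹) := by
  have hv := DM.eltVal U
  have h1 : DM S (fun p : U.Elt × U.Elt => (OMin.eltVal U p.1, OMin.eltVal U p.2)) :=
    (hv.comp' (by fun_prop)).prodMk (hv.comp' (by fun_prop))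
  refine DSet.congr (h1.preimage (defFunOn_iff.1 U.inv_graph_def)) fun p => ?_
  exact Subtype.ext_iff.trans ⟨fun h => ⟨p.1.2, h.symm⟩, fun h => h.2.symm⟩

/-- The definable group carried by a definable set of representatives of the cosets of a normal
subgroup. -/
theorem exists_quotient_defGroup {G : Type*} [Group G] [TopologicalSpace G] [DefTy S G]
    [DGrp S G] (V : Subgroup G) [V.Normal] (hV : DSet S (V : Set G)) {val : G → Fin m → N}
    (hv : DM S val) (hvi : Function.Injective val) :
    ∃ (Q : DefGroup S m) (q : G → Fin m → N), DM S q ∧ Q.carrier = range q ∧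
      (∀ x y, q x = q y ↔ y⁻¹ * x ∈ V) ∧ ∀ x y, q (x * y) = Q.mul (q x) (q y) := by
  obtain ⟨s, hs, hsV, hsu⟩ := exists_transversal hV
  obtain ⟨e, he, hev⟩ := exists_dm_inverse hv hvi
  have hmk : ∀ u, (s u : G ⧸ V) = u := fun u => (QuotientGroup.eq.2 (hsu u)).symm
  have hs_iff : ∀ u w, s u = s w ↔ (u : G ⧸ V) = w := fun u w => by
    refine ⟨fun h => by rw [← hmk u, h, hmk], fun h => ?_⟩
    rw [← hsV u _ (QuotientGroup.eq.1 h), mul_inv_cancel_left]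
  have hval : ∀ {u w : G}, (u : G ⧸ V) = w → val (s u) = val (s w) := fun {u w} h =>
    congrArg val ((hs_iff u w).2 h)
  have hss : ∀ u, s (s u) = s u := fun u => (hs_iff _ _).2 (hmk u)
  have hC : DSet S (range fun u => val (s u)) :=
    (DSet.univ.image (hv.comp' hs)).congr fun x => by rw [image_univ]
  have hC' := hC.dm
  let Q : DefGroup S m :=
    { carrier := range fun u => val (s u)
      carrier_def := DSet.fin_iff.1 hC
      mul := fun z w => val (s (e z * e w))
      one := val (s 1)
      inv := fun z => val (s (e z)⁻¹)
      one_mem := ⟨1, rfl⟩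
      mul_mem := fun _ _ _ _ => ⟨_, rfl⟩
      inv_mem := fun _ _ => ⟨_, rfl⟩
      mul_assoc' := by
        rintro _ _ _ ⟨x, rfl⟩ ⟨y, rfl⟩ ⟨z, rfl⟩
        exact hval (by simp [hev, hmk, mul_assoc])
      one_mul' := by
        rintro _ ⟨x, rfl⟩
        exact hval (by simp [hev, hmk])
      inv_mul' := by
        rintro _ ⟨x, rfl⟩
        exact hval (by simp [hev, hmk])
      mul_graph_def := by
        rw [defFun2_iff]
        exact DM.pred (by fun_prop)
      inv_graph_def := by
        rw [defFunOn_iff]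
        exact DM.pred (by fun_prop)
      top := ⊤
      contMul := @Continuous.continuousOn _ _ (_) ⊤ _ _ continuous_top
      contInv := @Continuous.continuousOn _ _ ⊤ ⊤ _ _ continuous_top
      pillay := ⟨_, subset_rfl, DSet.fin_iff.1 hC, Or.inl (diff_self),
        ⟨univ, @isOpen_univ _ ⊤, univ_inter _⟩, fun _ _ => rfl⟩ }
  refine ⟨Q, fun u => val (s u), hv.comp' hs, rfl, fun x y => ?_, fun x y => ?_⟩
  · rw [hvi.eq_iff, hs_iff, eq_comm, QuotientGroup.eq]
  · exact hval (by simp [hev, hmk])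

end Quotients

end OMin

/-- quotients of definable groups by definable normal subgroups are
definable: there is a definable map `π : U → N^k` whose fibers on `U` are exactly
the cosets of `V`, and `U/V` inherits the structure of a definable group. -/
theorem stmt_0 {N : Type u} [LinearOrder N] [DenselyOrdered N] [NoMinOrder N]
    [NoMaxOrder N] [Nonempty N] [TopologicalSpace N] [OrderTopology N]
    (S : Struc N) {m : ℕ} (U : DefGroup S m) (V : Set (Fin m → N))
    (hV : U.IsNormalDefSubgroup V) :
    ∃ (k : ℕ) (π : (Fin m → N) → (Fin k → N)),
      S.DefFunOn U.carrier π ∧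
      (∀ x ∈ U.carrier, ∀ y ∈ U.carrier, (π x = π y ↔ U.mul (U.inv y) x ∈ V)) ∧
      ∃ Q : DefGroup S k, Q.carrier = π '' U.carrier ∧ IsDefHom U Q π := by
  obtain ⟨⟨-, hVd, hone, hmul, hinv⟩, hnormal⟩ := hV
  have hv := OMin.DM.eltVal U
  have hvi : Function.Injective (OMin.eltVal U) := Subtype.val_injective
  obtain ⟨t, ht⟩ := OMin.exists_dGrp hv hvi (OMin.dm_mul_elt U) (OMin.dm_inv_elt U)
  let V' : Subgroup U.Elt :=
    { carrier := {x | x.1 ∈ V}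
      one_mem' := hone
      mul_mem' := fun {x y} hx hy => hmul x.1 hx y.1 hy
      inv_mem' := fun {x} hx => hinv x.1 hx }
  have : V'.Normal := ⟨fun n hn g => hnormal g.1 g.2 n.1 hn⟩
  obtain ⟨Q, q, hq, hQ, hfib, hhom⟩ := OMin.exists_quotient_defGroup V'
    (hv.preimage (OMin.DSet.fin_iff.2 hVd)) hv hvi
  obtain ⟨e, he, hev⟩ := OMin.exists_dm_inverse hv hvi
  have hπ : ∀ (x) (hx : x ∈ U.carrier), q (e x) = q ⟨x, hx⟩ := fun x hx =>
    congrArg q (hev ⟨x, hx⟩)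
  have hdef : S.DefFunOn U.carrier fun x => q (e x) := by
    rw [OMin.defFunOn_iff]
    have hC := (OMin.DSet.fin_iff.2 U.carrier_def).dm
    exact OMin.DM.pred (by fun_prop)
  refine ⟨m, fun x => q (e x), hdef, fun x hx y hy => ?_, Q, ?_, fun x hx => ?_, hdef,
    fun x hx y hy => ?_⟩
  · show q (e x) = q (e y) ↔ _
    rw [hπ x hx, hπ y hy]
    exact hfib _ _
  · rw [hQ]
    ext z
    constructor
    · rintro ⟨u, rfl⟩
      exact ⟨u.1, u.2, hπ u.1 u.2⟩
    · rintro ⟨x, hx, rfl⟩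
      exact ⟨_, rfl⟩
  · rw [hQ]
    exact ⟨_, rfl⟩
  · show q (e (U.mul x y)) = Q.mul (q (e x)) (q (e y))
    rw [hπ x hx, hπ y hy, hπ _ (U.mul_mem hx hy)]
    exact hhom ⟨x, hx⟩ ⟨y, hy⟩
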